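/- Let G = ⟨S|R⟩ be a C'(1/9) group and X = Cay(G,S) its Cayley graph with basepoint the identity. Then the following are equivalent: (1) X satisfies the Morse local-to-global property; (2) the Morse boundary of G is σ-compact, i.e. there is a sequence (M_n) of Morse gauges such that every Morse geodesic ray in X based at the identity is M_n-Morse for some n; (3) the Morse boundary of G is strongly σ-compact, i.e. there is such a sequence (M_n) with the additional property that for every Morse gauge M there exists n such that every M-Morse geodesic ray based at the identity is M_n-Morse. -/

import Mathlib

open Metric Set Filter

namespace MorseLTG

/-- A Morse gauge: a non-decreasing continuous function `[1, ∞) → [0, ∞)`. -/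
def IsMorseGauge (M : ℝ → ℝ) : Prop :=
  MonotoneOn M (Set.Ici 1) ∧ ContinuousOn M (Set.Ici 1) ∧ ∀ t : ℝ, 1 ≤ t → 0 ≤ M t

section Space

variable {X : Type*} [MetricSpace X]

/-- `γ` is a `Q`-quasi-geodesic on the set `I ⊆ ℝ`. -/
def QGeoOn (Q : ℝ) (I : Set ℝ) (γ : ℝ → X) : Prop :=
  ContinuousOn γ I ∧ ∀ s ∈ I, ∀ t ∈ I,
    |t - s| / Q - Q ≤ dist (γ s) (γ t) ∧ dist (γ s) (γ t) ≤ Q * |t - s| + Q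

/-- `γ` is `M`-Morse on `I`: every `Q`-quasi-geodesic with endpoints on `γ|_I`
stays in the closed `M Q`-neighbourhood of the corresponding subsegment of `γ`. -/
def MorseOn (M : ℝ → ℝ) (I : Set ℝ) (γ : ℝ → X) : Prop :=
  ∀ Q : ℝ, 1 ≤ Q → ∀ s ∈ I, ∀ t ∈ I, s ≤ t →
    ∀ (lam : ℝ → X) (a b : ℝ), a ≤ b → QGeoOn Q (Set.Icc a b) lam →
      lam a = γ s → lam b = γ t →
      ∀ u ∈ Set.Icc a b, ∃ v ∈ Set.Icc s t, dist (lam u) (γ v) ≤ M Q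

/-- `γ` is a geodesic on `I` (an isometric embedding). -/
def GeodesicOn (I : Set ℝ) (γ : ℝ → X) : Prop :=
  ∀ s ∈ I, ∀ t ∈ I, dist (γ s) (γ t) = |t - s|

/-- A geodesic ray based at `x₀`. -/
def GeodesicRayFrom (x₀ : X) (γ : ℝ → X) : Prop :=
  γ 0 = x₀ ∧ GeodesicOn (Set.Ici 0) γ

/-- A Morse geodesic ray (based anywhere). -/
def IsMorseGeodesicRay (γ : ℝ → X) : Prop :=
  GeodesicOn (Set.Ici 0) γ ∧ ∃ M : ℝ → ℝ, IsMorseGauge M ∧ MorseOn M (Set.Ici 0) γ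

/-- `p` is `L`-locally an `M`-Morse `Q`-quasi-geodesic on `I`. -/
def LocMorseQGeoOn (Q : ℝ) (M : ℝ → ℝ) (L : ℝ) (I : Set ℝ) (p : ℝ → X) : Prop :=
  ∀ s ∈ I, ∀ t ∈ I, s ≤ t → t - s ≤ L →
    QGeoOn Q (Set.Icc s t) p ∧ MorseOn M (Set.Icc s t) p

/-- `p` is `L`-locally `M`-Morse on `I`. -/
def LocMorseOn (M : ℝ → ℝ) (L : ℝ) (I : Set ℝ) (p : ℝ → X) : Prop :=
  ∀ s ∈ I, ∀ t ∈ I, s ≤ t → t - s ≤ L → MorseOn M (Set.Icc s t) p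

/-- The Morse local-to-global property for a geodesic metric space. -/
def MLTG (X : Type*) [MetricSpace X] : Prop :=
  ∀ Q : ℝ, 1 ≤ Q → ∀ M : ℝ → ℝ, IsMorseGauge M →
    ∃ (L Q' : ℝ) (M' : ℝ → ℝ), 0 < L ∧ 1 ≤ Q' ∧ IsMorseGauge M' ∧
      ∀ I : Set ℝ, I.OrdConnected → ∀ p : ℝ → X,
        LocMorseQGeoOn Q M L I p → QGeoOn Q' I p ∧ MorseOn M' I p

/-- `X` is a geodesic metric space. -/
def GeodesicSpace (X : Type*) [MetricSpace X] : Prop :=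
  ∀ x y : X, ∃ γ : ℝ → X, γ 0 = x ∧ γ (dist x y) = y ∧
    GeodesicOn (Set.Icc 0 (dist x y)) γ

/-- Gromov hyperbolicity via thin geodesic triangles. -/
def GromovHyperbolic (X : Type*) [MetricSpace X] : Prop :=
  ∃ δ : ℝ, 0 ≤ δ ∧
    ∀ (γ₁ γ₂ γ₃ : ℝ → X) (a₁ b₁ a₂ b₂ a₃ b₃ : ℝ),
      GeodesicOn (Set.Icc a₁ b₁) γ₁ → GeodesicOn (Set.Icc a₂ b₂) γ₂ →
        GeodesicOn (Set.Icc a₃ b₃) γ₃ →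
      γ₁ b₁ = γ₂ a₂ → γ₂ b₂ = γ₃ a₃ → γ₃ b₃ = γ₁ a₁ →
      ∀ s ∈ Set.Icc a₁ b₁,
        ∃ p ∈ γ₂ '' Set.Icc a₂ b₂ ∪ γ₃ '' Set.Icc a₃ b₃, dist (γ₁ s) p ≤ δ

/-- The set of closest-point projections of `x` to `A`. -/
def projSet (A : Set X) (x : X) : Set X :=
  {y ∈ A | ∀ z ∈ A, dist x y ≤ dist x z}

/-- A subset `A` is `C`-contracting. -/
def ContractingSet (C : ℝ) (A : Set X) : Prop :=
  ∀ x : X, Metric.diam (⋃ y ∈ Metric.ball x (Metric.infDist x A), projSet A y) ≤ C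

/-- `γ` is a `C`-contracting geodesic on `I`. -/
def ContractingOn (C : ℝ) (I : Set ℝ) (γ : ℝ → X) : Prop :=
  GeodesicOn I γ ∧ ContractingSet C (γ '' I)

/-- The Morse boundary of `X` (with basepoint `x₀`) is σ-compact. -/
def SigmaCompactMorseBoundary (x₀ : X) : Prop :=
  ∃ Ms : ℕ → ℝ → ℝ, (∀ n, IsMorseGauge (Ms n)) ∧
    ∀ γ : ℝ → X, GeodesicRayFrom x₀ γ → ∀ M : ℝ → ℝ, IsMorseGauge M →
      MorseOn M (Set.Ici 0) γ → ∃ n, MorseOn (Ms n) (Set.Ici 0) γ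

/-- `Ms` is a strong exhaustion of the Morse boundary of `X` based at `x₀`. -/
def IsStrongExhaustion (x₀ : X) (Ms : ℕ → ℝ → ℝ) : Prop :=
  (∀ n, IsMorseGauge (Ms n)) ∧
  (∀ γ : ℝ → X, GeodesicRayFrom x₀ γ → ∀ M : ℝ → ℝ, IsMorseGauge M →
    MorseOn M (Set.Ici 0) γ → ∃ n, MorseOn (Ms n) (Set.Ici 0) γ) ∧
  (∀ M : ℝ → ℝ, IsMorseGauge M → ∃ n, ∀ γ : ℝ → X, GeodesicRayFrom x₀ γ →
    MorseOn M (Set.Ici 0) γ → MorseOn (Ms n) (Set.Ici 0) γ)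

/-- The Morse boundary of `X` (with basepoint `x₀`) is strongly σ-compact. -/
def StronglySigmaCompactMorseBoundary (x₀ : X) : Prop :=
  ∃ Ms : ℕ → ℝ → ℝ, IsStrongExhaustion x₀ Ms

end Space

section Action

variable {G : Type*} [Group G] {X : Type*} [MetricSpace X]

/-- `φ` is an action of `G` on `X` by isometries. -/
def IsIsometricAction (φ : G → X → X) : Prop :=
  (∀ x : X, φ 1 x = x) ∧ (∀ g h : G, ∀ x : X, φ (g * h) x = φ g (φ h x)) ∧
    ∀ g : G, Isometry (φ g)

/-- `φ` is a geometric (proper and cocompact, isometric) action of `G` on `X`. -/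
def IsGeometricAction (φ : G → X → X) : Prop :=
  IsIsometricAction φ ∧
  (∀ (x : X) (r : ℝ), {g : G | dist x (φ g x) ≤ r}.Finite) ∧
  (∃ (x₀ : X) (r : ℝ), ∀ y : X, ∃ g : G, dist y (φ g x₀) ≤ r)

end Action

/-- `G` has contraction: it acts geometrically on some geodesic metric space
containing a strongly contracting geodesic ray. -/
def HasContraction (G : Type*) [Group G] : Prop :=
  ∃ (X : Type) (m : MetricSpace X), ∃ φ : G → X → X,
    letI := m
    IsGeometricAction φ ∧ GeodesicSpace X ∧
      ∃ (γ : ℝ → X) (C : ℝ), 0 ≤ C ∧ GeodesicOn (Set.Ici 0) γ ∧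
        ContractingSet C (γ '' Set.Ici 0)

section Horo

variable {X : Type*} [MetricSpace X]

/-- The horofunction associated to a geodesic ray `γ` based at `x₀`
(for geodesic rays, the infimum below equals the limit of
`t ↦ d(z, γ t) - d(x₀, γ t)` as `t → ∞`, since this function is non-increasing
and bounded below). -/
noncomputable def horofn (x₀ : X) (γ : ℝ → X) (z : X) : ℝ :=
  sInf ((fun t => dist z (γ t) - dist x₀ (γ t)) '' Set.Ici 0)

/-- The horofunction map `y ↦ ρ_y = d(·, y) - d(x₀, y)`. -/
noncomputable def horomap (x₀ y : X) : ContinuousMap X ℝ :=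
  ⟨fun z => dist z y - dist x₀ y, by fun_prop⟩

end Horo

section HoroAction

variable {G : Type*} [Group G] {X : Type*} [MetricSpace X]

/-- The `G`-action on the horofunction compactification:
`(g · f)(z) = f (g⁻¹ z) - f (g⁻¹ x₀)`. -/
noncomputable def horoAction (φ : G → X → X) (hc : ∀ g : G, Continuous (φ g)) (x₀ : X)
    (g : G) (f : ContinuousMap X ℝ) : ContinuousMap X ℝ :=
  ⟨fun z => f (φ g⁻¹ z) - f (φ g⁻¹ x₀), (f.continuous.comp (hc g⁻¹)).sub continuous_const⟩

end HoroAction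

section Words

variable {S : Type*}

/-- A word over the symmetrised alphabet `S ∪ S⁻¹`. -/
abbrev Word (S : Type*) := List (S × Bool)

/-- The formal inverse of a word. -/
def wordInv (w : Word S) : Word S := (w.map fun a => (a.1, !a.2)).reverse

/-- A word is reduced if it has no adjacent cancelling pair. -/
def ReducedWord (w : Word S) : Prop := w.Chain' fun a b => a.1 = b.1 → a.2 = b.2

/-- A word is cyclically reduced if all its cyclic shifts are reduced. -/
def CyclicallyReduced (w : Word S) : Prop := ∀ k : ℕ, ReducedWord (w.rotate k)

/-- The closure of `R ∪ R⁻¹` under cyclic shifts. -/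
def symmClosure (R : Set (Word S)) : Set (Word S) :=
  {w | ∃ r ∈ R, ∃ k : ℕ, w = r.rotate k ∨ w = (wordInv r).rotate k}

/-- A piece: a (non-trivial) common prefix of two distinct elements of `R̄`. -/
def IsPiece (R : Set (Word S)) (p : Word S) : Prop :=
  p ≠ [] ∧ ∃ r₁ ∈ symmClosure R, ∃ r₂ ∈ symmClosure R, r₁ ≠ r₂ ∧ p <+: r₁ ∧ p <+: r₂

/-- The `C'(lam)` small-cancellation condition. -/
def SmallCancellation (R : Set (Word S)) (lam : ℝ) : Prop :=
  (∀ r ∈ R, CyclicallyReduced r) ∧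
  ∀ r ∈ symmClosure R, ∀ p : Word S, IsPiece R p → p <:+: r →
    (p.length : ℝ) < lam * r.length

/-- A viable function. -/
def Viable (f : ℕ → ℝ) : Prop :=
  Monotone f ∧ (∀ n, 6 ≤ f n) ∧ Filter.Tendsto f Filter.atTop Filter.atTop

/-- The pair `(x, R)` satisfies the `C'(1/f)` small-cancellation condition. -/
def PairSmallCancellation (f : ℕ → ℝ) (x : Word S) (R : Set (Word S)) : Prop :=
  ∀ r ∈ symmClosure R, ∀ p : Word S, p ≠ [] → p <:+: x → p <:+: r →
    (p.length : ℝ) < (r.length : ℝ) / f r.length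

/-- The increasing partial small-cancellation condition. -/
def IPSC (R : Set (Word S)) : Prop :=
  ∀ ns : ℕ → ℕ, (∀ i, 0 < ns i) →
    ∃ f : ℕ → ℝ, Viable f ∧
      ∀ K : ℕ, ∃ i : ℕ, K ≤ i ∧ ∃ r ∈ symmClosure R, ∃ x y : Word S,
        r = x ++ y ∧ (ns i : ℝ) ≤ r.length ∧ (r.length : ℝ) / i ≤ x.length ∧
        PairSmallCancellation f x R

end Words

section Cayley

variable {G : Type*} [Group G] {S : Type*}

/-- The element of `G` spelled by a word over `S ∪ S⁻¹`. -/
def evalWord (σ : S → G) (w : Word S) : G :=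
  (w.map fun a => if a.2 then σ a.1 else (σ a.1)⁻¹).prod

/-- The word metric on `G` with respect to the generating map `σ`. -/
noncomputable def wordDist (σ : S → G) (g h : G) : ℕ :=
  sInf {n : ℕ | ∃ w : Word S, w.length = n ∧ g * evalWord σ w = h}

/-- A (discrete) edge path in the Cayley graph: consecutive points are adjacent. -/
def DIsPath (σ : S → G) (I : Set ℤ) (p : ℤ → G) : Prop :=
  ∀ n : ℤ, n ∈ I → n + 1 ∈ I → wordDist σ (p n) (p (n + 1)) ≤ 1

/-- A discrete `Q`-quasi-geodesic in the Cayley graph. -/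
def DQGeoOn (σ : S → G) (Q : ℝ) (I : Set ℤ) (p : ℤ → G) : Prop :=
  DIsPath σ I p ∧ ∀ m ∈ I, ∀ n ∈ I,
    |(n : ℝ) - (m : ℝ)| / Q - Q ≤ (wordDist σ (p m) (p n) : ℝ) ∧
      (wordDist σ (p m) (p n) : ℝ) ≤ Q * |(n : ℝ) - (m : ℝ)| + Q

/-- A discrete geodesic in the Cayley graph. -/
def DGeodesicOn (σ : S → G) (I : Set ℤ) (p : ℤ → G) : Prop :=
  ∀ m ∈ I, ∀ n ∈ I, (wordDist σ (p m) (p n) : ℤ) = |n - m|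

/-- `p` is `M`-Morse on `I` in the Cayley graph. -/
def DMorseOn (σ : S → G) (M : ℝ → ℝ) (I : Set ℤ) (p : ℤ → G) : Prop :=
  ∀ Q : ℝ, 1 ≤ Q → ∀ s ∈ I, ∀ t ∈ I, s ≤ t →
    ∀ (q : ℤ → G) (a b : ℤ), a ≤ b → DQGeoOn σ Q (Set.Icc a b) q →
      q a = p s → q b = p t →
      ∀ n ∈ Set.Icc a b, ∃ m ∈ Set.Icc s t, (wordDist σ (q n) (p m) : ℝ) ≤ M Q

/-- A geodesic ray in the Cayley graph based at the identity. -/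
def DGeodesicRay (σ : S → G) (p : ℤ → G) : Prop :=
  p 0 = 1 ∧ DGeodesicOn σ (Set.Ici 0) p

/-- `p` is `L`-locally an `M`-Morse `Q`-quasi-geodesic. -/
def DLocMorseQGeoOn (σ : S → G) (Q : ℝ) (M : ℝ → ℝ) (L : ℝ) (I : Set ℤ) (p : ℤ → G) : Prop :=
  ∀ s ∈ I, ∀ t ∈ I, s ≤ t → ((t - s : ℤ) : ℝ) ≤ L →
    DQGeoOn σ Q (Set.Icc s t) p ∧ DMorseOn σ M (Set.Icc s t) p

/-- `p` is `L`-locally `M`-Morse. -/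
def DLocMorseOn (σ : S → G) (M : ℝ → ℝ) (L : ℝ) (I : Set ℤ) (p : ℤ → G) : Prop :=
  ∀ s ∈ I, ∀ t ∈ I, s ≤ t → ((t - s : ℤ) : ℝ) ≤ L → DMorseOn σ M (Set.Icc s t) p

/-- The Morse local-to-global property for the Cayley graph of `(G, σ)`. -/
def CayMLTG (σ : S → G) : Prop :=
  ∀ Q : ℝ, 1 ≤ Q → ∀ M : ℝ → ℝ, IsMorseGauge M →
    ∃ (L Q' : ℝ) (M' : ℝ → ℝ), 0 < L ∧ 1 ≤ Q' ∧ IsMorseGauge M' ∧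
      ∀ I : Set ℤ, I.OrdConnected → ∀ p : ℤ → G,
        DLocMorseQGeoOn σ Q M L I p → DQGeoOn σ Q' I p ∧ DMorseOn σ M' I p

/-- The geodesic Morse local-to-global property for the Cayley graph. -/
def CayGeodesicMLTG (σ : S → G) : Prop :=
  ∀ M : ℝ → ℝ, IsMorseGauge M →
    ∃ (L : ℝ) (M' : ℝ → ℝ), 0 < L ∧ IsMorseGauge M' ∧
      ∀ I : Set ℤ, I.OrdConnected → ∀ p : ℤ → G, DGeodesicOn σ I p →
        DLocMorseOn σ M L I p → DMorseOn σ M' I p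

/-- σ-compactness of the Morse boundary of the Cayley graph. -/
def CaySigmaCompact (σ : S → G) : Prop :=
  ∃ Ms : ℕ → ℝ → ℝ, (∀ n, IsMorseGauge (Ms n)) ∧
    ∀ p : ℤ → G, DGeodesicRay σ p → ∀ M : ℝ → ℝ, IsMorseGauge M →
      DMorseOn σ M (Set.Ici 0) p → ∃ n, DMorseOn σ (Ms n) (Set.Ici 0) p

/-- Strong σ-compactness of the Morse boundary of the Cayley graph. -/
def CayStronglySigmaCompact (σ : S → G) : Prop :=
  ∃ Ms : ℕ → ℝ → ℝ, (∀ n, IsMorseGauge (Ms n)) ∧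
    (∀ p : ℤ → G, DGeodesicRay σ p → ∀ M : ℝ → ℝ, IsMorseGauge M →
      DMorseOn σ M (Set.Ici 0) p → ∃ n, DMorseOn σ (Ms n) (Set.Ici 0) p) ∧
    (∀ M : ℝ → ℝ, IsMorseGauge M → ∃ n, ∀ p : ℤ → G, DGeodesicRay σ p →
      DMorseOn σ M (Set.Ici 0) p → DMorseOn σ (Ms n) (Set.Ici 0) p)

/-- The edge path starting at `g` labelled by the word `w`. -/
def pathOfWord (σ : S → G) (g : G) (w : Word S) : ℤ → G :=
  fun n => g * evalWord σ (w.take n.toNat)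

end Cayley

/-- The canonical generating map of a presented group `⟨S | R⟩`. -/
def presGen {S : Type*} (R : Set (Word S)) : S → PresentedGroup (FreeGroup.mk '' R) :=
  fun s => PresentedGroup.of s

end MorseLTG

namespace MorseLTG
universe u

section WordsAux
variable {S : Type*}

def linv (a : S × Bool) : S × Bool := (a.1, !a.2)

@[simp] theorem linv_linv (a : S × Bool) : linv (linv a) = a := by simp [linv]

theorem linv_ne (a : S × Bool) : linv a ≠ a := by
  rcases a with ⟨s, b⟩; cases b <;> simp [linv]

theorem wordInv_eq (w : Word S) : wordInv w = (w.map linv).reverse := rfl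

@[simp] theorem wordInv_nil : wordInv ([] : Word S) = [] := rfl

@[simp] theorem wordInv_length (w : Word S) : (wordInv w).length = w.length := by
  simp [wordInv]

@[simp] theorem wordInv_append (u v : Word S) : wordInv (u ++ v) = wordInv v ++ wordInv u := by
  simp [wordInv]

@[simp] theorem wordInv_wordInv (w : Word S) : wordInv (wordInv w) = w := by
  have : (linv ∘ linv : S × Bool → S × Bool) = id := by funext a; simp
  simp [wordInv_eq, List.map_reverse, this]

theorem wordInv_cons (a : S × Bool) (w : Word S) : wordInv (a :: w) = wordInv w ++ [linv a] := by
  simp [wordInv_eq]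

theorem wordInv_inj {u v : Word S} (h : wordInv u = wordInv v) : u = v := by
  rw [← wordInv_wordInv u, h, wordInv_wordInv]

theorem wordInv_ne_nil {u : Word S} (h : u ≠ []) : wordInv u ≠ [] := by
  intro h'; apply h; apply wordInv_inj; simpa using h'

theorem wordInv_getElem? (w : Word S) (i : ℕ) (h : i < w.length) :
    (wordInv w)[i]? = (w[w.length - 1 - i]?).map linv := by
  rw [wordInv_eq, List.getElem?_reverse (by simpa using h)]; simp

def Red (w : Word S) : Prop := w.IsChain (fun a b => b ≠ linv a)

theorem Red.infix {u v : Word S} (h : Red v) (h' : u <:+: v) : Red u := List.IsChain.infix h h'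

theorem red_get {w : Word S} (h : Red w) (i : ℕ) {a b : S × Bool} (ha : w[i]? = some a)
    (hb : w[i+1]? = some b) : b ≠ linv a := by
  obtain ⟨hi, rfl⟩ := List.getElem?_eq_some_iff.1 ha
  obtain ⟨hi', rfl⟩ := List.getElem?_eq_some_iff.1 hb
  exact List.isChain_iff_getElem.1 h i hi'

theorem Red.inv {w : Word S} (h : Red w) : Red (wordInv w) := by
  unfold Red at *
  rw [wordInv_eq, List.isChain_reverse, List.isChain_map]
  refine List.IsChain.imp ?_ h
  intro a b hab hab'
  apply hab
  have := congrArg linv hab'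
  simp at this
  rw [this, linv_linv]

theorem take_inv (u : Word S) (i : ℕ) :
    (wordInv u).take (u.length - i) = wordInv (u.drop i) := by
  conv_lhs => rw [← List.take_append_drop i u, wordInv_append]
  rw [List.take_append_of_le_length (by simp), List.take_of_length_le (by simp)]

theorem drop_inv (u : Word S) (i : ℕ) :
    (wordInv u).drop (u.length - i) = wordInv (u.take i) := by
  conv_lhs => rw [← List.take_append_drop i u, wordInv_append]
  rw [List.drop_left' (by simp)]

theorem Red.ne_inv {u : Word S} (h : Red u) (hu : u ≠ []) : u ≠ wordInv u := by
  intro he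
  have hl : 0 < u.length := List.length_pos_iff.2 hu
  rcases Nat.even_or_odd' u.length with ⟨k, hk | hk⟩
  · have h1 := wordInv_getElem? u k (by omega)
    rw [← he] at h1
    have e : u.length - 1 - k = k - 1 := by omega
    rw [e] at h1
    have hk1 : k - 1 < u.length := by omega
    have hk2 : k < u.length := by omega
    rw [List.getElem?_eq_getElem hk2, List.getElem?_eq_getElem hk1] at h1
    simp at h1
    exact red_get h (k-1) (List.getElem?_eq_getElem hk1)
      (by rw [show k - 1 + 1 = k by omega]; exact List.getElem?_eq_getElem hk2) h1
  · have h1 := wordInv_getElem? u k (by omega)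
    rw [← he] at h1
    have e : u.length - 1 - k = k := by omega
    rw [e] at h1
    have hk2 : k < u.length := by omega
    rw [List.getElem?_eq_getElem hk2] at h1
    simp at h1
    exact linv_ne _ h1.symm

theorem take_succ_of_get {u : Word S} {i : ℕ} {a} (h : u[i]? = some a) :
    u.take (i+1) = u.take i ++ [a] := by
  rw [List.take_add_one, h]; rfl

theorem drop_of_get {u : Word S} {i : ℕ} {a} (h : u[i]? = some a) :
    u.drop i = a :: u.drop (i+1) := by
  obtain ⟨hi, rfl⟩ := List.getElem?_eq_some_iff.1 h
  exact List.drop_eq_getElem_cons hi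

end WordsAux

section Gr
variable {S : Type u} {G : Type u} [Group G]

def lt (σ : S → G) (a : S × Bool) : G := if a.2 then σ a.1 else (σ a.1)⁻¹

@[simp] theorem ev_nil (σ : S → G) : evalWord σ [] = 1 := by simp [evalWord]
theorem ev_cons (σ : S → G) (a w) : evalWord σ (a :: w) = lt σ a * evalWord σ w := by
  simp [evalWord, lt]
theorem ev_append (σ : S → G) (u v) : evalWord σ (u ++ v) = evalWord σ u * evalWord σ v := by
  simp [evalWord]
theorem lt_linv (σ : S → G) (a) : lt σ (linv a) = (lt σ a)⁻¹ := by
  rcases a with ⟨s, b⟩; cases b <;> simp [lt, linv]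
theorem ev_inv (σ : S → G) (w) : evalWord σ (wordInv w) = (evalWord σ w)⁻¹ := by
  induction w with
  | nil => simp
  | cons a w ih => rw [wordInv_cons, ev_append, ih, ev_cons, ev_cons, lt_linv]; simp

structure SC (σ : S → G) (R : Set (Word S)) : Prop where
  ne : ∀ ρ ∈ R, ρ ≠ []
  rot : ∀ u v, u ++ v ∈ R → v ++ u ∈ R
  inv : ∀ ρ ∈ R, wordInv ρ ∈ R
  red : ∀ ρ ∈ R, Red ρ
  piece : ∀ ρ ∈ R, ∀ ρ' ∈ R, ρ ≠ ρ' → ∀ t, t <+: ρ → t <+: ρ' → 9 * t.length < ρ.length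
  ev : ∀ ρ ∈ R, evalWord σ ρ = 1

structure Gr (σ : S → G) where
  V : Type u
  E : V → S × Bool → V → Prop
  val : V → G
  symm : ∀ x a y, E x a y → E y (linv a) x
  det : ∀ x a y z, E x a y → E x a z → y = z
  hval : ∀ x a y, E x a y → val y = val x * lt σ a

variable {σ : S → G} {R : Set (Word S)}

def Gr.W (Γ : Gr σ) : Γ.V → Word S → Γ.V → Prop
  | x, [], y => x = y
  | x, a :: w, y => ∃ z, Γ.E x a z ∧ Γ.W z w y

namespace Gr
variable (Γ : Gr σ)

@[simp] theorem W_nil (x y : Γ.V) : Γ.W x [] y ↔ x = y := Iff.rfl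
theorem W_cons (x y : Γ.V) (a w) : Γ.W x (a :: w) y ↔ ∃ z, Γ.E x a z ∧ Γ.W z w y := Iff.rfl

theorem W_append (x y : Γ.V) (u v) : Γ.W x (u ++ v) y ↔ ∃ z, Γ.W x u z ∧ Γ.W z v y := by
  induction u generalizing x with
  | nil => simp
  | cons a u ih =>
    simp only [List.cons_append, W_cons, ih]
    constructor
    · rintro ⟨z, h, z', h1, h2⟩; exact ⟨z', ⟨z, h, h1⟩, h2⟩
    · rintro ⟨z', ⟨z, h, h1⟩, h2⟩; exact ⟨z, h, z', h1, h2⟩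

variable {Γ}

theorem W_inv {x y : Γ.V} {w} (h : Γ.W x w y) : Γ.W y (wordInv w) x := by
  induction w generalizing x with
  | nil => exact Eq.symm h
  | cons a w ih =>
    obtain ⟨z, h1, h2⟩ := h
    rw [wordInv_cons, W_append]
    exact ⟨z, ih h2, x, Γ.symm _ _ _ h1, rfl⟩

theorem W_det {x y z : Γ.V} {w} (h : Γ.W x w y) (h' : Γ.W x w z) : y = z := by
  induction w generalizing x with
  | nil => exact (Eq.symm h).trans h'
  | cons a w ih =>
    obtain ⟨z, h1, h2⟩ := h
    obtain ⟨z', h1', h2'⟩ := h'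
    obtain rfl := Γ.det _ _ _ _ h1 h1'
    exact ih h2 h2'

theorem W_det' {x y z : Γ.V} {w} (h : Γ.W y w x) (h' : Γ.W z w x) : y = z :=
  W_det (W_inv h) (W_inv h')

theorem W_val {x y : Γ.V} {w} (h : Γ.W x w y) : Γ.val y = Γ.val x * evalWord σ w := by
  induction w generalizing x with
  | nil => cases h; simp
  | cons a w ih =>
    obtain ⟨z, h1, h2⟩ := h
    rw [ih h2, Γ.hval _ _ _ h1, ev_cons, mul_assoc]

theorem W_single {x y : Γ.V} {a} : Γ.W x [a] y ↔ Γ.E x a y := by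
  simp [W_cons]

theorem W_rot {x : Γ.V} {u v} {y : Γ.V} (h1 : Γ.W x u y) (h : Γ.W x (u ++ v) x) :
    Γ.W y v x := by
  obtain ⟨z, h2, h3⟩ := (Γ.W_append _ _ _ _).1 h
  obtain rfl := W_det h1 h2
  exact h3

theorem max_read (x : Γ.V) (w : Word S) : ∃ t s y, w = t ++ s ∧ Γ.W x t y ∧
    ∀ a, s[0]? = some a → ∀ z, ¬ Γ.E y a z := by
  induction w generalizing x with
  | nil => exact ⟨[], [], x, rfl, rfl, by simp⟩
  | cons a w ih =>
    by_cases h : ∃ z, Γ.E x a z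
    · obtain ⟨z, hz⟩ := h
      obtain ⟨t, s, y, rfl, h1, h2⟩ := ih z
      exact ⟨a :: t, s, y, rfl, ⟨z, hz, h1⟩, h2⟩
    · push Not at h
      exact ⟨[], a :: w, x, rfl, rfl, by simpa using h⟩

theorem max_read' (x : Γ.V) (w : Word S) : ∃ t s y, w = t ++ s ∧ Γ.W y s x ∧
    ∀ a, t[t.length - 1]? = some a → ∀ z, ¬ Γ.E y (linv a) z := by
  obtain ⟨t, s, y, h, h1, h2⟩ := Γ.max_read x (wordInv w)
  refine ⟨wordInv s, wordInv t, y, ?_, W_inv h1, ?_⟩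
  · rw [← wordInv_append, ← h, wordInv_wordInv]
  · intro a ha
    apply h2
    rcases Nat.eq_zero_or_pos s.length with h0 | h0
    · have : s = [] := List.length_eq_zero_iff.1 h0
      subst this; simp at ha
    · rw [wordInv_getElem? s _ (by simp; omega)] at ha
      simp only [wordInv_length] at ha
      rw [show s.length - 1 - (s.length - 1) = 0 by omega] at ha
      rw [Option.map_eq_some_iff] at ha
      obtain ⟨b, hb, rfl⟩ := ha
      simpa using hb

end Gr

/-- relators with long readable part are closed -/
def Gr.Hyp (Γ : Gr σ) (R : Set (Word S)) : Prop :=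
  ∀ t s, t ++ s ∈ R → ∀ x y, Γ.W x t y → Γ.W x (t ++ s) x ∨ 2 * t.length ≤ (t ++ s).length

@[ext] structure Gr.Arc (Γ : Gr σ) (R : Set (Word S)) where
  x : Γ.V
  u : Word S
  p : Word S
  y : Γ.V
  hu : u ≠ []
  hρ : u ++ p ∈ R
  hp : Γ.W y p x
  hx : ∀ a, u[0]? = some a → ∀ z, ¬ Γ.E x a z
  hy : ∀ a, u[u.length - 1]? = some a → ∀ z, ¬ Γ.E y (linv a) z

namespace Gr.Arc
variable {Γ : Gr σ}

theorem upos (A : Γ.Arc R) : 0 < A.u.length := List.length_pos_iff.2 A.hu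

def n (A : Γ.Arc R) : ℕ := (A.u ++ A.p).length

theorem n_eq (A : Γ.Arc R) : A.n = A.u.length + A.p.length := by simp [n]

def inv (hR : SC σ R) (A : Γ.Arc R) : Γ.Arc R where
  x := A.y
  u := wordInv A.u
  p := wordInv A.p
  y := A.x
  hu := wordInv_ne_nil A.hu
  hρ := by
    apply hR.rot
    rw [← wordInv_append]
    exact hR.inv _ A.hρ
  hp := W_inv A.hp
  hx := by
    intro a ha
    rw [wordInv_getElem? _ _ A.upos] at ha
    simp only [Nat.sub_zero, Option.map_eq_some_iff] at ha
    obtain ⟨b, hb, rfl⟩ := ha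
    exact A.hy b hb
  hy := by
    intro a ha
    have := A.upos
    rw [wordInv_getElem? _ _ (by simp; omega)] at ha
    simp only [wordInv_length, Option.map_eq_some_iff] at ha
    rw [show A.u.length - 1 - (A.u.length - 1) = 0 by omega] at ha
    obtain ⟨b, hb, rfl⟩ := ha
    simpa using A.hx b hb

variable (hR : SC σ R)

@[simp] theorem inv_x (A : Γ.Arc R) : (A.inv hR).x = A.y := rfl
@[simp] theorem inv_y (A : Γ.Arc R) : (A.inv hR).y = A.x := rfl
@[simp] theorem inv_u (A : Γ.Arc R) : (A.inv hR).u = wordInv A.u := rfl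
@[simp] theorem inv_p (A : Γ.Arc R) : (A.inv hR).p = wordInv A.p := rfl
@[simp] theorem inv_inv (A : Γ.Arc R) : (A.inv hR).inv hR = A := by
  ext <;> simp
@[simp] theorem inv_n (A : Γ.Arc R) : (A.inv hR).n = A.n := by simp [n]

theorem inv_inj {A B : Γ.Arc R} (h : A.inv hR = B.inv hR) : A = B := by
  rw [← inv_inv hR A, h, inv_inv]

include hR in
theorem redu (A : Γ.Arc R) : Red A.u := (hR.red _ A.hρ).infix ⟨[], A.p, by simp⟩

theorem eq_of {A B : Γ.Arc R} (hx : A.x = B.x) (hρ : A.u ++ A.p = B.u ++ B.p) : A = B := by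
  have key : ∀ A B : Γ.Arc R, A.x = B.x → A.u ++ A.p = B.u ++ B.p →
      ¬ A.u.length < B.u.length := by
    intro A B hx hρ hlt
    have hle : A.u <+: B.u := by
      refine List.prefix_of_prefix_length_le (l₃ := B.u ++ B.p) ?_ ?_ hlt.le
      · rw [← hρ]; simp
      · simp
    obtain ⟨c, hc⟩ := hle
    have hp : A.p = c ++ B.p := by
      rw [← hc, List.append_assoc] at hρ
      exact List.append_cancel_left hρ
    have hcp : 0 < c.length := by
      rw [← hc] at hlt; simp at hlt; exact hlt
    have h1 := A.hp
    rw [hp, W_append] at h1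
    obtain ⟨z, h1, h2⟩ := h1
    rw [hx] at h2
    obtain rfl := W_det' h2 B.hp
    have h3 := W_inv h1
    obtain ⟨c', a, rfl⟩ : ∃ c' a, c = c' ++ [a] :=
      ⟨c.dropLast, c.getLast (List.length_pos_iff.1 hcp), (List.dropLast_append_getLast _).symm⟩
    rw [wordInv_append] at h3
    obtain ⟨w, h4, -⟩ : ∃ w, Γ.E B.y (linv a) w ∧ _ := by
      exact h3
    refine B.hy a ?_ w h4
    rw [← hc, ← List.append_assoc]; simp
  have hl : A.u.length = B.u.length :=
    le_antisymm (not_lt.1 (key B A hx.symm hρ.symm)) (not_lt.1 (key A B hx hρ))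
  have h := List.append_inj hρ hl
  have hy : A.y = B.y := by
    have h1 := A.hp
    rw [hx, h.2] at h1
    exact W_det' h1 B.hp
  ext1 <;> simp_all

variable {hR}

theorem nle (hH : Γ.Hyp R) (hR : SC σ R) (A : Γ.Arc R) : A.n ≤ 2 * A.u.length := by
  have h := hH A.p A.u (hR.rot _ _ A.hρ) _ _ A.hp
  rcases h with h | h
  · have := W_rot A.hp h
    obtain ⟨a, u', hu⟩ := List.exists_cons_of_ne_nil A.hu
    rw [hu] at this
    obtain ⟨z, hz, -⟩ := this
    exact absurd hz (A.hx a (by simp [hu]) z)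
  · simp at h; rw [n_eq]; omega

theorem common (hR : SC σ R) {A B : Γ.Arc R} (hne : A ≠ B) (hx : A.x = B.x) {i : ℕ}
    (hi : i ≤ A.u.length) (h : A.u.take i = B.u.take i) : 9 * i < A.n ∧ 9 * i < B.n := by
  have hne' : A.u ++ A.p ≠ B.u ++ B.p := fun h => hne (eq_of hx h)
  have h1 : A.u.take i <+: A.u ++ A.p := (List.take_prefix _ _).trans (by simp)
  have h2 : A.u.take i <+: B.u ++ B.p := h ▸ (List.take_prefix _ _).trans (by simp)
  have := hR.piece _ A.hρ _ B.hρ hne' _ h1 h2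
  have := hR.piece _ B.hρ _ A.hρ hne'.symm _ h2 h1
  simp [hi] at *
  simp [n, *]

end Gr.Arc

end Gr
end MorseLTG

namespace MorseLTG
universe u

section Next
variable {S : Type u} {G : Type u} [Group G] {σ : S → G} {R : Set (Word S)}

def own (u : Word S) (i : ℕ) : Prop :=
  2 * i < u.length ∨ (2 * i = u.length ∧ WellOrderingRel u (wordInv u))

theorem own_inv {u : Word S} (hu : Red u) (hne : u ≠ []) {i : ℕ} (hi : i ≤ u.length) :
    own (wordInv u) (u.length - i) ↔ ¬ own u i := by
  have hne' := hu.ne_inv hne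
  unfold own
  rw [wordInv_wordInv, wordInv_length]
  have e1 : WellOrderingRel (wordInv u) u ↔ ¬ WellOrderingRel u (wordInv u) := by
    constructor
    · exact fun h h' => asymm h h'
    · intro h
      rcases trichotomous_of WellOrderingRel u (wordInv u) with h' | h' | h'
      · exact absurd h' h
      · exact absurd h' hne'
      · exact h'
  rw [e1]
  by_cases h : WellOrderingRel u (wordInv u) <;> simp only [h] <;> simp <;> omega

namespace Gr
variable {Γ : Gr σ}

open Classical in
noncomputable def Arc.pt (A : Γ.Arc R) (i : ℕ) : Γ.V ⊕ (Γ.V × Word S) :=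
  if i = 0 then Sum.inl A.x else if A.u.length ≤ i then Sum.inl A.y else
  if own A.u i then Sum.inr (A.x, A.u.take i) else
    Sum.inr (A.y, (wordInv A.u).take (A.u.length - i))

namespace Arc

@[simp] theorem pt_zero (A : Γ.Arc R) : A.pt 0 = Sum.inl A.x := by simp [pt]
theorem pt_ge (A : Γ.Arc R) {i} (h : A.u.length ≤ i) : A.pt i = Sum.inl A.y := by
  have := A.upos
  rw [pt, if_neg (by omega), if_pos h]
theorem pt_own (A : Γ.Arc R) {i} (h0 : 0 < i) (h1 : i < A.u.length) (h : own A.u i) :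
    A.pt i = Sum.inr (A.x, A.u.take i) := by
  rw [pt, if_neg (by omega), if_neg (by omega), if_pos h]
theorem pt_nown (A : Γ.Arc R) {i} (h0 : 0 < i) (h1 : i < A.u.length) (h : ¬ own A.u i) :
    A.pt i = Sum.inr (A.y, (wordInv A.u).take (A.u.length - i)) := by
  rw [pt, if_neg (by omega), if_neg (by omega), if_neg h]

theorem pt_inl {A : Γ.Arc R} {i v} (h : A.pt i = Sum.inl v) (hi : i < A.u.length) :
    i = 0 ∧ v = A.x := by
  rcases Nat.eq_zero_or_pos i with h0 | h0
  · subst h0; simp at h; exact ⟨rfl, h.symm⟩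
  · by_cases ho : own A.u i
    · rw [pt_own _ h0 hi ho] at h; cases h
    · rw [pt_nown _ h0 hi ho] at h; cases h

theorem pt_inr {A : Γ.Arc R} {i v z} (h : A.pt i = Sum.inr (v, z)) :
    0 < i ∧ i < A.u.length ∧ ((own A.u i ∧ v = A.x ∧ z = A.u.take i) ∨
      (¬ own A.u i ∧ v = A.y ∧ z = (wordInv A.u).take (A.u.length - i))) := by
  rcases Nat.eq_zero_or_pos i with h0 | h0
  · subst h0; simp at h
  rcases Nat.lt_or_ge i A.u.length with hi | hi
  · refine ⟨h0, hi, ?_⟩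
    by_cases ho : own A.u i
    · rw [pt_own _ h0 hi ho] at h; cases h; simp [ho]
    · rw [pt_nown _ h0 hi ho] at h; cases h; simp [ho]
  · rw [pt_ge _ hi] at h; cases h

theorem pt_inv (hR : SC σ R) (A : Γ.Arc R) {i} (hi : i ≤ A.u.length) :
    (A.inv hR).pt (A.u.length - i) = A.pt i := by
  have hp := A.upos
  rcases Nat.eq_zero_or_pos i with h0 | h0
  · subst h0; rw [pt_ge _ (by simp)]; simp
  rcases Nat.lt_or_ge i A.u.length with hi' | hi'
  · by_cases ho : own A.u i
    · rw [pt_own _ h0 hi' ho, pt_nown _ (by omega) (by simp; omega)]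
      · simp only [inv_u, wordInv_wordInv, wordInv_length, inv_y]
        rw [show A.u.length - (A.u.length - i) = i by omega]
      · simp only [inv_u]; rw [own_inv (A.redu hR) A.hu hi]; simpa using ho
    · rw [pt_nown _ h0 hi' ho, pt_own _ (by omega) (by simp; omega)]
      · simp
      · simp only [inv_u]; rw [own_inv (A.redu hR) A.hu hi]; exact ho
  · rw [pt_ge _ hi', show A.u.length - i = 0 by omega]; simp

theorem pt_prefix (hH : Γ.Hyp R) (hR : SC σ R) {A B : Γ.Arc R} (hx : A.x = B.x) {i : ℕ}
    (hi : i ≤ A.u.length) (h : A.u.take i = B.u.take i) : A.pt i = B.pt i := by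
  by_cases hne : A = B
  · rw [hne]
  have h1 := common hR hne hx hi h
  have h2 := A.nle hH hR
  have h3 := B.nle hH hR
  rcases Nat.eq_zero_or_pos i with h0 | h0
  · subst h0; simp [hx]
  · rw [pt_own _ h0 (by omega) (Or.inl (by omega)), pt_own _ h0 (by omega) (Or.inl (by omega)), hx, h]

theorem meet {A B : Γ.Arc R} {i j a b} (ha : A.u[i]? = some a)
    (hb : B.u[j]? = some b) (h : A.pt i = B.pt j) :
    (i = j ∧ A.x = B.x ∧ A.u.take i = B.u.take i ∧ (i = 0 ∨ own A.u i)) ∨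
    (0 < i ∧ A.u[i-1]? = some (linv b)) ∨
    (0 < i ∧ 0 < j ∧ B.u[j-1]? = some (linv a) ∧ A.y = B.x ∧ wordInv (A.u.drop i) = B.u.take j ∧
      j = A.u.length - i) ∨
    (a = b ∧ A.y = B.y ∧ A.u.length - i = B.u.length - j ∧
      (wordInv A.u).take (A.u.length - i) = (wordInv B.u).take (A.u.length - i)) := by
  obtain ⟨hi, -⟩ := List.getElem?_eq_some_iff.1 ha
  obtain ⟨hj, -⟩ := List.getElem?_eq_some_iff.1 hb
  rcases hP : A.pt i with v | ⟨v, z⟩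
  · obtain ⟨rfl, rfl⟩ := pt_inl hP hi
    rw [h] at hP
    obtain ⟨rfl, hx⟩ := pt_inl hP hj
    left; simp [hx]
  · obtain ⟨i0, -, hc⟩ := pt_inr hP
    rw [h] at hP
    obtain ⟨j0, -, hc'⟩ := pt_inr hP
    rcases hc with ⟨ho, rfl, rfl⟩ | ⟨ho, rfl, rfl⟩ <;> rcases hc' with ⟨ho', h1, h2⟩ | ⟨ho', h1, h2⟩
    · left
      have := congrArg List.length h2
      simp at this
      have : i = j := by omega
      subst this
      exact ⟨rfl, h1, h2, Or.inr ho⟩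
    · right; left
      refine ⟨i0, ?_⟩
      have hl := congrArg List.length h2
      simp at hl
      have h3 := congrArg (fun l => l[i-1]?) h2
      simp only [List.getElem?_take] at h3
      rw [if_pos (by omega), if_pos (by omega), wordInv_getElem? _ _ (by omega),
        show B.u.length - 1 - (i-1) = j by omega, hb] at h3
      exact h3
    · right; right; left
      have hl := congrArg List.length h2
      simp at hl
      have h3 := congrArg (fun l => l[j-1]?) h2
      simp only [List.getElem?_take] at h3
      rw [if_pos (by omega), if_pos (by omega), wordInv_getElem? _ _ (by omega),
        show A.u.length - 1 - (j-1) = i by omega, ha] at h3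
      refine ⟨i0, j0, h3.symm, h1, ?_, by omega⟩
      rw [← take_inv]; exact h2
    · right; right; right
      have hl := congrArg List.length h2
      simp at hl
      have he : A.u.length - i = B.u.length - j := by omega
      rw [← he] at h2
      refine ⟨?_, h1, he, h2⟩
      have h3 := congrArg (fun l => l[A.u.length-i-1]?) h2
      simp only [List.getElem?_take] at h3
      rw [if_pos (by omega), if_pos (by omega), wordInv_getElem? _ _ (by omega), wordInv_getElem? _ _ (by omega),
        show A.u.length - 1 - (A.u.length - i-1) = i by omega,
        show B.u.length - 1 - (A.u.length - i-1) = j by omega, ha, hb] at h3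
      simp at h3
      simpa using congrArg linv h3

theorem same_step (hR : SC σ R) {A B : Γ.Arc R} {i j a} (ha : A.u[i]? = some a)
    (hb : B.u[j]? = some a) (h : A.pt i = B.pt j) :
    (A = B ∧ i = j) ∨
    (i = j ∧ A.x = B.x ∧ A.u.take (i+1) = B.u.take (i+1) ∧ 9 * (i+1) < A.n ∧ 9 * (i+1) < B.n) ∨
    (A.y = B.y ∧ A.u.length - i = B.u.length - j ∧
      (wordInv A.u).take (A.u.length - i) = (wordInv B.u).take (A.u.length - i) ∧
      9 * (A.u.length - i) < A.n ∧ 9 * (A.u.length - i) < B.n) := by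
  obtain ⟨hi, -⟩ := List.getElem?_eq_some_iff.1 ha
  obtain ⟨hj, -⟩ := List.getElem?_eq_some_iff.1 hb
  by_cases hne : A = B
  · subst hne
    rcases meet ha hb h with h1 | h1 | h1 | h1
    · exact Or.inl ⟨rfl, h1.1⟩
    · exact absurd (linv_linv a).symm (red_get (A.redu hR) (i-1) h1.2 (by rw [show i-1+1 = i by omega]; exact ha))
    · exact absurd (linv_linv a).symm (red_get (A.redu hR) (j-1) h1.2.2.1 (by rw [show j-1+1 = j by omega]; exact hb))
    · exact Or.inl ⟨rfl, by omega⟩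
  right
  rcases meet ha hb h with h1 | h1 | h1 | h1
  · left
    obtain ⟨rfl, hx, ht, -⟩ := h1
    have ht' : A.u.take (i+1) = B.u.take (i+1) := by
      rw [take_succ_of_get ha, take_succ_of_get hb, ht]
    exact ⟨rfl, hx, ht', common hR hne hx hi ht'⟩
  · exact absurd (linv_linv a).symm (red_get (A.redu hR) (i-1) h1.2 (by rw [show i-1+1 = i by omega]; exact ha))
  · exact absurd (linv_linv a).symm (red_get (B.redu hR) (j-1) h1.2.2.1 (by rw [show j-1+1 = j by omega]; exact hb))
  · right
    refine ⟨h1.2.1, h1.2.2.1, h1.2.2.2, ?_⟩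
    have := common hR (A := A.inv hR) (B := B.inv hR) (fun h => hne (inv_inj hR h)) h1.2.1
      (i := A.u.length - i) (by simp) h1.2.2.2
    simpa using this

theorem step_det (hH : Γ.Hyp R) (hR : SC σ R) {A B : Γ.Arc R} {i j a} (ha : A.u[i]? = some a)
    (hb : B.u[j]? = some a) (h : A.pt i = B.pt j) : A.pt (i+1) = B.pt (j+1) := by
  obtain ⟨hi, -⟩ := List.getElem?_eq_some_iff.1 ha
  obtain ⟨hj, -⟩ := List.getElem?_eq_some_iff.1 hb
  rcases same_step hR ha hb h with ⟨rfl, rfl⟩ | ⟨rfl, hx, ht, -⟩ | ⟨hy, hl, ht, -⟩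
  · rfl
  · exact pt_prefix hH hR hx hi ht
  · rw [← pt_inv hR A (i := i+1) (by omega), ← pt_inv hR B (i := j+1) (by omega),
      show B.u.length - (j+1) = A.u.length - (i+1) by omega]
    apply pt_prefix hH hR hy (by simp)
    have := congrArg (List.take (A.u.length - (i+1))) ht
    simp only [List.take_take] at this
    rwa [min_eq_left (by omega)] at this

end Arc

def Leaf (Γ : Gr σ) (R : Set (Word S)) (x : Γ.V) (a : S × Bool) : Prop :=
  (∀ z, ¬ Γ.E x a z) ∧ ∀ A : Γ.Arc R, A.x = x → A.u[0]? ≠ some a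

inductive NE (Γ : Gr σ) (R : Set (Word S)) :
    Γ.V ⊕ (Γ.V × Word S) → S × Bool → Γ.V ⊕ (Γ.V × Word S) → Prop
  | old (x a y) (h : Γ.E x a y) : NE Γ R (Sum.inl x) a (Sum.inl y)
  | arc (A : Γ.Arc R) (i a) (h : A.u[i]? = some a) : NE Γ R (A.pt i) a (A.pt (i+1))
  | leaf (x a) (h : Γ.Leaf R x a) : NE Γ R (Sum.inl x) a (Sum.inr (x, [a]))
  | leaf' (x a) (h : Γ.Leaf R x a) : NE Γ R (Sum.inr (x, [a])) (linv a) (Sum.inl x)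

theorem NE_inl {x : Γ.V} {a Q} (h : NE Γ R (Sum.inl x) a Q) :
    (∃ y, Γ.E x a y ∧ Q = Sum.inl y) ∨ (∃ A : Γ.Arc R, A.x = x ∧ A.u[0]? = some a ∧ Q = A.pt 1) ∨
    (Γ.Leaf R x a ∧ Q = Sum.inr (x, [a])) := by
  generalize hP : (Sum.inl x : Γ.V ⊕ (Γ.V × Word S)) = P at h
  cases h with
  | old x a y h => cases hP; exact Or.inl ⟨y, h, rfl⟩
  | arc A i a h =>
    obtain ⟨rfl, rfl⟩ := Arc.pt_inl hP.symm (List.getElem?_eq_some_iff.1 h).1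
    exact Or.inr (Or.inl ⟨A, rfl, h, rfl⟩)
  | leaf x a h => cases hP; exact Or.inr (Or.inr ⟨h, rfl⟩)
  | leaf' x a h => cases hP

theorem NE_inr {P a Q z} (h : NE Γ R P a Q) (hP : P = Sum.inr z) :
    (∃ (A : Γ.Arc R) (i : ℕ), A.u[i]? = some a ∧ P = A.pt i ∧ Q = A.pt (i+1)) ∨
    (∃ x b, a = linv b ∧ Γ.Leaf R x b ∧ P = Sum.inr (x, [b]) ∧ Q = Sum.inl x) := by
  cases h with
  | old x a y h => cases hP
  | arc A i a h => exact Or.inl ⟨A, i, h, rfl, rfl⟩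
  | leaf x a h => cases hP
  | leaf' x a h => exact Or.inr ⟨x, a, rfl, h, rfl, rfl⟩

theorem leaf_ne_pt (hR : SC σ R) {A : Γ.Arc R} {i x b} (hl : Γ.Leaf R x b) :
    A.pt i ≠ Sum.inr (x, [b]) := by
  intro h
  obtain ⟨h0, h1, ⟨ho, rfl, hz⟩ | ⟨ho, rfl, hz⟩⟩ := Arc.pt_inr h
  · refine hl.2 A rfl ?_
    have := congrArg (fun l => l[0]?) hz
    simp only [List.getElem?_take, if_pos h0] at this
    exact this.symm
  · refine hl.2 (A.inv hR) rfl ?_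
    have := congrArg (fun l => l[0]?) hz
    simp only [List.getElem?_take] at this
    rw [if_pos (by omega)] at this
    exact this.symm

theorem NE_det (hH : Γ.Hyp R) (hR : SC σ R) {P a Q Q'} (h : NE Γ R P a Q) (h' : NE Γ R P a Q') :
    Q = Q' := by
  rcases P with x | z
  · rcases NE_inl h with ⟨y, hy, rfl⟩ | ⟨A, hx, hA, rfl⟩ | ⟨hl, rfl⟩ <;>
    rcases NE_inl h' with ⟨y', hy', rfl⟩ | ⟨B, hx', hB, rfl⟩ | ⟨hl', rfl⟩
    · rw [Γ.det _ _ _ _ hy hy']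
    · exact absurd hy (hx' ▸ B.hx a hB y)
    · exact absurd hy (hl'.1 y)
    · exact absurd hy' (hx ▸ A.hx a hA y')
    · exact Arc.step_det hH hR hA hB (by simp [hx, hx'])
    · exact absurd hA (hl'.2 A hx)
    · exact absurd hy' (hl.1 y')
    · exact absurd hB (hl.2 B hx')
    · rfl
  · rcases NE_inr h rfl with ⟨A, i, hA, hP, rfl⟩ | ⟨x, b, rfl, hl, hP, rfl⟩ <;>
    rcases NE_inr h' rfl with ⟨B, j, hB, hP', rfl⟩ | ⟨x', b', hb, hl', hP', rfl⟩
    · exact Arc.step_det hH hR hA hB (hP.symm.trans hP')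
    · exact absurd (hP.symm.trans hP') (leaf_ne_pt hR hl')
    · exact absurd (hP'.symm.trans hP) (leaf_ne_pt hR hl)
    · have := hP.symm.trans hP'
      simp at this
      rw [this.1]

theorem NE_symm (hR : SC σ R) {P a Q} (h : NE Γ R P a Q) : NE Γ R Q (linv a) P := by
  cases h with
  | old x a y h => exact NE.old _ _ _ (Γ.symm _ _ _ h)
  | arc A i a h =>
    obtain ⟨hi, -⟩ := List.getElem?_eq_some_iff.1 h
    rw [← Arc.pt_inv hR A (i := i+1) (by omega), ← Arc.pt_inv hR A (i := i) (by omega),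
      show A.u.length - i = A.u.length - (i+1) + 1 by omega]
    apply NE.arc
    rw [Arc.inv_u, wordInv_getElem? _ _ (by omega),
      show A.u.length - 1 - (A.u.length - (i+1)) = i by omega, h]; rfl
  | leaf x a h => exact NE.leaf' _ _ h
  | leaf' x a h => rw [linv_linv]; exact NE.leaf _ _ h

def nval (Γ : Gr σ) : Γ.V ⊕ (Γ.V × Word S) → G
  | Sum.inl x => Γ.val x
  | Sum.inr (x, z) => Γ.val x * evalWord σ z

theorem Arc.val_y (hR : SC σ R) (A : Γ.Arc R) : Γ.val A.y = Γ.val A.x * evalWord σ A.u := by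
  have h1 := W_val A.hp
  have h2 := hR.ev _ A.hρ
  rw [ev_append] at h2
  rw [h1, mul_assoc, mul_eq_one_iff_eq_inv.1 h2]; simp

theorem Arc.nval_pt (hR : SC σ R) (A : Γ.Arc R) {i : ℕ} (hi : i ≤ A.u.length) :
    Γ.nval (A.pt i) = Γ.val A.x * evalWord σ (A.u.take i) := by
  rcases Nat.eq_zero_or_pos i with h0 | h0
  · subst h0; simp [nval]
  rcases Nat.lt_or_ge i A.u.length with hi' | hi'
  · by_cases ho : own A.u i
    · rw [pt_own _ h0 hi' ho]; rfl
    · rw [pt_nown _ h0 hi' ho]; simp only [nval]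
      rw [A.val_y hR, take_inv, ev_inv]
      conv_lhs => rw [← List.take_append_drop i A.u, ev_append]
      simp [mul_assoc]
  · rw [pt_ge _ hi', show A.u.take i = A.u from List.take_of_length_le hi']; exact A.val_y hR

theorem NE_val (hR : SC σ R) {P a Q} (h : NE Γ R P a Q) : Γ.nval Q = Γ.nval P * lt σ a := by
  cases h with
  | old x a y h => exact Γ.hval _ _ _ h
  | arc A i a h =>
    obtain ⟨hi, -⟩ := List.getElem?_eq_some_iff.1 h
    rw [A.nval_pt hR hi.le, A.nval_pt hR hi, take_succ_of_get h, ev_append, ev_cons]; simp [mul_assoc]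
  | leaf x a h => simp [nval, ev_cons]
  | leaf' x a h => simp [nval, ev_cons, lt_linv]

@[reducible] def next (Γ : Gr σ) (hH : Γ.Hyp R) (hR : SC σ R) : Gr σ where
  V := Γ.V ⊕ (Γ.V × Word S)
  E := NE Γ R
  val := Γ.nval
  symm := fun _ _ _ h => NE_symm hR h
  det := fun _ _ _ _ h h' => NE_det hH hR h h'
  hval := fun _ _ _ h => NE_val hR h

variable {hH : Γ.Hyp R} {hR : SC σ R}

/-- walk in the next graph -/
theorem W_old {x y : Γ.V} {w} (h : Γ.W x w y) : (Γ.next hH hR).W (Sum.inl x) w (Sum.inl y) := by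
  induction w generalizing x with
  | nil => cases h; rfl
  | cons a w ih => obtain ⟨z, h1, h2⟩ := h; exact ⟨_, NE.old _ _ _ h1, ih h2⟩

theorem W_arc (A : Γ.Arc R) (i k : ℕ) :
    i + k ≤ A.u.length → (Γ.next hH hR).W (A.pt i) ((A.u.drop i).take k) (A.pt (i+k)) := by
  induction k generalizing i with
  | zero => intro _; exact rfl
  | succ k ih =>
    intro h
    have hi : A.u[i]? = some A.u[i] := List.getElem?_eq_getElem (by omega)
    rw [drop_of_get hi, List.take_succ_cons]
    have := ih (i+1) (by omega)
    rw [show i + (k+1) = i+1+k by omega]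
    exact ⟨_, NE.arc A i _ hi, this⟩

theorem W_arc_end (A : Γ.Arc R) (i : ℕ) (hi : i ≤ A.u.length) :
    (Γ.next hH hR).W (A.pt i) (A.u.drop i) (Sum.inl A.y) := by
  have := W_arc (hH := hH) (hR := hR) A i (A.u.length - i) (by omega)
  rwa [List.take_of_length_le (by simp), Arc.pt_ge _ (i := i + (A.u.length - i)) (by omega)] at this

theorem W_arc_start (A : Γ.Arc R) (i : ℕ) (hi : i ≤ A.u.length) :
    (Γ.next hH hR).W (Sum.inl A.x) (A.u.take i) (A.pt i) := by
  have := W_arc (hH := hH) (hR := hR) A 0 i (by omega)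
  simpa using this

theorem closed_arc (A : Γ.Arc R) (i : ℕ) (hi : i ≤ A.u.length) :
    (Γ.next hH hR).W (A.pt i) (A.u.drop i ++ A.p ++ A.u.take i) (A.pt i) := by
  rw [W_append]; refine ⟨Sum.inl A.x, ?_, W_arc_start A i hi⟩
  rw [W_append]; exact ⟨_, W_arc_end A i hi, W_old A.hp⟩

theorem closed_inl (x : Γ.V) {ρ} (hρ : ρ ∈ R) : (Γ.next hH hR).W (Sum.inl x) ρ (Sum.inl x) := by
  obtain ⟨t, s, x1, rfl, h1, h2⟩ := Γ.max_read x ρ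
  by_cases hs : s = []
  · subst hs
    rcases hH t [] hρ x x1 h1 with h | h
    · exact W_old h
    · have := hR.ne _ hρ
      have : 0 < (t ++ []).length := List.length_pos_iff.2 this
      simp at *; omega
  obtain ⟨m, t', y, rfl, h3, h4⟩ := Γ.max_read' x s
  have hm : m ≠ [] := by
    rintro rfl
    have h5 : Γ.W y (t' ++ t) x1 := (Γ.W_append _ _ _ _).2 ⟨_, h3, h1⟩
    have h6 : t' ++ t ∈ R := hR.rot _ _ hρ
    rcases hH (t' ++ t) [] (by simpa using h6) _ _ h5 with h | h
    · rw [List.append_nil] at h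
      obtain rfl := W_det h h5
      obtain ⟨a, w, rfl⟩ := List.exists_cons_of_ne_nil hs
      obtain ⟨z, hz, -⟩ := h3
      exact h2 a (by simp) z hz
    · simp at h hs
      have := List.length_pos_iff.2 hs
      omega
  let A : Γ.Arc R := ⟨x1, m, t' ++ t, y, hm, by
      have := hR.rot _ _ hρ
      rwa [List.append_assoc] at this, (Γ.W_append _ _ _ _).2 ⟨_, h3, h1⟩, by
      intro a ha
      apply h2
      rw [List.getElem?_append_left (List.getElem?_eq_some_iff.1 ha).1]; exact ha, h4⟩
  rw [W_append]
  refine ⟨_, W_old h1, ?_⟩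
  rw [W_append]
  refine ⟨_, ?_, W_old h3⟩
  have := W_arc_end (hH := hH) (hR := hR) A 0 (by omega)
  simpa using this

theorem full_inl (x : Γ.V) (a) : ∃ Q, (Γ.next hH hR).E (Sum.inl x) a Q := by
  by_cases h : ∃ z, Γ.E x a z
  · obtain ⟨z, hz⟩ := h; exact ⟨_, NE.old _ _ _ hz⟩
  by_cases h' : ∃ A : Γ.Arc R, A.x = x ∧ A.u[0]? = some a
  · obtain ⟨A, rfl, hA⟩ := h'
    have := NE.arc A 0 a hA
    rw [Arc.pt_zero] at this
    exact ⟨_, this⟩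
  · push Not at h h'
    exact ⟨_, NE.leaf x a ⟨h, h'⟩⟩

theorem exists_max {P : ℕ → Prop} {N k : ℕ} (hk : P k) (hN : ∀ k, P k → k ≤ N) :
    ∃ k, P k ∧ ∀ k', P k' → k' ≤ k := by
  classical
  exact ⟨Nat.findGreatest P N, Nat.findGreatest_spec (hN k hk) hk,
    fun k' h => Nat.le_findGreatest (hN k' h) h⟩

def Branch (Γ : Gr σ) (R : Set (Word S)) (P : Γ.V ⊕ (Γ.V × Word S)) (x : Γ.V) (b : S × Bool) : Prop :=
  ∀ (A : Γ.Arc R) (i : ℕ), A.pt i = P → A.u[i]? = some b → A.x = x ∧ 9 * i < A.n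

theorem inr_pt_step {A : Γ.Arc R} {i b Q} (h0 : 0 < i) (hi : i < A.u.length)
    (h : NE Γ R (A.pt i) b Q) (hR : SC σ R) :
    ∃ (B : Γ.Arc R) (j : ℕ), B.u[j]? = some b ∧ A.pt i = B.pt j := by
  obtain ⟨z, hz⟩ : ∃ z, A.pt i = Sum.inr z := by
    by_cases ho : own A.u i
    · exact ⟨_, Arc.pt_own _ h0 hi ho⟩
    · exact ⟨_, Arc.pt_nown _ h0 hi ho⟩
  rcases NE_inr h hz with ⟨B, j, h1, h2, -⟩ | ⟨x, b, -, hl, hP, -⟩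
  · exact ⟨B, j, h1, h2⟩
  · exact absurd hP (leaf_ne_pt hR hl)

theorem follow {P Q : (Γ.next hH hR).V} {q : Word S} (hW : (Γ.next hH hR).W P q Q) (hq : Red q)
    {A : Γ.Arc R} {i : ℕ} {a} (hP : A.pt i = P) (ha : A.u[i]? = some a) (ha' : q[0]? = some a) :
    ∃ (B : Γ.Arc R) (j k : ℕ) (q' : Word S), 1 ≤ k ∧ j + k ≤ B.u.length ∧ B.pt j = P ∧
      q = (B.u.drop j).take k ++ q' ∧ (Γ.next hH hR).W (B.pt (j+k)) q' Q ∧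
      B.u[j]? = some a ∧
      (q' = [] ∨ j + k = B.u.length ∨ (j + k < B.u.length ∧ 9 * (B.u.length - (j+k)) < B.n ∧
        ∀ b, q'[0]? = some b → Γ.Branch R (B.pt (j+k)) B.y b ∧
          ∃ (C : Γ.Arc R) (i : ℕ), C.pt i = B.pt (j+k) ∧ C.u[i]? = some b)) := by
  obtain ⟨hi, -⟩ := List.getElem?_eq_some_iff.1 ha
  obtain ⟨hq0, -⟩ := List.getElem?_eq_some_iff.1 ha'
  let Pr : ℕ → Prop := fun k => ∃ (B : Γ.Arc R) (j : ℕ), 1 ≤ k ∧ k ≤ q.length ∧ j + k ≤ B.u.length ∧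
    B.pt j = P ∧ (B.u.drop j).take k = q.take k
  have h1 : Pr 1 := by
    refine ⟨A, i, le_rfl, hq0, hi, hP, ?_⟩
    rw [drop_of_get ha]
    rw [show q.take 1 = q.take 0 ++ [a] from take_succ_of_get ha']; simp
  obtain ⟨k, ⟨B, j, hk1, hkq, hjk, hBP, hBt⟩, hmax⟩ := exists_max h1 (N := q.length) (by
    rintro k ⟨_, _, _, h, _⟩; exact h)
  have hqe : q = (B.u.drop j).take k ++ q.drop k := by rw [hBt]; simp
  have hW1 := hW
  rw [hqe, W_append] at hW1
  obtain ⟨Z, hZ, hW2⟩ := hW1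
  rw [← hBP] at hZ
  obtain rfl := W_det hZ (W_arc B j k hjk)
  have hBa : B.u[j]? = some a := by
    have := congrArg (fun l => l[0]?) hBt
    simp only [List.getElem?_take, List.getElem?_drop] at this
    rw [if_pos (by omega), if_pos (by omega), ha'] at this
    simpa using this
  refine ⟨B, j, k, q.drop k, hk1, hjk, hBP, hqe, hW2, hBa, ?_⟩
  by_cases hq' : q.drop k = []
  · exact Or.inl hq'
  by_cases hend : j + k = B.u.length
  · exact Or.inr (Or.inl hend)
  have hlt : j + k < B.u.length := by omega
  right; right
  refine ⟨hlt, ?_⟩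
  obtain ⟨b, q'', hb⟩ := List.exists_cons_of_ne_nil hq'
  have hqk : q[k]? = some b := by
    have := congrArg (fun l => l[0]?) hb
    simpa using this
  have hqk' : q[k-1]? = B.u[j+k-1]? := by
    have := congrArg (fun l => l[k-1]?) hBt
    simp only [List.getElem?_take, List.getElem?_drop] at this
    rw [if_pos (by omega), if_pos (by omega)] at this
    rw [← this]; congr 1; omega
  have ha2 : B.u[j+k]? = some B.u[j+k] := List.getElem?_eq_getElem hlt
  set a' := B.u[j+k] with ha'def
  have hred : ∀ c, B.u[j+k-1]? = some c → b ≠ linv c := by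
    intro c hc
    rw [← hqk'] at hc
    exact red_get hq (k-1) hc (by rw [show k-1+1 = k by omega]; exact hqk)
  have hne : a' ≠ b := by
    intro hab
    have : Pr (k+1) := by
      refine ⟨B, j, by omega, ?_, by omega, hBP, ?_⟩
      · have := (List.getElem?_eq_some_iff.1 hqk).1; omega
      · rw [take_succ_of_get hqk, take_succ_of_get (a := b), hBt]
        rw [List.getElem?_drop, ha2, hab]
    have := hmax _ this
    omega
  have key : ∀ (C : Γ.Arc R) (i : ℕ), C.pt i = B.pt (j+k) → C.u[i]? = some b →
      (C.x = B.y ∧ 9 * i < C.n) ∧ 9 * (B.u.length - (j+k)) < B.n := by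
    intro C i hC hCb
    have hCi := (List.getElem?_eq_some_iff.1 hCb).1
    rcases Arc.meet ha2 hCb hC.symm with h | h | h | h
    · exfalso
      obtain ⟨rfl, hx, ht, ho⟩ := h
      have htk : ∀ m, m ≤ j + k → B.u.take m = C.u.take m := by
        intro m hm
        have := congrArg (List.take m) ht
        simpa [List.take_take, min_eq_left hm] using this
      have : Pr (k+1) := by
        refine ⟨C, j, by omega, ?_, by omega, ?_, ?_⟩
        · have := (List.getElem?_eq_some_iff.1 hqk).1; omega
        · rw [← hBP]; symm; exact Arc.pt_prefix hH hR hx (by omega) (htk j (by omega))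
        · rw [take_succ_of_get hqk, take_succ_of_get (a := b), ← hBt]
          · have := congrArg (List.drop j) (htk _ le_rfl)
            rw [List.drop_take, List.drop_take, Nat.add_sub_cancel_left] at this
            rw [this]
          · rw [List.getElem?_drop, hCb]
      have := hmax _ this
      omega
    · exact absurd (linv_linv b).symm (hred _ h.2)
    · obtain ⟨-, hi0, hCl, hy, ht, hil⟩ := h
      have hne2 : B.inv hR ≠ C := by
        intro he
        have : (B.inv hR).u[i]? = some b := by rw [he]; exact hCb
        rw [Arc.inv_u, wordInv_getElem? _ _ (by omega), Option.map_eq_some_iff] at this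
        obtain ⟨c, hc, hcb⟩ := this
        rw [show B.u.length - 1 - i = j + k - 1 by omega] at hc
        exact hred c hc hcb.symm
      rw [← take_inv, ← hil] at ht
      have := Arc.common hR hne2 hy (i := i) (by simp; omega) ht
      rw [Arc.inv_n] at this
      exact ⟨⟨hy.symm, this.2⟩, by omega⟩
    · exact absurd h.1 hne
  have hstep : ∃ (C : Γ.Arc R) (i : ℕ), C.u[i]? = some b ∧ B.pt (j+k) = C.pt i := by
    have h := hW2
    rw [hb] at h
    obtain ⟨z, hz, -⟩ := h
    exact inr_pt_step (by omega) hlt hz hR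
  obtain ⟨C, i, hC1, hC2⟩ := hstep
  refine ⟨(key C i hC2.symm hC1).2, ?_⟩
  intro b' hb'
  rw [hb] at hb'
  simp at hb'
  subst hb'
  exact ⟨fun D i h1 h2 => (key D i h1 h2).1, C, i, hC2.symm, hC1⟩

theorem piece_of_open {P : (Γ.next hH hR).V} {ρ t : Word S} (hρ : ρ ∈ R) (ht : t <+: ρ)
    (hcl : ¬ (Γ.next hH hR).W P ρ P) {B : Γ.Arc R} {j : ℕ} (hj : j ≤ B.u.length)
    (hP : B.pt j = P) (ht' : t <+: B.u.drop j) : 9 * t.length < ρ.length ∧ 9 * t.length < B.n := by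
  have hσ : B.u.drop j ++ B.p ++ B.u.take j ∈ R := by
    apply hR.rot
    rw [← List.append_assoc, List.take_append_drop]; exact B.hρ
  have hne : ρ ≠ B.u.drop j ++ B.p ++ B.u.take j := by
    rintro rfl
    apply hcl
    rw [← hP]
    exact closed_arc B j hj
  have ht2 : t <+: B.u.drop j ++ B.p ++ B.u.take j := by
    rw [List.append_assoc]; exact ht'.trans (by simp)
  refine ⟨hR.piece _ hρ _ hσ hne _ ht ht2, ?_⟩
  have := hR.piece _ hσ _ hρ hne.symm _ ht2 ht
  refine this.trans_le ?_
  rw [Arc.n_eq]; simp; omega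

theorem open_inr {P Z Q : (Γ.next hH hR).V} {t1 t2 s : Word S} (hρ : t1 ++ t2 ++ s ∈ R)
    (h1 : (Γ.next hH hR).W P t1 Z) (h2 : (Γ.next hH hR).W Z t2 Q)
    (hcl : ¬ (Γ.next hH hR).W P (t1 ++ t2 ++ s) P) : ∃ z, Z = Sum.inr z := by
  rcases Z with x | z
  · exfalso; apply hcl
    rw [List.append_assoc] at hρ ⊢
    have := closed_inl (hH := hH) (hR := hR) x (hR.rot _ _ hρ)
    rw [W_append]
    refine ⟨_, h1, ?_⟩
    obtain ⟨z, h3, h4⟩ := (W_append _ _ _ _ _).1 this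
    obtain rfl := W_det' h4 h1
    exact h3
  · exact ⟨z, rfl⟩

/-- `t` follows an arc starting at `P`. -/
def Seg (hH : Γ.Hyp R) (hR : SC σ R) (m : ℕ) (P : (Γ.next hH hR).V) (t : Word S) : Prop :=
  t ≠ [] → ∃ (B : Γ.Arc R) (j : ℕ), B.pt j = P ∧ t <+: B.u.drop j ∧
    9 * t.length < m ∧ 9 * t.length < B.n

theorem two_piece {P Q : (Γ.next hH hR).V} {t s : Word S} (hρ : t ++ s ∈ R)
    (hW : (Γ.next hH hR).W P t Q) (hcl : ¬ (Γ.next hH hR).W P (t ++ s) P) :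
    ∃ t1 t2 Z, t = t1 ++ t2 ∧ (Γ.next hH hR).W P t1 Z ∧ (Γ.next hH hR).W Z t2 Q ∧
      Seg hH hR (t ++ s).length P t1 ∧ Seg hH hR (t ++ s).length Z t2 := by
  have hred : Red t := (hR.red _ hρ).infix ⟨[], s, by simp⟩
  have first : ∀ t1 t2 Z, t = t1 ++ t2 → (Γ.next hH hR).W P t1 Z → (Γ.next hH hR).W Z t2 Q →
      t1 ++ t2 ++ s ∈ R ∧ ∃ z, Z = Sum.inr z := by
    rintro t1 t2 Z rfl h1 h2
    exact ⟨hρ, open_inr hρ h1 h2 hcl⟩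
  by_cases ht : t = []
  · subst ht
    exact ⟨[], [], Q, rfl, hW, rfl, fun h => absurd rfl h, fun h => absurd rfl h⟩
  obtain ⟨a, w, hw⟩ := List.exists_cons_of_ne_nil ht
  have hta : t[0]? = some a := by simp [hw]
  -- first arc
  obtain ⟨A, i, hPA, hAa⟩ : ∃ (A : Γ.Arc R) (i : ℕ), A.pt i = P ∧ A.u[i]? = some a := by
    obtain ⟨z, hz⟩ := (first [] t P rfl rfl hW).2
    have h := hW
    rw [hw] at h
    obtain ⟨Z, h1, h2⟩ := h
    rcases NE_inr h1 hz with ⟨A, i, h3, h4, -⟩ | ⟨x, b, rfl, hl, hP, rfl⟩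
    · exact ⟨A, i, h4.symm, h3⟩
    · obtain ⟨z, hz⟩ := (first [linv b] w _ hw (W_single.2 h1) h2).2
      cases hz
  obtain ⟨B, j, k, q', hk, hjk, hBP, hq, hWq, hBa, hc⟩ := follow hW hred hPA hAa hta
  have hjl : j ≤ B.u.length := by omega
  have hW1 : (Γ.next hH hR).W P ((B.u.drop j).take k) (B.pt (j+k)) := by
    rw [← hBP]; exact W_arc B j k hjk
  have hp1 := piece_of_open hρ (t := (B.u.drop j).take k) (by
    rw [hq, List.append_assoc]; simp) hcl hjl hBP (List.take_prefix _ _)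
  have hseg1 : Seg hH hR (t ++ s).length P ((B.u.drop j).take k) := fun _ =>
    ⟨B, j, hBP, List.take_prefix _ _, hp1⟩
  rcases hc with hc | hc | ⟨hlt, h9, hbr⟩
  · subst hc
    exact ⟨_, [], _, hq, hW1, hWq, hseg1, fun h => absurd rfl h⟩
  · obtain ⟨z, hz⟩ := (first _ _ _ hq hW1 hWq).2
    rw [Arc.pt_ge _ hc.ge] at hz; cases hz
  by_cases hq0 : q' = []
  · subst hq0
    exact ⟨_, [], _, hq, hW1, hWq, hseg1, fun h => absurd rfl h⟩
  obtain ⟨b, w', hw'⟩ := List.exists_cons_of_ne_nil hq0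
  have hqb : q'[0]? = some b := by simp [hw']
  obtain ⟨hB, C, m, hC, hCb⟩ := hbr b hqb
  have hred' : Red q' := hred.infix ⟨(B.u.drop j).take k, [], by rw [hq]; simp⟩
  obtain ⟨D, j2, k2, q2, hk2, hjk2, hDP, hq2, hWq2, hDb, hc2⟩ := follow hWq hred' hC hCb hqb
  set t1 := (B.u.drop j).take k
  set t2 := (D.u.drop j2).take k2 with ht2
  have hW2 : (Γ.next hH hR).W (B.pt (j+k)) t2 (D.pt (j2+k2)) := by
    rw [← hDP]; exact W_arc D j2 k2 hjk2
  have hρ2 : q' ++ s ++ t1 ∈ R := by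
    apply hR.rot
    rw [← List.append_assoc, ← hq]; exact hρ
  have hcl2 : ¬ (Γ.next hH hR).W (B.pt (j+k)) (q' ++ s ++ t1) (B.pt (j+k)) := by
    intro h
    apply hcl
    rw [hq, List.append_assoc, W_append]
    refine ⟨_, hW1, ?_⟩
    obtain ⟨z, h3, h4⟩ := (W_append _ _ _ _ _).1 h
    obtain rfl := W_det' h4 hW1
    exact h3
  have hp2 := piece_of_open hρ2 (t := t2) (by
    rw [hq2, List.append_assoc, List.append_assoc]; simp) hcl2 (by omega) hDP (List.take_prefix _ _)
  have hlen : (q' ++ s ++ t1).length = (t ++ s).length := by rw [hq]; simp; omega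
  rw [hlen] at hp2
  have hseg2 : Seg hH hR (t ++ s).length (B.pt (j+k)) t2 := fun _ =>
    ⟨D, j2, hDP, List.take_prefix _ _, hp2⟩
  have ht2l : t2.length = k2 := by rw [ht2]; simp; omega
  have hqq : t = (t1 ++ t2) ++ q2 := by rw [hq, hq2, List.append_assoc]
  have hWW : (Γ.next hH hR).W P (t1 ++ t2) (D.pt (j2+k2)) :=
    (W_append _ _ _ _ _).2 ⟨_, hW1, hW2⟩
  rcases hc2 with hc | hc | ⟨hlt2, h92, -⟩
  · subst hc
    refine ⟨t1, t2, _, by simpa using hqq, hW1, ?_, hseg1, hseg2⟩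
    rw [W_nil] at hWq2
    rw [← hWq2]; exact hW2
  · obtain ⟨z, hz⟩ := (first _ _ _ hqq hWW hWq2).2
    rw [Arc.pt_ge _ hc.ge] at hz; cases hz
  · exfalso
    have := (hB D j2 hDP hDb).2
    have := D.nle hH hR
    omega

theorem next_hyp (hH : Γ.Hyp R) (hR : SC σ R) : (Γ.next hH hR).Hyp R := by
  intro t s hρ P Q hW
  by_cases hcl : (Γ.next hH hR).W P (t ++ s) P
  · exact Or.inl hcl
  right
  obtain ⟨t1, t2, Z, rfl, -, -, h1, h2⟩ := two_piece hρ hW hcl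
  have e1 : 9 * t1.length ≤ (t1 ++ t2 ++ s).length := by
    by_cases h : t1 = []
    · simp [h]
    · obtain ⟨_, _, _, _, h, _⟩ := h1 h; exact h.le
  have e2 : 9 * t2.length ≤ (t1 ++ t2 ++ s).length := by
    by_cases h : t2 = []
    · simp [h]
    · obtain ⟨_, _, _, _, h, _⟩ := h2 h; exact h.le
  have : (t1 ++ t2).length = t1.length + t2.length := by simp
  omega

end Gr
end Next
end MorseLTG

namespace MorseLTG
universe u

section Push
variable {S : Type u} {G : Type u} [Group G] {σ : S → G} {R : Set (Word S)}

abbrev SW (V S : Type u) := List (V × (S × Bool) × ℝ)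

def lets {V : Type u} (l : SW V S) : Word S := l.map (fun e => e.2.1)
def wt {V : Type u} (l : SW V S) : ℝ := (l.map (fun e => e.2.2)).sum

@[simp] theorem lets_nil {V : Type u} : lets ([] : SW V S) = [] := rfl
@[simp] theorem lets_cons {V : Type u} (e) (l : SW V S) : lets (e :: l) = e.2.1 :: lets l := rfl
@[simp] theorem lets_append {V : Type u} (l l' : SW V S) : lets (l ++ l') = lets l ++ lets l' := by
  simp [lets]
@[simp] theorem lets_length {V : Type u} (l : SW V S) : (lets l).length = l.length := by
  simp [lets]
@[simp] theorem wt_nil {V : Type u} : wt ([] : SW V S) = 0 := rfl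
@[simp] theorem wt_cons {V : Type u} (e) (l : SW V S) : wt (e :: l) = e.2.2 + wt l := by simp [wt]
@[simp] theorem wt_append {V : Type u} (l l' : SW V S) : wt (l ++ l') = wt l + wt l' := by
  simp [wt]

def Pos {V : Type u} (l : SW V S) : Prop := ∀ e ∈ l, 0 ≤ e.2.2

theorem wt_nonneg {V : Type u} {l : SW V S} (h : Pos l) : 0 ≤ wt l := by
  apply List.sum_nonneg
  intro x hx
  obtain ⟨e, he, rfl⟩ := List.mem_map.1 hx
  exact h e he

theorem wt_sublist {V : Type u} {l l' : SW V S} (h : l.Sublist l') (hp : Pos l') : wt l ≤ wt l' := by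
  induction h with
  | slnil => simp
  | cons a h ih =>
    have := ih (fun e he => hp e (List.mem_cons_of_mem _ he))
    have := hp a (by simp)
    simp; linarith
  | cons_cons a h ih =>
    have := ih (fun e he => hp e (List.mem_cons_of_mem _ he))
    simp; linarith

theorem wt_ge {V : Type u} {l : SW V S} {c : ℝ} (h : ∀ e ∈ l, c ≤ e.2.2) : c * l.length ≤ wt l := by
  induction l with
  | nil => simp
  | cons e l ih =>
    have := ih (fun e he => h e (List.mem_cons_of_mem _ he))
    have := h e (by simp)
    simp; nlinarith

namespace Gr

def AW (Γ : Gr σ) : Γ.V → SW Γ.V S → Γ.V → Prop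
  | x, [], y => x = y
  | x, e :: l, y => e.1 = x ∧ ∃ z, Γ.E x e.2.1 z ∧ Γ.AW z l y

variable {Γ : Gr σ}

theorem AW_append {x y : Γ.V} {l l'} : Γ.AW x (l ++ l') y ↔ ∃ z, Γ.AW x l z ∧ Γ.AW z l' y := by
  induction l generalizing x with
  | nil => simp [AW]
  | cons e l ih =>
    simp only [List.cons_append, AW, ih]
    constructor
    · rintro ⟨h0, z, h, z', h1, h2⟩; exact ⟨z', ⟨h0, z, h, h1⟩, h2⟩
    · rintro ⟨z', ⟨h0, z, h, h1⟩, h2⟩; exact ⟨h0, z, h, z', h1, h2⟩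

theorem AW.W {x y : Γ.V} {l} (h : Γ.AW x l y) : Γ.W x (lets l) y := by
  induction l generalizing x with
  | nil => exact h
  | cons e l ih => obtain ⟨-, z, h1, h2⟩ := h; exact ⟨z, h1, ih h2⟩

theorem AW_reduce {x y : Γ.V} {l} (h : Γ.AW x l y) :
    ∃ l', l'.Sublist l ∧ Γ.AW x l' y ∧ Red (lets l') := by
  induction l generalizing x with
  | nil => exact ⟨[], by simp, h, by simp [Red]⟩
  | cons e l ih =>
    obtain ⟨h0, z, h1, h2⟩ := h
    obtain ⟨l', hs, hA, hr⟩ := ih h2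
    rcases l' with _ | ⟨f, l''⟩
    · exact ⟨[e], by simp, ⟨h0, z, h1, hA⟩, by simp [Red]⟩
    by_cases hc : f.2.1 = linv e.2.1
    · obtain ⟨hf, z', h3, h4⟩ := hA
      have h5 := Γ.symm _ _ _ h1
      rw [← hc] at h5
      obtain rfl := Γ.det _ _ _ _ h3 h5
      refine ⟨l'', ?_, h4, hr.infix ⟨[f.2.1], [], by simp⟩⟩
      exact ((List.sublist_cons_self _ _).trans hs).trans (List.sublist_cons_self _ _)
    · refine ⟨e :: f :: l'', hs.cons_cons e, ⟨h0, z, h1, hA⟩, ?_⟩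
      simp only [lets_cons, Red, List.isChain_cons_cons] at hr ⊢
      exact ⟨hc, hr⟩

/-- annotate a walk with weights -/
theorem AW_annot {x y : Γ.V} {w} (h : Γ.W x w y) (c : ℝ) : ∃ l, Γ.AW x l y ∧ lets l = w ∧
    wt l = c * w.length ∧
    ∀ e ∈ l, e.2.2 = c ∧ ∃ w1 w2, w = w1 ++ e.2.1 :: w2 ∧ Γ.W x w1 e.1 ∧ Γ.W e.1 (e.2.1 :: w2) y := by
  induction w generalizing x with
  | nil => exact ⟨[], h, rfl, by simp, by simp⟩
  | cons a w ih =>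
    obtain ⟨z, h1, h2⟩ := h
    obtain ⟨l, hl, hle, hw, hp⟩ := ih h2
    refine ⟨(x, a, c) :: l, ⟨rfl, z, h1, hl⟩, by simp [hle], by simp [hw]; ring, ?_⟩
    intro e he
    rcases List.mem_cons.1 he with rfl | he
    · exact ⟨rfl, [], w, rfl, rfl, z, h1, h2⟩
    · obtain ⟨h3, w1, w2, h4, h5, h6⟩ := hp e he
      exact ⟨h3, a :: w1, w2, by rw [h4]; rfl, ⟨z, h1, h5⟩, h6⟩

def PrivA (A : Γ.Arc R) (f : (Γ.V ⊕ (Γ.V × Word S)) × (S × Bool) × ℝ) : Prop :=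
  ∃ i, f.1 = A.pt i ∧ A.u[i]? = some f.2.1 ∧ A.n ≤ 9 * (i+1) ∧ A.n ≤ 9 * (A.u.length - i)

variable {hH : Γ.Hyp R} {hR : SC σ R}

theorem AW_arc (B : Γ.Arc R) (j k : ℕ) {l : SW (Γ.next hH hR).V S} {Q q'} (hk : j + k ≤ B.u.length)
    (h : (Γ.next hH hR).AW (B.pt j) l Q) (hl : lets l = (B.u.drop j).take k ++ q') :
    ∃ l1 l2, l = l1 ++ l2 ∧ l1.length = k ∧ lets l2 = q' ∧ (Γ.next hH hR).AW (B.pt (j+k)) l2 Q ∧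
      ∀ r f, l1[r]? = some f → f.1 = B.pt (j+r) ∧ B.u[j+r]? = some f.2.1 := by
  induction k generalizing j l with
  | zero => exact ⟨[], l, rfl, rfl, by simpa using hl, h, by simp⟩
  | succ k ih =>
    have hi : B.u[j]? = some B.u[j] := List.getElem?_eq_getElem (by omega)
    rw [drop_of_get hi, List.take_succ_cons] at hl
    rcases l with _ | ⟨e, l⟩
    · simp at hl
    simp only [lets_cons, List.cons_append, List.cons.injEq] at hl
    obtain ⟨he, hl⟩ := hl
    obtain ⟨h0, z, h1, h2⟩ := h
    obtain rfl := (Γ.next hH hR).det _ _ _ _ h1 (NE.arc B j _ (he ▸ hi))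
    obtain ⟨l1, l2, rfl, hlen, hl2, hA, hf⟩ := ih (j+1) (by omega) h2 hl
    refine ⟨e :: l1, l2, rfl, by simp [hlen], hl2, by rw [show j + (k+1) = j+1+k by omega]; exact hA, ?_⟩
    intro r f hr
    rcases r with _ | r
    · simp at hr; subst hr
      exact ⟨h0, he ▸ hi⟩
    · simp at hr
      have := hf r f hr
      rwa [show j + 1 + r = j + (r+1) by omega] at this

/-- what is known about the pushed step -/
def Res (Pr : Γ.Arc R → ℝ → Γ.V × (S × Bool) × ℝ → Prop)
    (l' : SW (Γ.V ⊕ (Γ.V × Word S)) S) (e : Γ.V × (S × Bool) × ℝ) : Prop :=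
  (Sum.inl e.1, e.2) ∈ l' ∨ ∃ (A : Γ.Arc R) (pl : SW (Γ.V ⊕ (Γ.V × Word S)) S), pl.Sublist l' ∧
    (∀ f ∈ pl, PrivA A f) ∧ 7 * A.n ≤ 9 * (pl.length + A.p.length) ∧ Pr A (wt pl) e

theorem Res.mono {Pr : Γ.Arc R → ℝ → Γ.V × (S × Bool) × ℝ → Prop} {l l' e} (h : Res Pr l e)
    (hs : l.Sublist l') : Res Pr l' e := by
  rcases h with h | ⟨A, pl, h1, h2⟩
  · exact Or.inl (hs.subset h)
  · exact Or.inr ⟨A, pl, h1.trans hs, h2⟩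

theorem push (Pr : Γ.Arc R → ℝ → Γ.V × (S × Bool) × ℝ → Prop)
    (hD : ∀ (A : Γ.Arc R) (W : ℝ), 0 ≤ W → ∃ l, Γ.AW A.x l A.y ∧ wt l ≤ W ∧ ∀ e ∈ l, Pr A W e)
    (v' : Γ.V) (N : ℕ) : ∀ (l' : SW (Γ.next hH hR).V S) (P : (Γ.next hH hR).V) (x : Γ.V),
    l'.length ≤ N →
    (P = Sum.inl x ∨ ∃ b, (lets l')[0]? = some b ∧ Γ.Branch R P x b ∧
        ∃ (C : Γ.Arc R) (i : ℕ), C.pt i = P ∧ C.u[i]? = some b) →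
    (Γ.next hH hR).AW P l' (Sum.inl v') → Red (lets l') → Pos l' →
    ∃ l, Γ.AW x l v' ∧ wt l ≤ wt l' ∧ ∀ e ∈ l, Res Pr l' e := by
  induction N with
  | zero =>
    intro l' P x hl hS hA hr hp
    have : l' = [] := List.length_eq_zero_iff.1 (by omega)
    subst this
    rcases hS with rfl | ⟨b, hb, -⟩
    · cases hA
      exact ⟨[], rfl, by simp, by simp⟩
    · simp at hb
  | succ N ih =>
    have main : ∀ (l' : SW (Γ.next hH hR).V S) (P : (Γ.next hH hR).V) (x : Γ.V),
        l'.length ≤ N + 1 → (∃ b, (lets l')[0]? = some b ∧ Γ.Branch R P x b ∧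
          ∃ (C : Γ.Arc R) (i : ℕ), C.pt i = P ∧ C.u[i]? = some b) →
        (Γ.next hH hR).AW P l' (Sum.inl v') → Red (lets l') → Pos l' →
        ∃ l, Γ.AW x l v' ∧ wt l ≤ wt l' ∧ ∀ e ∈ l, Res Pr l' e := by
      rintro l' P x hl ⟨b, hb, hBr, C, i, hCP, hCb⟩ hA hr hp
      obtain ⟨B, j, k, q', hk, hjk, hBP, hq, hWq, hBb, hc⟩ := follow hA.W hr hCP hCb hb
      obtain ⟨hBx, h9j⟩ := hBr B j hBP hBb
      rw [← hBP] at hA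
      obtain ⟨l1, l2, rfl, hl1, hl2, hA2, hf⟩ := AW_arc B j k hjk hA hq
      have hnle := B.nle hH hR
      have h9 : 9 * (B.u.length - (j+k)) < B.n ∧ (B.pt (j+k) = Sum.inl B.y ∨
          ∃ b, (lets l2)[0]? = some b ∧ Γ.Branch R (B.pt (j+k)) B.y b ∧
          ∃ (C : Γ.Arc R) (i : ℕ), C.pt i = (B.pt (j+k)) ∧ C.u[i]? = some b) := by
        have hend : j + k = B.u.length → 9 * (B.u.length - (j+k)) < B.n ∧ (B.pt (j+k) = Sum.inl B.y ∨
          ∃ b, (lets l2)[0]? = some b ∧ Γ.Branch R (B.pt (j+k)) B.y b ∧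
          ∃ (C : Γ.Arc R) (i : ℕ), C.pt i = (B.pt (j+k)) ∧ C.u[i]? = some b) := by
          intro he
          refine ⟨?_, Or.inl (Arc.pt_ge _ he.ge)⟩
          have := B.upos
          rw [B.n_eq]; omega
        by_cases hq0 : q' = []
        · apply hend
          rw [hq0] at hWq
          by_contra hne
          have := Arc.pt_inl (A := B) (i := j + k) hWq (by omega)
          omega
        rcases hc with hc | hc | ⟨-, h1, h2⟩
        · exact absurd hc hq0
        · exact hend hc
        · obtain ⟨b, w', hw'⟩ := List.exists_cons_of_ne_nil hq0
          have hqb : q'[0]? = some b := by simp [hw']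
          exact ⟨h1, Or.inr ⟨b, by rw [hl2]; exact hqb, h2 b hqb⟩⟩
      obtain ⟨h9e, hS⟩ := h9
      have hp1 : Pos l1 := fun e he => hp e (by simp [he])
      have hp2 : Pos l2 := fun e he => hp e (by simp [he])
      obtain ⟨lr, hAr, hwr, hRr⟩ := ih l2 _ B.y (by simp at hl; omega) hS hA2
        (hr.infix ⟨lets l1, [], by simp⟩) hp2
      set c := (B.n + 8) / 9 with hcdef
      let pl := (l1.drop (c - 1 - j)).take (B.u.length + 2 - 2 * c)
      have hpls : pl.Sublist l1 := (List.take_sublist _ _).trans (List.drop_sublist _ _)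
      have hn := B.n_eq
      have hu := B.upos
      have hpll : pl.length = B.u.length + 2 - 2 * c := by
        simp only [pl, List.length_take, List.length_drop, hl1]
        omega
      obtain ⟨lB, hAB, hwB, hPB⟩ := hD B (wt pl) (wt_nonneg (fun e he => hp1 e (hpls.subset he)))
      have hwpl := wt_sublist hpls hp1
      refine ⟨lB ++ lr, AW_append.2 ⟨B.y, hBx ▸ hAB, hAr⟩, by simp; linarith, ?_⟩
      intro e he
      rcases List.mem_append.1 he with he | he
      · right
        refine ⟨B, pl, hpls.trans (List.sublist_append_left _ _), ?_, by omega, hPB e he⟩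
        intro f hfm
        obtain ⟨r, hr1, hr2⟩ := List.getElem_of_mem hfm
        have h1 : pl[r]? = some f := by rw [List.getElem?_eq_getElem hr1, hr2]
        simp only [pl, List.getElem?_take, List.getElem?_drop] at h1
        rw [if_pos (by omega)] at h1
        obtain ⟨h2, h3⟩ := hf _ _ h1
        refine ⟨_, h2, h3, ?_, ?_⟩ <;> omega
      · exact (hRr e he).mono (List.sublist_append_right _ _)
    intro l' P x hl hS hA hr hp
    rcases hS with rfl | hS
    swap
    · exact main l' P x hl hS hA hr hp
    rcases l' with _ | ⟨e, l'⟩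
    · cases hA
      exact ⟨[], rfl, by simp, by simp⟩
    have hA0 := hA
    obtain ⟨h0, z, h1, h2⟩ := hA
    rcases NE_inl h1 with ⟨y, hy, rfl⟩ | ⟨A, hx, hAa, rfl⟩ | ⟨hleaf, rfl⟩
    · obtain ⟨l, hl1, hl2, hl3⟩ := ih l' _ y (by simp at hl; omega) (Or.inl rfl) h2
        (hr.infix ⟨[e.2.1], [], by simp⟩) (fun e he => hp e (List.mem_cons_of_mem _ he))
      refine ⟨(x, e.2) :: l, ⟨rfl, y, hy, hl1⟩, by simpa using hl2, ?_⟩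
      intro f hf
      rcases List.mem_cons.1 hf with rfl | hf
      · left; simp [← h0]
      · exact (hl3 f hf).mono (List.sublist_cons_self _ _)
    · apply main _ _ x hl ⟨e.2.1, by simp, ?_, A, 0, by simp [hx], hAa⟩ hA0 hr hp
      intro B i hB hBi
      obtain ⟨rfl, hx'⟩ := Arc.pt_inl hB (List.getElem?_eq_some_iff.1 hBi).1
      refine ⟨hx'.symm, ?_⟩
      have := B.upos
      rw [B.n_eq]; omega
    · exfalso
      rcases l' with _ | ⟨f, l''⟩
      · cases h2
      obtain ⟨h3, z', h4, h5⟩ := h2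
      rcases NE_inr h4 rfl with ⟨A, i, -, hA1, -⟩ | ⟨x', b, hb, hl', hP, -⟩
      · exact leaf_ne_pt hR hleaf hA1.symm
      · simp at hP
        simp only [lets_cons, Red, List.isChain_cons_cons] at hr
        apply hr.1
        rw [hb, hP.2]

def BB : ℕ → ℕ → ℕ
  | 0, _ => 0
  | d+1, N => BB d (2^(d+1) * N) + 2^(d+1) * N

def Near (σ : S → G) (Z : Set G) (g : G) (D : ℕ) : Prop :=
  ∃ z ∈ Z, ∃ w : Word S, w.length ≤ D ∧ z * evalWord σ w = g

theorem Near.step {Z : Set G} {g h : G} {D m : ℕ} (hn : Near σ Z g D) {w : Word S}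
    (hw : w.length ≤ m) (he : g * evalWord σ w = h) : Near σ Z h (D + m) := by
  obtain ⟨z, hz, v, hv, rfl⟩ := hn
  exact ⟨z, hz, v ++ w, by simp; omega, by rw [ev_append, ← mul_assoc, he]⟩

theorem Near.mono {Z : Set G} {g : G} {D m : ℕ} (hn : Near σ Z g D) (h : D ≤ m) : Near σ Z g m := by
  obtain ⟨z, hz, v, hv, rfl⟩ := hn
  exact ⟨z, hz, v, by omega, rfl⟩

theorem Near.zero {Z : Set G} {g : G} (h : g ∈ Z) : Near σ Z g 0 := ⟨g, h, [], by simp, by simp⟩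

/-- Invariant for steps in `next Γ`. -/
def Inv (Γ : Gr σ) (R : Set (Word S)) (Z : Set G)
    (e : (Γ.V ⊕ (Γ.V × Word S)) × (S × Bool) × ℝ) : Prop :=
  1 ≤ e.2.2 ∧ (Γ.nval e.1 ∈ Z ∨ ((∃ z, e.1 = Sum.inr z) ∧ ∀ (d N : ℕ) (A : Γ.Arc R), A.n ≤ N →
    PrivA A e → Near σ Z (Γ.nval e.1) (BB d N) ∨ (2:ℝ)^d ≤ e.2.2))

theorem PrivA.near {A : Γ.Arc R} (hR : SC σ R) {f} (h : PrivA A f) {Z : Set G} {D : ℕ}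
    (hn : Near σ Z (Γ.nval f.1) D) {w1 w2 : Word S} (hw : wordInv A.p = w1 ++ w2) {e : Γ.V}
    (he : Γ.W A.x w1 e) : Near σ Z (Γ.val e) (D + A.n) := by
  obtain ⟨i, h1, h2, -⟩ := h
  have hi := (List.getElem?_eq_some_iff.1 h2).1
  refine hn.step (w := wordInv (A.u.take i) ++ w1) ?_ ?_
  · have := congrArg List.length hw
    simp at this
    simp [A.n_eq]; omega
  · rw [h1, A.nval_pt hR hi.le, W_val he, ev_append, ev_inv]; group

theorem pl_bound {A : Γ.Arc R} {pl : SW (Γ.V ⊕ (Γ.V × Word S)) S} {Z : Set G}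
    (hI : ∀ f ∈ pl, Inv Γ R Z f) (hP : ∀ f ∈ pl, PrivA A f) (hR : SC σ R)
    {w1 w2 : Word S} (hw : wordInv A.p = w1 ++ w2) {e : Γ.V}
    (he : Γ.W A.x w1 e) {d N : ℕ} (hN : A.n ≤ N) :
    Near σ Z (Γ.val e) (BB d N + N) ∨ (2:ℝ)^d * pl.length ≤ wt pl := by
  by_cases hall : ∀ f ∈ pl, (2:ℝ)^d ≤ f.2.2
  · exact Or.inr (wt_ge hall)
  left
  push Not at hall
  obtain ⟨f, hf, hlt⟩ := hall
  rcases (hI f hf).2 with h | ⟨-, h⟩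
  · exact ((hP f hf).near hR (Near.zero h) hw he).mono (by omega)
  · rcases h d N A hN (hP f hf) with h | h
    · exact ((hP f hf).near hR h hw he).mono (by omega)
    · linarith

theorem BB_mono {d N M : ℕ} (h : N ≤ M) : BB d N ≤ BB d M := by
  induction d generalizing N M with
  | zero => simp [BB]
  | succ d ih =>
    simp only [BB]
    have : 2^(d+1) * N ≤ 2^(d+1) * M := Nat.mul_le_mul_left _ h
    have := ih this
    omega

theorem Arc.not_closed (A : Γ.Arc R) : ¬ Γ.W A.x (wordInv A.p ++ wordInv A.u) A.x := by
  intro h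
  have h1 := W_rot (W_inv A.hp) h
  have h2 := W_inv h1
  rw [wordInv_wordInv] at h2
  obtain ⟨a, u', hu⟩ := List.exists_cons_of_ne_nil A.hu
  rw [hu] at h2
  obtain ⟨z, hz, -⟩ := h2
  exact absurd hz (A.hx a (by simp [hu]) z)

end Gr
end Push
end MorseLTG

namespace MorseLTG
universe u

section Push
variable {S : Type u} {G : Type u} [Group G] {σ : S → G} {R : Set (Word S)}
namespace Gr
variable {Γ : Gr σ} {hH : Γ.Hyp R} {hR : SC σ R}

theorem seg_annot {m : ℕ} {P Q : (Γ.next hH hR).V} {t : Word S} (hS : Seg hH hR m P t)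
    (hW : (Γ.next hH hR).W P t Q) {W : ℝ} (hW0 : 0 ≤ W) :
    ∃ l, (Γ.next hH hR).AW P l Q ∧ wt l ≤ W / 2 ∧ ∀ e ∈ l,
      (∃ w1 w2, t = w1 ++ e.2.1 :: w2 ∧ (Γ.next hH hR).W P w1 e.1 ∧
        (Γ.next hH hR).W e.1 (e.2.1 :: w2) Q) ∧
      ∃ L : ℕ, 1 ≤ L ∧ e.2.2 = W / (2 * L) ∧ 9 * L < m ∧
        ∃ (B : Γ.Arc R) (i : ℕ), e.1 = B.pt i ∧ B.u[i]? = some e.2.1 ∧ 9 * L < B.n := by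
  obtain ⟨l, hA, -, hwt, he⟩ := AW_annot hW (W / (2 * t.length))
  refine ⟨l, hA, ?_, ?_⟩
  · rw [hwt]
    rcases Nat.eq_zero_or_pos t.length with h | h
    · rw [h]; simp; linarith
    · have : (0:ℝ) < t.length := by exact_mod_cast h
      apply le_of_eq; field_simp
  · intro e hel
    obtain ⟨hω, w1, w2, hw, hw1, hw2⟩ := he e hel
    refine ⟨⟨w1, w2, hw, hw1, hw2⟩, ?_⟩
    have hne : t ≠ [] := by rw [hw]; simp
    obtain ⟨B, j, hBP, hpre, h9, h9'⟩ := hS hne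
    refine ⟨t.length, List.length_pos_iff.2 hne, hω, h9, B, j + w1.length, ?_, ?_, h9'⟩
    · have hw1p : w1 <+: B.u.drop j := (List.IsPrefix.trans (⟨_, hw.symm⟩ : w1 <+: t) hpre)
      have hlen := hw1p.length_le
      rw [List.length_drop] at hlen
      have hw1e : w1 = (B.u.drop j).take w1.length := List.prefix_iff_eq_take.1 hw1p
      rcases Nat.lt_or_ge B.u.length j with hj | hj
      · exfalso
        have := hpre.length_le
        rw [List.length_drop] at this
        have := List.length_pos_iff.2 hne
        omega
      have h1 := W_arc (hH := hH) (hR := hR) B j w1.length (by omega)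
      rw [← hw1e, hBP] at h1
      exact W_det hw1 h1
    · obtain ⟨r, hr⟩ := hpre
      have := congrArg (fun l => l[w1.length]?) hr
      rw [hw] at this
      simp at this
      exact this.symm

def Pr1 (hH : Γ.Hyp R) (hR : SC σ R) (A : (Γ.next hH hR).Arc R) (W : ℝ)
    (e : (Γ.next hH hR).V × (S × Bool) × ℝ) : Prop :=
  (∃ z, e.1 = Sum.inr z) ∧ (∃ w1 w2, wordInv A.p = w1 ++ w2 ∧ (Γ.next hH hR).W A.x w1 e.1) ∧
  9 * A.p.length ≤ 2 * A.n ∧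
  ∃ L : ℕ, 1 ≤ L ∧ e.2.2 = W / (2 * L) ∧ 9 * L < A.n ∧
        ∃ (B : Γ.Arc R) (i : ℕ), e.1 = B.pt i ∧ B.u[i]? = some e.2.1 ∧ 9 * L < B.n

theorem rule1 (A : (Γ.next hH hR).Arc R) (W : ℝ) (hW0 : 0 ≤ W) :
    ∃ l, (Γ.next hH hR).AW A.x l A.y ∧ wt l ≤ W ∧ ∀ e ∈ l, Pr1 hH hR A W e := by
  have hρ : wordInv A.p ++ wordInv A.u ∈ R := by
    rw [← wordInv_append]; exact hR.inv _ A.hρ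
  have hcl := A.not_closed
  obtain ⟨t1, t2, Z, ht, hW1, hW2, hS1, hS2⟩ := two_piece hρ (W_inv A.hp) hcl
  have hm : (wordInv A.p ++ wordInv A.u).length = A.n := by rw [A.n_eq]; simp; omega
  rw [hm] at hS1 hS2
  have h9 : 9 * A.p.length ≤ 2 * A.n := by
    have hl := congrArg List.length ht
    simp at hl
    have e1 : 9 * t1.length ≤ A.n := by
      by_cases h : t1 = []
      · simp [h]
      · obtain ⟨_, _, _, _, h, _⟩ := hS1 h; exact h.le
    have e2 : 9 * t2.length ≤ A.n := by
      by_cases h : t2 = []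
      · simp [h]
      · obtain ⟨_, _, _, _, h, _⟩ := hS2 h; exact h.le
    omega
  rw [ht] at hρ hcl
  obtain ⟨l1, hA1, hw1, he1⟩ := seg_annot hS1 hW1 hW0
  obtain ⟨l2, hA2, hw2, he2⟩ := seg_annot hS2 hW2 hW0
  refine ⟨l1 ++ l2, AW_append.2 ⟨Z, hA1, hA2⟩, by simp; linarith, ?_⟩
  intro e he
  rcases List.mem_append.1 he with he | he
  · obtain ⟨⟨w1, w2, hw, h1, h2⟩, h3⟩ := he1 e he
    have h4 : (Γ.next hH hR).W e.1 (e.2.1 :: w2 ++ t2) A.y := (W_append _ _ _ _ _).2 ⟨_, h2, hW2⟩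
    refine ⟨?_, ⟨w1, e.2.1 :: w2 ++ t2, by rw [ht, hw]; simp, h1⟩, h9, h3⟩
    refine open_inr (s := wordInv A.u) ?_ h1 h4 ?_
    · rw [hw] at hρ; simpa using hρ
    · rw [hw] at hcl; simpa using hcl
  · obtain ⟨⟨w1, w2, hw, h1, h2⟩, h3⟩ := he2 e he
    have h4 : (Γ.next hH hR).W A.x (t1 ++ w1) e.1 := (W_append _ _ _ _ _).2 ⟨_, hW1, h1⟩
    refine ⟨?_, ⟨t1 ++ w1, e.2.1 :: w2, by rw [ht, hw]; simp, h4⟩, h9, h3⟩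
    refine open_inr (s := wordInv A.u) ?_ h4 h2 ?_
    · rw [hw] at hρ; simpa using hρ
    · rw [hw] at hcl; simpa using hcl

theorem PrivA.unique (hR : SC σ R) {A B : Γ.Arc R} {f} (h : PrivA A f) {i} (h1 : f.1 = B.pt i)
    (h2 : B.u[i]? = some f.2.1) : A.n = B.n := by
  obtain ⟨j, h3, h4, h5, h6⟩ := h
  rcases Arc.same_step hR h4 h2 (h3.symm.trans h1) with h | h | h
  · rw [h.1]
  · omega
  · omega

theorem push1 {Z : Set G} {v v' : (Γ.next hH hR).V}
    {l' : SW ((Γ.next hH hR).next (next_hyp hH hR) hR).V S}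
    (hA : ((Γ.next hH hR).next (next_hyp hH hR) hR).AW (Sum.inl v) l' (Sum.inl v'))
    (hI : ∀ e ∈ l', Inv (Γ.next hH hR) R Z e) :
    ∃ l, (Γ.next hH hR).AW v l v' ∧ wt l ≤ wt l' ∧ ∀ e ∈ l, Inv Γ R Z e := by
  obtain ⟨l0, hs, hA0, hr⟩ := AW_reduce hA
  have hI0 : ∀ e ∈ l0, Inv (Γ.next hH hR) R Z e := fun e he => hI e (hs.subset he)
  have hpos' : Pos l' := fun e he => zero_le_one.trans (hI e he).1
  have hpos : Pos l0 := fun e he => zero_le_one.trans (hI0 e he).1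
  obtain ⟨l, hl, hw, hres⟩ := push (Pr1 hH hR) (fun A W h => rule1 A W h) v' l0.length l0 _ v le_rfl
    (Or.inl rfl) hA0 hr hpos
  refine ⟨l, hl, hw.trans (wt_sublist hs hpos'), ?_⟩
  intro e he
  rcases hres e he with h | ⟨A, pl, hpl, hP, hcnt, ⟨hinr, ⟨w1, w2, hww, hwalk⟩, h9, L, hL1, hω, hLn, B, i, hB1, hB2, hLB⟩⟩
  · have := hI0 _ h
    refine ⟨this.1, Or.inl ?_⟩
    rcases this.2 with h | ⟨⟨z, hz⟩, -⟩
    · exact h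
    · cases hz
  · have hIp : ∀ f ∈ pl, Inv (Γ.next hH hR) R Z f := fun f hf => hI0 f (hpl.subset hf)
    have hL0 : (0:ℝ) < L := by exact_mod_cast hL1
    have hcnt' : (5:ℝ) * A.n ≤ 9 * pl.length := by
      have : 5 * A.n ≤ 9 * pl.length := by omega
      exact_mod_cast this
    have hLn' : (9:ℝ) * L ≤ A.n := by exact_mod_cast hLn.le
    have hW1 : (1:ℝ) * pl.length ≤ wt pl := wt_ge fun f hf => (hIp f hf).1
    have hωge : ∀ c : ℝ, c * (2 * L) ≤ wt pl → c ≤ e.2.2 := by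
      intro c hc
      rw [hω, le_div_iff₀ (by positivity)]; exact hc
    have h1 : 1 ≤ e.2.2 := hωge 1 (by nlinarith)
    refine ⟨h1, Or.inr ⟨hinr, ?_⟩⟩
    intro d N A' hA'N hPA'
    have hnn := hPA'.unique hR hB1 hB2
    rcases d with _ | d
    · right; simpa using h1
    by_cases hbig : 2^(d+1) * N ≤ A.n
    · right
      apply hωge
      have h5 : (2:ℝ)^(d+1) * N ≤ A.n := by exact_mod_cast hbig
      have h6 : (9:ℝ) * L ≤ N := by
        have : 9 * L ≤ N := by omega
        exact_mod_cast this
      have h7 : (0:ℝ) < 2^(d+1) := by positivity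
      have h8 : (2:ℝ)^(d+1) * (9 * L) ≤ 2^(d+1) * N := by gcongr
      linarith
    · rcases pl_bound hIp hP hR hww hwalk (d := d) (N := 2^(d+1) * N) (by omega) with h | h
      · exact Or.inl h
      · right
        apply hωge
        have h7 : (0:ℝ) < 2^d := by positivity
        have h8 : (2:ℝ)^d * (10 * L) ≤ 2^d * pl.length * 2 := by
          have : (10:ℝ) * L ≤ pl.length * 2 := by linarith
          calc (2:ℝ)^d * (10 * L) ≤ 2^d * (pl.length * 2) := by gcongr
            _ = _ := by ring
        have h9 : 0 < (2:ℝ)^d * L := by positivity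
        rw [pow_succ]
        nlinarith

def Pr0 (A : Γ.Arc R) (W : ℝ) (e : Γ.V × (S × Bool) × ℝ) : Prop :=
  (∃ w1 w2, wordInv A.p = w1 ++ w2 ∧ Γ.W A.x w1 e.1) ∧ A.p ≠ [] ∧ e.2.2 = W / A.p.length

theorem rule0 (A : Γ.Arc R) (W : ℝ) (hW0 : 0 ≤ W) :
    ∃ l, Γ.AW A.x l A.y ∧ wt l ≤ W ∧ ∀ e ∈ l, Pr0 A W e := by
  obtain ⟨l, hA, -, hwt, he⟩ := AW_annot (W_inv A.hp) (W / A.p.length)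
  refine ⟨l, hA, ?_, ?_⟩
  · rw [hwt, wordInv_length]
    rcases Nat.eq_zero_or_pos A.p.length with h | h
    · rw [h]; simp; linarith
    · have : (0:ℝ) < A.p.length := by exact_mod_cast h
      apply le_of_eq; field_simp
  · intro e hel
    obtain ⟨hω, w1, w2, hw, hw1, hw2⟩ := he e hel
    refine ⟨⟨w1, _, hw, hw1⟩, ?_, hω⟩
    intro h
    rw [h] at hw; simp at hw

theorem push0 (hH : Γ.Hyp R) (hR : SC σ R) {Z : Set G} {v v' : Γ.V}
    {l' : SW (Γ.next hH hR).V S}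
    (hA : (Γ.next hH hR).AW (Sum.inl v) l' (Sum.inl v'))
    (hI : ∀ e ∈ l', Inv Γ R Z e) :
    ∃ l, Γ.AW v l v' ∧ Red (lets l) ∧ wt l ≤ wt l' ∧ ∀ e ∈ l, 0 ≤ e.2.2 ∧
      ((1 ≤ e.2.2 ∧ Γ.val e.1 ∈ Z) ∨
      ∃ A : Γ.Arc R, A.p ≠ [] ∧ (7:ℝ) * A.n - 9 * A.p.length ≤ 9 * A.p.length * e.2.2 ∧
        ∀ d N : ℕ, A.n ≤ N → Near σ Z (Γ.val e.1) (BB d N + N) ∨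
          2^d * ((7:ℝ) * A.n - 9 * A.p.length) ≤ 9 * A.p.length * e.2.2) := by
  obtain ⟨l0, hs, hA0, hr⟩ := AW_reduce hA
  have hI0 : ∀ e ∈ l0, Inv Γ R Z e := fun e he => hI e (hs.subset he)
  have hpos' : Pos l' := fun e he => zero_le_one.trans (hI e he).1
  have hpos : Pos l0 := fun e he => zero_le_one.trans (hI0 e he).1
  obtain ⟨l, hl, hw, hres⟩ := push Pr0 (fun A W h => rule0 A W h) v' l0.length l0 _ v le_rfl
    (Or.inl rfl) hA0 hr hpos
  have hall : ∀ e ∈ l, 0 ≤ e.2.2 ∧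
      ((1 ≤ e.2.2 ∧ Γ.val e.1 ∈ Z) ∨
      ∃ A : Γ.Arc R, A.p ≠ [] ∧ (7:ℝ) * A.n - 9 * A.p.length ≤ 9 * A.p.length * e.2.2 ∧
        ∀ d N : ℕ, A.n ≤ N → Near σ Z (Γ.val e.1) (BB d N + N) ∨
          2^d * ((7:ℝ) * A.n - 9 * A.p.length) ≤ 9 * A.p.length * e.2.2) := by
    intro e he
    rcases hres e he with h | ⟨A, pl, hpl, hP, hcnt, ⟨⟨w1, w2, hww, hwalk⟩, hp0, hω⟩⟩
    · have := hI0 _ h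
      refine ⟨zero_le_one.trans this.1, Or.inl ⟨this.1, ?_⟩⟩
      rcases this.2 with h | ⟨⟨z, hz⟩, -⟩
      · exact h
      · cases hz
    · have hIp : ∀ f ∈ pl, Inv Γ R Z f := fun f hf => hI0 f (hpl.subset hf)
      have hL0 : (0:ℝ) < A.p.length := by exact_mod_cast List.length_pos_iff.2 hp0
      have hωe : A.p.length * e.2.2 = wt pl := by rw [hω]; field_simp
      have hcnt' : (7:ℝ) * A.n - 9 * A.p.length ≤ 9 * pl.length := by
        have : (7:ℝ) * A.n ≤ 9 * (pl.length + A.p.length) := by exact_mod_cast hcnt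
        linarith
      have hW1 : (1:ℝ) * pl.length ≤ wt pl := wt_ge fun f hf => (hIp f hf).1
      refine ⟨?_, Or.inr ⟨A, hp0, by nlinarith, ?_⟩⟩
      · rw [hω]
        have : (0:ℝ) ≤ pl.length := by positivity
        apply div_nonneg (by linarith) hL0.le
      intro d N hN
      rcases pl_bound hIp hP hR hww hwalk (d := d) hN with h | h
      · exact Or.inl h
      · right
        have h7 : (0:ℝ) < 2^d := by positivity
        calc (2:ℝ)^d * ((7:ℝ) * A.n - 9 * A.p.length) ≤ 2^d * (9 * pl.length) := by gcongr
          _ ≤ 9 * wt pl := by linarith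
          _ = _ := by rw [← hωe]; ring
  obtain ⟨l2, hs2, hA2, hr2⟩ := AW_reduce hl
  exact ⟨l2, hA2, hr2, (wt_sublist hs2 (fun e he => (hall e he).1)).trans (hw.trans (wt_sublist hs hpos')),
    fun e he => hall e (hs2.subset he)⟩

/-! layers -/
structure GH (σ : S → G) (R : Set (Word S)) where
  g : Gr σ
  h : g.Hyp R

@[reducible] def GH.nx (hR : SC σ R) (Γ : GH σ R) : GH σ R := ⟨Γ.g.next Γ.h hR, next_hyp Γ.h hR⟩

def lay (hR : SC σ R) (Γ : GH σ R) : ℕ → GH σ R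
  | 0 => Γ
  | n+1 => (lay hR Γ n).nx hR

def emb (hR : SC σ R) (Γ : GH σ R) : (n : ℕ) → Γ.g.V → (lay hR Γ n).g.V
  | 0, v => v
  | n+1, v => Sum.inl (emb hR Γ n v)

theorem emb_val (hR : SC σ R) (Γ : GH σ R) (n : ℕ) (v : Γ.g.V) :
    (lay hR Γ n).g.val (emb hR Γ n v) = Γ.g.val v := by
  induction n with
  | zero => rfl
  | succ n ih => exact ih

theorem push_all (hR : SC σ R) (Γ : GH σ R) {Z : Set G} {v v' : Γ.g.V} (n : ℕ)
    (l' : SW (lay hR Γ (n+1)).g.V S)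
    (hA : (lay hR Γ (n+1)).g.AW (emb hR Γ (n+1) v) l' (emb hR Γ (n+1) v'))
    (hI : ∀ e ∈ l', Inv (lay hR Γ n).g R Z e) :
    ∃ l, (Γ.nx hR).g.AW (Sum.inl v) l (Sum.inl v') ∧ wt l ≤ wt l' ∧ ∀ e ∈ l, Inv Γ.g R Z e := by
  induction n with
  | zero => exact ⟨l', hA, le_rfl, hI⟩
  | succ n ih =>
    obtain ⟨l1, hA1, hw1, hI1⟩ := push1 (Γ := (lay hR Γ n).g) (hH := (lay hR Γ n).h) (hR := hR)
      (v := emb hR Γ (n+1) v) (v' := emb hR Γ (n+1) v') (l' := l') hA hI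
    obtain ⟨l, h1, h2, h3⟩ := ih l1 hA1 hI1
    exact ⟨l, h1, h2.trans hw1, h3⟩

end Gr
end Push
end MorseLTG

namespace MorseLTG
universe u

section ThmA
variable {S : Type u} {G : Type u} [Group G] {σ : S → G} {R : Set (Word S)}

def Uni (σ : S → G) (R : Set (Word S)) : Prop :=
  ∀ (K : Type u) [Group K] (f : S → K), (∀ ρ ∈ R, evalWord f ρ = 1) →
    ∀ w, evalWord σ w = 1 → evalWord f w = 1

namespace Gr

theorem lay_old (hR : SC σ R) (Γ : GH σ R) (n : ℕ) {x y w} (h : (lay hR Γ n).g.W x w y) :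
    (lay hR Γ (n+1)).g.W (Sum.inl x) w (Sum.inl y) :=
  W_old (hH := (lay hR Γ n).h) (hR := hR) h

theorem lay_closed (hR : SC σ R) (Γ : GH σ R) (n : ℕ) (x) {ρ} (h : ρ ∈ R) :
    (lay hR Γ (n+1)).g.W (Sum.inl x) ρ (Sum.inl x) :=
  closed_inl (hH := (lay hR Γ n).h) (hR := hR) x h

theorem lay_map (hR : SC σ R) (Γ : GH σ R) (n m : ℕ) (h : n ≤ m) :
    ∃ f : (lay hR Γ n).g.V → (lay hR Γ m).g.V,
      (∀ x q y, (lay hR Γ n).g.W x q y → (lay hR Γ m).g.W (f x) q (f y)) ∧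
      ∀ v, f (emb hR Γ n v) = emb hR Γ m v := by
  induction m, h using Nat.le_induction with
  | base => exact ⟨id, fun _ _ _ h => h, fun _ => rfl⟩
  | succ m h ih =>
    obtain ⟨f, h1, h2⟩ := ih
    refine ⟨fun x => Sum.inl (f x), fun x q y hq => lay_old _ _ _ (h1 x q y hq), fun v => ?_⟩
    exact congrArg Sum.inl (h2 v)

def Eqv (hR : SC σ R) (Γ : GH σ R) (v : Γ.g.V) (q q' : Word S) : Prop :=
  ∃ n X, (lay hR Γ n).g.W (emb hR Γ n v) q X ∧ (lay hR Γ n).g.W (emb hR Γ n v) q' X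

variable (hR : SC σ R) (Γ : GH σ R) (v : Γ.g.V)

theorem walk_ex (q : Word S) : ∃ n X, (lay hR Γ n).g.W (emb hR Γ n v) q X := by
  induction q using List.reverseRecOn with
  | nil => exact ⟨0, v, rfl⟩
  | append_singleton q a ih =>
    obtain ⟨n, X, h⟩ := ih
    obtain ⟨Q, hQ⟩ := full_inl (hH := (lay hR Γ n).h) (hR := hR) X a
    exact ⟨n+1, Q, (W_append _ _ _ _ _).2 ⟨_, lay_old _ _ _ h, W_single.2 hQ⟩⟩

theorem Eqv.trans {q1 q2 q3} (h : Eqv hR Γ v q1 q2) (h' : Eqv hR Γ v q2 q3) : Eqv hR Γ v q1 q3 := by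
  obtain ⟨n, X, h1, h2⟩ := h
  obtain ⟨m, Y, h3, h4⟩ := h'
  obtain ⟨f, hf, hf'⟩ := lay_map hR Γ n (max n m) (le_max_left _ _)
  obtain ⟨g, hg, hg'⟩ := lay_map hR Γ m (max n m) (le_max_right _ _)
  have e1 := hf _ _ _ h1
  have e2 := hf _ _ _ h2
  have e3 := hg _ _ _ h3
  have e4 := hg _ _ _ h4
  rw [hf'] at e1 e2
  rw [hg'] at e3 e4
  rw [W_det e2 e3] at e1
  exact ⟨_, _, e1, e4⟩

def eqvSetoid : Setoid (Word S) where
  r := Eqv hR Γ v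
  iseqv := ⟨fun q => by obtain ⟨n, X, h⟩ := walk_ex hR Γ v q; exact ⟨n, X, h, h⟩,
    fun ⟨n, X, h1, h2⟩ => ⟨n, X, h2, h1⟩, fun h h' => Eqv.trans hR Γ v h h'⟩

theorem Eqv.step {q1 q2} (h : Eqv hR Γ v q1 q2) (a) : Eqv hR Γ v (q1 ++ [a]) (q2 ++ [a]) := by
  obtain ⟨n, X, h1, h2⟩ := h
  obtain ⟨Q, hQ⟩ := full_inl (hH := (lay hR Γ n).h) (hR := hR) X a
  exact ⟨n+1, Q, (W_append _ _ _ _ _).2 ⟨_, lay_old _ _ _ h1, W_single.2 hQ⟩,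
    (W_append _ _ _ _ _).2 ⟨_, lay_old _ _ _ h2, W_single.2 hQ⟩⟩

theorem Eqv.canc (q a) : Eqv hR Γ v (q ++ [a] ++ [linv a]) q := by
  obtain ⟨n, X, h1⟩ := walk_ex hR Γ v q
  obtain ⟨Q, hQ⟩ := full_inl (hH := (lay hR Γ n).h) (hR := hR) X a
  refine ⟨n+1, Sum.inl X, (W_append _ _ _ _ _).2 ⟨Q, (W_append _ _ _ _ _).2 ⟨_, lay_old _ _ _ h1, W_single.2 hQ⟩, W_single.2 ?_⟩, lay_old _ _ _ h1⟩
  exact Gr.symm _ _ _ _ hQ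

theorem Eqv.rel (q ρ) (hρ : ρ ∈ R) : Eqv hR Γ v (q ++ ρ) q := by
  obtain ⟨n, X, h1⟩ := walk_ex hR Γ v q
  exact ⟨n+1, Sum.inl X, (W_append _ _ _ _ _).2 ⟨_, lay_old _ _ _ h1, lay_closed _ _ _ _ hρ⟩, lay_old _ _ _ h1⟩

def stepQ (a : S × Bool) : Quotient (eqvSetoid hR Γ v) → Quotient (eqvSetoid hR Γ v) :=
  Quotient.map (fun q => q ++ [a]) (fun _ _ h => Eqv.step hR Γ v h a)

theorem stepQ_canc (a : S × Bool) (x) : stepQ hR Γ v (linv a) (stepQ hR Γ v a x) = x := by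
  induction x using Quotient.inductionOn with
  | h q => exact Quotient.sound (Eqv.canc hR Γ v q a)

def permQ (a : S × Bool) : Equiv.Perm (Quotient (eqvSetoid hR Γ v)) where
  toFun := stepQ hR Γ v a
  invFun := stepQ hR Γ v (linv a)
  left_inv := stepQ_canc hR Γ v a
  right_inv := fun x => by
    have := stepQ_canc hR Γ v (linv a) x
    rwa [linv_linv] at this

def repQ (s : S) : (Equiv.Perm (Quotient (eqvSetoid hR Γ v)))ᵐᵒᵖ := MulOpposite.op (permQ hR Γ v (s, true))

theorem repQ_lt (a : S × Bool) : (lt (repQ hR Γ v) a).unop = permQ hR Γ v a := by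
  rcases a with ⟨s, b⟩
  cases b
  · simp only [lt, repQ]
    ext x; rfl
  · simp [lt, repQ]

theorem repQ_ev (w q : Word S) : (evalWord (repQ hR Γ v) w).unop (Quotient.mk _ q) = Quotient.mk _ (q ++ w) := by
  induction w generalizing q with
  | nil => simp
  | cons a w ih =>
    rw [ev_cons, MulOpposite.unop_mul, Equiv.Perm.mul_apply, repQ_lt]
    have : permQ hR Γ v a (Quotient.mk _ q) = Quotient.mk _ (q ++ [a]) := rfl
    rw [this, ih]; simp

theorem eqv_of_eval (hU : Uni σ R) {q q' : Word S} (h : evalWord σ q = evalWord σ q') :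
    Eqv hR Γ v q q' := by
  have h1 := hU _ (repQ hR Γ v) (by
    intro ρ hρ
    apply MulOpposite.unop_injective
    ext x
    induction x using Quotient.inductionOn with
    | h q =>
      rw [repQ_ev]
      exact Quotient.sound (Eqv.rel hR Γ v q ρ hρ)) (q ++ wordInv q') (by
    rw [ev_append, ev_inv, h, mul_inv_cancel])
  rw [ev_append, ev_inv, mul_inv_eq_one] at h1
  have h2 := repQ_ev hR Γ v q []
  rw [h1, repQ_ev] at h2
  exact Quotient.exact h2.symm

end Gr

/-! line graph -/
def lineGr (σ : S → G) (g : G) (w : Word S) (hw : Red w) : Gr σ where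
  V := Word S
  E x a y := (y = x ++ [a] ∧ y <+: w) ∨ (x = y ++ [linv a] ∧ x <+: w)
  val x := g * evalWord σ x
  symm := by
    rintro x a y (⟨h1, h2⟩ | ⟨h1, h2⟩)
    · right; exact ⟨by simpa using h1, h2⟩
    · left; exact ⟨h1, h2⟩
  det := by
    have key : ∀ x a y z, y = x ++ [a] → y <+: w → x = z ++ [linv a] → False := by
      rintro x a y z rfl h rfl
      have := hw.infix h.isInfix
      have h2 : Red [linv a, a] := this.infix ⟨z, [], by simp⟩
      simp [Red] at h2
    rintro x a y z (⟨h1, h2⟩ | ⟨h1, h2⟩) (⟨h3, h4⟩ | ⟨h3, h4⟩)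
    · rw [h1, h3]
    · exact (key _ _ _ _ h1 h2 h3).elim
    · exact (key _ _ _ _ h3 h4 h1).elim
    · exact List.append_cancel_right (h1.symm.trans h3)
  hval := by
    rintro x a y (⟨h1, h2⟩ | ⟨h1, h2⟩)
    · rw [h1, ev_append, ev_cons]; simp [mul_assoc]
    · rw [h1, ev_append, ev_cons]; simp [mul_assoc, lt_linv]

theorem line_walk {g : G} {w : Word S} {hw : Red w} {t : Word S} (ht : Red t) :
    ∀ {x y : Word S}, (lineGr σ g w hw).W x t y →
    (y = x ++ t ∧ (t = [] ∨ y <+: w)) ∨ (x = y ++ wordInv t ∧ (t = [] ∨ x <+: w)) := by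
  induction t with
  | nil =>
    intro x y h
    have h : x = y := h
    left; exact ⟨by simp [h], Or.inl rfl⟩
  | cons a t ih =>
    rintro x y ⟨z0, h1, h2⟩
    obtain ⟨z, hz⟩ : ∃ z : Word S, z = z0 := ⟨z0, rfl⟩
    subst hz
    have h1 : (z = x ++ [a] ∧ z <+: w) ∨ (x = z ++ [linv a] ∧ x <+: w) := h1
    have ih' := ih (ht.infix ⟨[a], [], by simp⟩) h2
    rcases h1 with ⟨h1, h1'⟩ | ⟨h1, h1'⟩
    · rcases ih' with ⟨h3, h4⟩ | ⟨h3, h4⟩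
      · left
        refine ⟨?_, Or.inr ?_⟩
        · rw [h3, h1]; simp
        · rcases h4 with h4 | h4
          · rw [h3, h4]; simpa using h1'
          · exact h4
      · cases t with
        | nil =>
          simp at h3
          left; subst h3; exact ⟨h1, Or.inr h1'⟩
        | cons b t =>
          exfalso
          rw [wordInv_cons, h1, ← List.append_assoc] at h3
          have := List.append_inj_right' h3 rfl
          have hr : Red [a, b] := ht.infix ⟨[], t, by simp⟩
          simp [Red] at hr this
          exact hr (by rw [this, linv_linv])
    · rcases ih' with ⟨h3, h4⟩ | ⟨h3, h4⟩
      · cases t with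
        | nil =>
          simp at h3
          right; subst h3; exact ⟨h1, Or.inr h1'⟩
        | cons b t =>
          exfalso
          have h5 : z ++ [b] <+: w := by
            refine List.IsPrefix.trans ⟨t, ?_⟩ (h4.resolve_left (by simp))
            rw [h3]; simp
          have h6 : z ++ [linv a] <+: w := by
            rw [← h1]; exact h1'
          have h7 := List.prefix_of_prefix_length_le h5 h6 (by simp)
          have h8 := h7.eq_of_length (by simp)
          have hr : Red [a, b] := ht.infix ⟨[], t, by simp⟩
          simp [Red] at hr h8
          exact hr h8
      · right
        refine ⟨?_, Or.inr h1'⟩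
        rw [wordInv_cons, h1, h3]; simp

def Ov (R : Set (Word S)) (w : Word S) : Prop :=
  ∀ t ρ, t <:+: w → ρ ∈ R → t <+: ρ → 2 * t.length ≤ ρ.length

theorem prefix_inv (hR : SC σ R) {t s : Word S} (h : t ++ s ∈ R) :
    ∃ ρ ∈ R, wordInv t <+: ρ ∧ ρ.length = (t ++ s).length := by
  have := hR.inv _ h
  rw [wordInv_append] at this
  exact ⟨_, hR.rot _ _ this, ⟨_, rfl⟩, by simp⟩

theorem line_read (hR : SC σ R) {g : G} {w : Word S} {hw : Red w} {t s : Word S} (h : t ++ s ∈ R)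
    {x y : (lineGr σ g w hw).V} (hW : (lineGr σ g w hw).W x t y) :
    ∃ t' ρ, t'.length = t.length ∧ t' <:+: w ∧ ρ ∈ R ∧ t' <+: ρ ∧ ρ.length = (t ++ s).length := by
  have ht : Red t := (hR.red _ h).infix ⟨[], s, by simp⟩
  rcases line_walk ht hW with ⟨h1, h2⟩ | ⟨h1, h2⟩
  · refine ⟨t, _, rfl, ?_, h, ⟨s, rfl⟩, rfl⟩
    rcases h2 with h2 | h2
    · rw [h2]; exact List.nil_infix
    · rw [h1] at h2
      exact List.IsInfix.trans ⟨_, [], by simp; rfl⟩ h2.isInfix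
  · obtain ⟨ρ, h3, h4, h5⟩ := prefix_inv hR h
    refine ⟨wordInv t, ρ, by simp, ?_, h3, h4, h5⟩
    rcases h2 with h2 | h2
    · rw [h2]; exact List.nil_infix
    · rw [h1] at h2
      exact List.IsInfix.trans ⟨_, [], by simp; rfl⟩ h2.isInfix

theorem line_hyp (hR : SC σ R) {g : G} {w : Word S} (hw : Red w) (hov : Ov R w) :
    (lineGr σ g w hw).Hyp R := by
  intro t s h x y hW
  obtain ⟨t', ρ, h1, h2, h3, h4, h5⟩ := line_read hR h hW
  right
  have := hov t' ρ h2 h3 h4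
  omega

theorem line_base (g : G) (w : Word S) (hw : Red w) :
    (lineGr σ g w hw).W ([] : Word S) w w := by
  have : ∀ t s, t ++ s = w → (lineGr σ g w hw).W t s w := by
    intro t s
    induction s generalizing t with
    | nil => intro h; simp at h; exact h
    | cons a s ih =>
      intro h
      refine ⟨t ++ [a], Or.inl ⟨rfl, ⟨s, ?_⟩⟩, ih _ ?_⟩ <;> simpa using h
  exact this [] w rfl

theorem sum_getD (l : List ℝ) : ∑ k ∈ Finset.range l.length, l.getD k 0 = l.sum := by
  induction l with
  | nil => simp
  | cons a l ih =>
    rw [List.length_cons, Finset.sum_range_succ', List.sum_cons, ← ih]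
    simp [add_comm]

open Gr in
theorem coreA (hR : SC σ R) (hU : Uni σ R) (Γ : GH σ R) {v v' : Γ.g.V} {w : Word S} (hW : Γ.g.W v w v')
    (q : Word S) (hq : evalWord σ q = evalWord σ w) (Z : Set G)
    (hZ : ∀ k, k ≤ q.length → Γ.g.val v * evalWord σ (q.take k) ∈ Z) :
    ∃ l, Γ.g.AW v l v' ∧ Red (lets l) ∧ wt l ≤ q.length ∧ ∀ e ∈ l, 0 ≤ e.2.2 ∧
      ((1 ≤ e.2.2 ∧ Γ.g.val e.1 ∈ Z) ∨
      ∃ A : Γ.g.Arc R, A.p ≠ [] ∧ (7:ℝ) * A.n - 9 * A.p.length ≤ 9 * A.p.length * e.2.2 ∧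
        ∀ d N : ℕ, A.n ≤ N → Near σ Z (Γ.g.val e.1) (BB d N + N) ∨
          2^d * ((7:ℝ) * A.n - 9 * A.p.length) ≤ 9 * A.p.length * e.2.2) := by
  obtain ⟨n, X, hX, hX'⟩ := eqv_of_eval hR Γ v hU hq
  obtain ⟨f, hf, hf'⟩ := lay_map hR Γ n (n+1) (by omega)
  obtain ⟨f0, hf0, hf0'⟩ := lay_map hR Γ 0 (n+1) (by omega)
  have e1 := hf _ _ _ hX
  have e2 := hf _ _ _ hX'
  have e3 := hf0 _ _ _ hW
  have e4 := hf0' v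
  have e5 := hf0' v'
  change f0 v = _ at e4
  change f0 v' = _ at e5
  rw [hf'] at e1 e2
  rw [e4, e5] at e3
  rw [W_det e2 e3] at e1
  obtain ⟨l', hA', hl', hwt', he'⟩ := AW_annot e1 1
  obtain ⟨l1, hA1, hw1, hI1⟩ := push_all hR Γ (Z := Z) n l' hA' (by
    intro e he
    obtain ⟨h1, w1, w2, h2, h3, h4⟩ := he' e he
    refine ⟨h1.ge, Or.inl ?_⟩
    have h5 := W_val h3
    rw [emb_val] at h5
    have h7 := hZ w1.length (by rw [h2]; simp)
    rw [h2, List.take_left' rfl, ← h5] at h7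
    exact h7)
  obtain ⟨l, hA, hr, hwt, he⟩ := push0 Γ.h hR hA1 hI1
  exact ⟨l, hA, hr, by linarith, he⟩

open Gr in
theorem thmA (hR : SC σ R) (hU : Uni σ R) {w : Word S} (hw : Red w) (hov : Ov R w) (g : G)
    (q : Word S) (hq : evalWord σ q = evalWord σ w) (Z : Set G)
    (hZ : ∀ k, k ≤ q.length → g * evalWord σ (q.take k) ∈ Z) :
    ∃ ω : ℕ → ℝ, ∑ k ∈ Finset.range w.length, ω k ≤ q.length ∧ ∀ k < w.length, 0 ≤ ω k ∧
      ((1 ≤ ω k ∧ g * evalWord σ (w.take k) ∈ Z) ∨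
       ∃ t ρ, t ≠ [] ∧ t <:+: w ∧ ρ ∈ R ∧ t <+: ρ ∧
        (7:ℝ) * ρ.length - 9 * t.length ≤ 9 * t.length * ω k ∧
        ∀ d N : ℕ, ρ.length ≤ N → Near σ Z (g * evalWord σ (w.take k)) (BB d N + N) ∨
          2^d * ((7:ℝ) * ρ.length - 9 * t.length) ≤ 9 * t.length * ω k) := by
  set Γ : GH σ R := ⟨lineGr σ g w hw, line_hyp hR hw hov⟩ with hΓ
  obtain ⟨l, hA, hr, hwt, he⟩ := coreA hR hU Γ (line_base g w hw) q hq Z (by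
    intro k hk
    have h6 : Γ.g.val ([] : Word S) = g := by
      show g * evalWord σ [] = g
      simp
    have := hZ k hk
    rwa [← h6] at this)
  have hlw : lets l = w := by
    rcases line_walk (hw := hw) hr hA.W with ⟨h, -⟩ | ⟨h, -⟩
    · simpa using h.symm
    · have h := (List.append_eq_nil_iff.1 h.symm)
      rw [h.1]
      exact wordInv_inj h.2
  have hlen : l.length = w.length := by rw [← hlw]; simp [lets]
  refine ⟨fun k => (l.map (fun e => e.2.2)).getD k 0, ?_, ?_⟩
  · have := sum_getD (l.map (fun e => e.2.2))
    rw [List.length_map, hlen] at this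
    rw [this]
    change wt l ≤ _
    linarith
  · intro k hk
    have hkl : k < l.length := by omega
    have hk1 : (l.map (fun e => e.2.2)).getD k 0 = (l[k]).2.2 := by simp [hkl]
    have hv : l[k].1 = w.take k := by
      have h1 : l.take k ++ l[k] :: l.drop (k+1) = l := by
        rw [← List.drop_eq_getElem_cons hkl]; simp
      rw [← h1] at hA
      obtain ⟨z, hz, hz', -⟩ := AW_append.1 hA
      have h2 : lets (l.take k) = w.take k := by rw [← hlw]; simp [lets, List.map_take]
      have h3 := hz.W
      rw [h2] at h3
      rw [hz']
      rcases line_walk (hw := hw) (hw.infix (List.take_prefix k w).isInfix) h3 with ⟨h, -⟩ | ⟨h, -⟩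
      · exact h
      · have h := (List.append_eq_nil_iff.1 h.symm)
        have h2 : w.take k = [] := wordInv_inj h.2
        rw [h2]
        exact h.1
    have hval : Γ.g.val l[k].1 = g * evalWord σ (w.take k) := by
      rw [hv]; rfl
    obtain ⟨h0, h⟩ := he l[k] (List.getElem_mem _)
    rw [hval] at h
    simp only [hk1]
    refine ⟨h0, ?_⟩
    rcases h with h | ⟨A, h1, h2, h3⟩
    · exact Or.inl h
    · right
      obtain ⟨t, ρ, k1, k2, k3, k4, k5⟩ := line_read (hw := hw) hR (hR.rot _ _ A.hρ) A.hp
      have k6 : ρ.length = A.n := by rw [k5, A.n_eq]; simp; omega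
      refine ⟨t, ρ, ?_, k2, k3, k4, ?_, ?_⟩
      · rintro rfl
        exact h1 (List.length_eq_zero_iff.1 k1.symm)
      · rw [k1, k6]; exact h2
      · rw [k1, k6]; exact h3

end ThmA
end MorseLTG

namespace MorseLTG
universe u

section Dist
variable {S : Type u} {G : Type u} [Group G] {σ : S → G} {R : Set (Word S)}

def Gen (σ : S → G) : Prop := ∀ g, ∃ w, evalWord σ w = g

theorem wd_le {g h : G} {w : Word S} (hw : g * evalWord σ w = h) : wordDist σ g h ≤ w.length :=
  Nat.sInf_le ⟨w, rfl, hw⟩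

theorem wd_ex (hG : Gen σ) (g h : G) : ∃ w, w.length = wordDist σ g h ∧ g * evalWord σ w = h := by
  obtain ⟨w, hw⟩ := hG (g⁻¹ * h)
  have : {n : ℕ | ∃ w : Word S, w.length = n ∧ g * evalWord σ w = h}.Nonempty :=
    ⟨_, w, rfl, by rw [hw]; group⟩
  exact Nat.sInf_mem this

theorem wd_self (g : G) : wordDist σ g g = 0 := by
  have := wd_le (σ := σ) (g := g) (h := g) (w := []) (by simp)
  simpa using this

theorem wd_symm (hG : Gen σ) (g h : G) : wordDist σ g h = wordDist σ h g := by
  have key : ∀ g h : G, wordDist σ g h ≤ wordDist σ h g := by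
    intro g h
    obtain ⟨w, h1, h2⟩ := wd_ex hG h g
    rw [← h1, ← wordInv_length]
    exact wd_le (by rw [ev_inv, ← h2]; group)
  exact le_antisymm (key _ _) (key _ _)

theorem wd_tri (hG : Gen σ) (g h k : G) : wordDist σ g k ≤ wordDist σ g h + wordDist σ h k := by
  obtain ⟨w, h1, h2⟩ := wd_ex hG g h
  obtain ⟨v, h3, h4⟩ := wd_ex hG h k
  rw [← h1, ← h3, ← List.length_append]
  exact wd_le (by rw [ev_append, ← mul_assoc, h2, h4])

theorem wd_left (k g h : G) : wordDist σ (k * g) (k * h) = wordDist σ g h := by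
  unfold wordDist
  congr 1
  ext n
  simp [mul_assoc]

theorem wd_zero (hG : Gen σ) {g h : G} (h0 : wordDist σ g h = 0) : g = h := by
  obtain ⟨w, h1, h2⟩ := wd_ex hG g h
  rw [h0] at h1
  rw [List.length_eq_zero_iff.1 h1] at h2
  simpa using h2

/-- the vertex path of a word -/
def pw (σ : S → G) (g : G) (w : Word S) (k : ℕ) : G := g * evalWord σ (w.take k)

@[simp] theorem pw_zero (g : G) (w : Word S) : pw σ g w 0 = g := by simp [pw]
theorem pw_end (g : G) (w : Word S) {k} (h : w.length ≤ k) : pw σ g w k = g * evalWord σ w := by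
  rw [pw, List.take_of_length_le h]

theorem take_split (w : Word S) {i j : ℕ} (h : i ≤ j) : w.take j = w.take i ++ (w.drop i).take (j-i) := by
  conv_lhs => rw [← List.take_append_drop i (w.take j)]
  rw [List.take_take, min_eq_left h, List.drop_take]

theorem pw_seg (g : G) (w : Word S) {i j : ℕ} (h : i ≤ j) :
    pw σ g w i * evalWord σ ((w.drop i).take (j-i)) = pw σ g w j := by
  rw [pw, pw, take_split w h, ev_append, mul_assoc]

theorem pw_shift (g : G) (w : Word S) (i k j : ℕ) (h : k ≤ j - i) :
    pw σ (pw σ g w i) ((w.drop i).take (j-i)) k = pw σ g w (i+k) := by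
  rw [pw, List.take_take, min_eq_left h]
  have := pw_seg (σ := σ) g w (Nat.le_add_right i k)
  simpa using this

theorem pw_dist_le (g : G) (w : Word S) {i j : ℕ} (h : i ≤ j) :
    wordDist σ (pw σ g w i) (pw σ g w j) ≤ j - i := by
  refine (wd_le (pw_seg g w h)).trans ?_
  simp

theorem sub_infix (w : Word S) (i j : ℕ) : (w.drop i).take j <:+: w :=
  (List.take_prefix _ _).isInfix.trans (List.drop_suffix _ _).isInfix

theorem Ov.infix {w v : Word S} (h : Ov R w) (hv : v <:+: w) : Ov R v :=
  fun t ρ ht hρ hp => h t ρ (ht.trans hv) hρ hp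

def Small (R : Set (Word S)) (φ : ℕ → ℕ) (w : Word S) : Prop :=
  ∀ t ρ, t <:+: w → ρ ∈ R → t <+: ρ → t.length ≤ φ ρ.length

theorem Small.infix {φ} {w v : Word S} (h : Small R φ w) (hv : v <:+: w) : Small R φ v :=
  fun t ρ ht hρ hp => h t ρ (ht.trans hv) hρ hp

def Subl (φ : ℕ → ℕ) : Prop := Monotone φ ∧ ∀ K, ∃ n0, ∀ n, n0 ≤ n → K * φ n ≤ n

def Geo (σ : S → G) (w : Word S) : Prop := ∀ v, evalWord σ v = evalWord σ w → w.length ≤ v.length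

theorem geo_of (hG : Gen σ) {g h : G} {w : Word S} (h1 : w.length = wordDist σ g h)
    (h2 : g * evalWord σ w = h) : Geo σ w := by
  intro v hv
  rw [h1]
  exact wd_le (by rw [hv, h2])

theorem Geo.dist (hG : Gen σ) {w : Word S} (h : Geo σ w) (g : G) :
    wordDist σ g (g * evalWord σ w) = w.length := by
  apply le_antisymm (wd_le rfl)
  obtain ⟨v, h1, h2⟩ := wd_ex hG g (g * evalWord σ w)
  rw [← h1]
  exact h v (mul_left_cancel h2)

theorem Geo.infix {w v : Word S} (h : Geo σ w) (hv : v <:+: w) : Geo σ v := by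
  obtain ⟨a, b, rfl⟩ := hv
  intro q hq
  have := h (a ++ q ++ b) (by simp [ev_append, hq])
  simp at this
  omega

theorem Geo.inv {w : Word S} (h : Geo σ w) : Geo σ (wordInv w) := by
  intro v hv
  have := h (wordInv v) (by rw [ev_inv, hv, ev_inv, inv_inv])
  simpa using this

theorem Geo.red {w : Word S} (h : Geo σ w) : Red w := by
  induction w with
  | nil => simp [Red]
  | cons a w ih =>
    have := ih (h.infix ⟨[a], [], by simp⟩)
    cases w with
    | nil => simp [Red]
    | cons b w =>
      refine List.IsChain.cons_cons ?_ this
      rintro rfl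
      have := h w (by simp [ev_cons, lt_linv])
      simp at this

theorem Geo.ov (hR : SC σ R) {w : Word S} (h : Geo σ w) : Ov R w := by
  rintro t ρ ht hρ ⟨s, rfl⟩
  have h1 := hR.ev _ hρ
  have := (h.infix ht) (wordInv s) (by
    rw [ev_inv]; rw [ev_append] at h1; exact (eq_inv_of_mul_eq_one_left h1).symm)
  simp at this ⊢
  omega

theorem a1 (hR : SC σ R) (hU : Uni σ R) {w : Word S} (hw : Red w) (hov : Ov R w) {q : Word S}
    (hq : evalWord σ q = evalWord σ w) : 5 * w.length ≤ 9 * q.length := by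
  obtain ⟨ω, h1, h2⟩ := thmA hR hU hw hov 1 q hq univ (fun _ _ => trivial)
  have h3 : ∀ k ∈ Finset.range w.length, (5/9:ℝ) ≤ ω k := by
    intro k hk
    obtain ⟨h0, h | ⟨t, ρ, ht, hi, hρ, hp, h, -⟩⟩ := h2 k (Finset.mem_range.1 hk)
    · linarith [h.1]
    · have h4 : (2:ℝ) * t.length ≤ ρ.length := by exact_mod_cast hov t ρ hi hρ hp
      have h5 : (0:ℝ) < t.length := by exact_mod_cast List.length_pos_iff.2 ht
      by_contra hc
      push Not at hc
      nlinarith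
  have h4 := Finset.card_nsmul_le_sum _ _ _ h3
  simp at h4
  have : (5:ℝ) * w.length ≤ 9 * q.length := by linarith
  exact_mod_cast this

theorem a1geo (hR : SC σ R) (hU : Uni σ R) {w : Word S} (hw : Red w)
    (hov : ∀ t ρ, t <:+: w → ρ ∈ R → t <+: ρ → 18 * t.length ≤ 7 * ρ.length) : Geo σ w := by
  intro q hq
  obtain ⟨ω, h1, h2⟩ := thmA hR hU hw (fun t ρ h h' h'' => by
    have := hov t ρ h h' h''; omega) 1 q hq univ (fun _ _ => trivial)
  have h3 : ∀ k ∈ Finset.range w.length, (1:ℝ) ≤ ω k := by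
    intro k hk
    obtain ⟨h0, h | ⟨t, ρ, ht, hi, hρ, hp, h, -⟩⟩ := h2 k (Finset.mem_range.1 hk)
    · linarith [h.1]
    · have h4 : (18:ℝ) * t.length ≤ 7 * ρ.length := by exact_mod_cast hov t ρ hi hρ hp
      have h5 : (0:ℝ) < t.length := by exact_mod_cast List.length_pos_iff.2 ht
      by_contra hc
      push Not at hc
      nlinarith
  have h4 := Finset.card_nsmul_le_sum _ _ _ h3
  simp at h4
  have : (w.length:ℝ) ≤ q.length := by linarith
  exact_mod_cast this

theorem a1dist (hR : SC σ R) (hU : Uni σ R) (hG : Gen σ) {w : Word S} (hw : Red w) (hov : Ov R w) (g : G)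
    {i j : ℕ} (hij : i ≤ j) (hj : j ≤ w.length) :
    5 * (j - i) ≤ 9 * wordDist σ (pw σ g w i) (pw σ g w j) := by
  obtain ⟨v, h1, h2⟩ := wd_ex hG (pw σ g w i) (pw σ g w j)
  rw [← pw_seg g w hij] at h2
  have hs := sub_infix w i (j-i)
  have := a1 hR hU (hw.infix hs) (hov.infix hs) (mul_left_cancel h2)
  rw [← h1]
  simp at this
  omega

open Gr in
theorem a2 (hR : SC σ R) (hU : Uni σ R) {φ : ℕ → ℕ} (hφ : Subl φ) (C : ℕ) :
    ∃ D : ℕ, ∀ w : Word S, Red w → Ov R w → Small R φ w → ∀ (g : G) (q : Word S),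
      evalWord σ q = evalWord σ w →
      ∃ ω : ℕ → ℝ, ∑ k ∈ Finset.range w.length, ω k ≤ q.length ∧ ∀ k < w.length, 0 ≤ ω k ∧
        ((∃ j, j ≤ q.length ∧ wordDist σ (pw σ g q j) (pw σ g w k) ≤ D) ∨ 2 * (C:ℝ) ≤ ω k) := by
  obtain ⟨n0, hn0⟩ := hφ.2 (18 * C + 9)
  refine ⟨BB (C+2) n0 + n0, ?_⟩
  intro w hw hov hS g q hq
  obtain ⟨ω, h1, h2⟩ := thmA hR hU hw hov g q hq {x | ∃ k, k ≤ q.length ∧ pw σ g q k = x}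
    (fun k hk => ⟨k, hk, rfl⟩)
  refine ⟨ω, h1, ?_⟩
  intro k hk
  obtain ⟨h0, h⟩ := h2 k hk
  refine ⟨h0, ?_⟩
  rcases h with ⟨-, j, hj, h⟩ | ⟨t, ρ, ht, hi, hρ, hp, h3, h4⟩
  · left
    refine ⟨j, hj, ?_⟩
    rw [h, pw, wd_self]; exact Nat.zero_le _
  · have h5 : (0:ℝ) < t.length := by exact_mod_cast List.length_pos_iff.2 ht
    have h6 : (2:ℝ) * t.length ≤ ρ.length := by exact_mod_cast hov t ρ hi hρ hp
    by_cases hbig : n0 ≤ ρ.length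
    · right
      have h7 := hn0 _ hbig
      have h8 := hS t ρ hi hρ hp
      have h9 : (18 * C + 9) * t.length ≤ ρ.length := (Nat.mul_le_mul_left _ h8).trans h7
      have h9 : (18 * C + 9) * (t.length:ℝ) ≤ ρ.length := by exact_mod_cast h9
      by_contra hc
      push Not at hc
      nlinarith
    · rcases h4 (C+2) n0 (by omega) with ⟨z, ⟨j, hj, rfl⟩, v, hv, hv'⟩ | h
      · left
        refine ⟨j, hj, (wd_le hv').trans hv⟩
      · right
        have h7 : (C:ℝ) ≤ 2^C := by exact_mod_cast (Nat.lt_two_pow_self (n := C)).le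
        have h8 : (5:ℝ) * t.length ≤ 7 * ρ.length - 9 * t.length := by linarith
        have h9 : (2:ℝ)^(C+2) * (5 * t.length) ≤ 9 * t.length * ω k := by
          refine le_trans ?_ h; gcongr
        have h10 : (2:ℝ)^(C+2) = 4 * 2^C := by ring
        rw [h10] at h9
        have h11 : (20:ℝ) * C * t.length ≤ 9 * t.length * ω k := by
          refine le_trans ?_ h9
          nlinarith
        have h12 : (20:ℝ) * C ≤ 9 * ω k := by
          by_contra hc
          push Not at hc
          nlinarith
        have : (0:ℝ) ≤ C := by positivity
        linarith

theorem cyc0 (hR : SC σ R) (hU : Uni σ R) {t s : Word S} (h : t ++ s ∈ R) (h2 : t.length ≤ s.length)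
    {q : Word S} (hq : evalWord σ q = evalWord σ t) : 5 * t.length ≤ 9 * q.length := by
  refine a1 hR hU ((hR.red _ h).infix ⟨[], s, by simp⟩) ?_ hq
  rintro t' ρ' ⟨a, b, rfl⟩ hρ' hp
  have h3 : t' ++ b ++ s ++ a ∈ R := by
    have := hR.rot a (t' ++ b ++ s) (by simpa using h)
    simpa using this
  by_cases he : ρ' = t' ++ b ++ s ++ a
  · rw [he]; simp at h2 ⊢; omega
  · have := hR.piece _ hρ' _ h3 he t' hp ⟨b ++ s ++ a, by simp⟩
    omega

theorem cyc (hR : SC σ R) (hU : Uni σ R) {t s : Word S} (h : t ++ s ∈ R) (g : G) (hG : Gen σ) :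
    5 * min t.length s.length ≤ 9 * wordDist σ g (g * evalWord σ t) := by
  obtain ⟨q, hq, hq'⟩ := wd_ex hG g (g * evalWord σ t)
  have hq' := mul_left_cancel hq'
  rw [← hq]
  rcases le_total t.length s.length with h1 | h1
  · rw [min_eq_left h1]; exact cyc0 hR hU h h1 hq'
  · rw [min_eq_right h1]
    have h2 := hR.ev _ h
    rw [ev_append] at h2
    have := cyc0 hR hU (hR.rot _ _ h) h1 (q := wordInv q) (by
      rw [ev_inv, hq']; exact inv_eq_of_mul_eq_one_right h2)
    simpa using this

theorem around_mid (hR : SC σ R) (hU : Uni σ R) (hG : Gen σ) {x c : Word S} (h : x ++ c ∈ R) (g : G)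
    (h2 : x.length ≤ c.length) (j : ℕ) (hj : j ≤ x.length) :
    5 * (x ++ c).length ≤ 36 * wordDist σ (pw σ g (wordInv c) (c.length / 2)) (pw σ g x j) + 10 := by
  set n := c.length / 2 with hn
  have hc : wordInv ((wordInv c).take n) = c.drop (c.length - n) := by
    have := take_inv c (c.length - n)
    rw [Nat.sub_sub_self (by omega)] at this
    rw [this, wordInv_wordInv]
  have hr : (c.drop (c.length - n) ++ x.take j) ++ (x.drop j ++ c.take (c.length - n)) ∈ R := by
    have := hR.rot (x ++ c.take (c.length - n)) (c.drop (c.length - n)) (by simpa using h)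
    rwa [List.append_assoc, ← List.append_assoc (x.take j), List.take_append_drop]
  have h3 := cyc hR hU hr (pw σ g (wordInv c) n) hG
  have h4 : pw σ g (wordInv c) n * evalWord σ (c.drop (c.length - n) ++ x.take j) = pw σ g x j := by
    rw [ev_append, ← hc, ev_inv, pw, pw]; group
  rw [h4] at h3
  simp at h3 ⊢
  omega

end Dist
end MorseLTG

namespace MorseLTG
universe u

section Morse
variable {S : Type u} {G : Type u} [Group G] {σ : S → G} {R : Set (Word S)}

theorem gauge_ex (D : ℕ → ℕ) : ∃ M : ℝ → ℝ, IsMorseGauge M ∧ ∀ Q : ℝ, 1 ≤ Q → (D ⌈Q⌉₊ : ℝ) ≤ M Q := by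
  set E : ℕ → ℝ := fun n => ∑ i ∈ Finset.range (n+1), (D i : ℝ) with hE
  have hEm : Monotone E := by
    intro m n h
    apply Finset.sum_le_sum_of_subset_of_nonneg
    · intro i hi; simp at hi ⊢; omega
    · intros; positivity
  have hE0 : ∀ n, 0 ≤ E n := fun n => Finset.sum_nonneg (fun _ _ => by positivity)
  set F : ℝ → ℝ := fun s => E ⌈s⌉₊ with hF
  have hFm : Monotone F := fun a b h => hEm (Nat.ceil_mono h)
  have hI : ∀ a b, IntervalIntegrable F MeasureTheory.volume a b := fun a b => hFm.intervalIntegrable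
  refine ⟨fun t => ∫ s in (0:ℝ)..(t+2), F s, ⟨?_, ?_, ?_⟩, ?_⟩
  · intro a ha b hb hab
    have := intervalIntegral.integral_add_adjacent_intervals (hI 0 (a+2)) (hI (a+2) (b+2))
    have h2 : 0 ≤ ∫ s in (a+2)..(b+2), F s :=
      intervalIntegral.integral_nonneg (by linarith) (fun s _ => hE0 _)
    simp only
    linarith
  · have := intervalIntegral.continuous_primitive hI 0
    exact (this.comp (continuous_id.add continuous_const)).continuousOn
  · intro t ht
    exact intervalIntegral.integral_nonneg (by linarith) (fun s _ => hE0 _)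
  · intro Q hQ
    have := intervalIntegral.integral_add_adjacent_intervals (hI 0 (Q+1)) (hI (Q+1) (Q+2))
    have h2 : 0 ≤ ∫ s in (0:ℝ)..(Q+1), F s :=
      intervalIntegral.integral_nonneg (by linarith) (fun s _ => hE0 _)
    have h3 : ∫ s in (Q+1)..(Q+2), F Q ≤ ∫ s in (Q+1)..(Q+2), F s := by
      apply intervalIntegral.integral_mono_on (by linarith) (by simp) (hI _ _)
      intro x hx
      exact hFm (by linarith [hx.1])
    have h4 : ∫ s in (Q+1)..(Q+2), F Q = F Q := by simp; ring
    have h5 : (D ⌈Q⌉₊ : ℝ) ≤ F Q :=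
      Finset.single_le_sum (f := fun i => (D i : ℝ)) (fun _ _ => by positivity) (by simp)
    simp only
    linarith

theorem DQGeoOn.mono' {Q Q' : ℝ} (h1 : 1 ≤ Q) (h : Q ≤ Q') {I : Set ℤ} {p : ℤ → G}
    (hp : DQGeoOn σ Q I p) : DQGeoOn σ Q' I p := by
  refine ⟨hp.1, fun m hm n hn => ?_⟩
  obtain ⟨h2, h3⟩ := hp.2 m hm n hn
  have h0 := abs_nonneg ((n:ℝ) - m)
  constructor
  · refine le_trans ?_ h2
    gcongr
  · refine h3.trans ?_
    gcongr

theorem DQGeoOn.sub {Q : ℝ} {I J : Set ℤ} (hJ : J ⊆ I) {p : ℤ → G}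
    (hp : DQGeoOn σ Q I p) : DQGeoOn σ Q J p :=
  ⟨fun n h1 h2 => hp.1 n (hJ h1) (hJ h2), fun m hm n hn => hp.2 m (hJ hm) n (hJ hn)⟩

theorem dqgeo_of (hG : Gen σ) {Q : ℝ} {I : Set ℤ} {p : ℤ → G} (h1 : DIsPath σ I p)
    (h : ∀ m ∈ I, ∀ n ∈ I, m ≤ n → ((n:ℝ) - m) / Q - Q ≤ wordDist σ (p m) (p n) ∧
      (wordDist σ (p m) (p n) : ℝ) ≤ Q * ((n:ℝ) - m) + Q) : DQGeoOn σ Q I p := by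
  refine ⟨h1, fun m hm n hn => ?_⟩
  rcases le_total m n with hmn | hmn
  · have : ((m:ℝ)) ≤ n := by exact_mod_cast hmn
    rw [abs_of_nonneg (by linarith)]
    exact h m hm n hn hmn
  · have : ((n:ℝ)) ≤ m := by exact_mod_cast hmn
    rw [abs_of_nonpos (by linarith), wd_symm hG, neg_sub]
    exact h n hn m hm hmn

theorem pow_path (g : G) (w : Word S) (I : Set ℤ) : DIsPath σ I (pathOfWord σ g w) := by
  intro n _ _
  have h : n.toNat ≤ (n+1).toNat := by omega
  have := pw_dist_le (σ := σ) g w h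
  refine this.trans ?_
  omega

theorem around_qg (hR : SC σ R) (hU : Uni σ R) (hG : Gen σ) {x c : Word S} (h : x ++ c ∈ R) (g : G)
    {K : ℕ} (hK : 1 ≤ K) (hx : (x ++ c).length ≤ K * x.length) :
    DQGeoOn σ (2 * K) (Icc 0 (c.length : ℤ)) (pathOfWord σ g (wordInv c)) := by
  have hK' : (1:ℝ) ≤ K := by exact_mod_cast hK
  refine dqgeo_of hG (pow_path _ _ _) ?_
  rintro m ⟨hm, hm'⟩ n ⟨hn, hn'⟩ hmn
  lift m to ℕ using hm
  lift n to ℕ using hn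
  have hmn : m ≤ n := by exact_mod_cast hmn
  have hn' : n ≤ c.length := by exact_mod_cast hn'
  have e1 : pathOfWord σ g (wordInv c) m = pw σ g (wordInv c) m := rfl
  have e2 : pathOfWord σ g (wordInv c) n = pw σ g (wordInv c) n := rfl
  rw [e1, e2]
  have hup := pw_dist_le (σ := σ) g (wordInv c) hmn
  have hup' : (wordDist σ (pw σ g (wordInv c) m) (pw σ g (wordInv c) n) : ℝ) ≤ n - m := by
    have : wordDist σ (pw σ g (wordInv c) m) (pw σ g (wordInv c) n) + m ≤ n := by omega
    have : (wordDist σ (pw σ g (wordInv c) m) (pw σ g (wordInv c) n) : ℝ) + m ≤ n := by exact_mod_cast this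
    linarith
  have hnm : (m:ℝ) ≤ n := by exact_mod_cast hmn
  constructor
  · have h1 : wordInv c ++ wordInv x ∈ R := by rw [← wordInv_append]; exact hR.inv _ h
    have h2 : ((wordInv c).drop m).take (n-m) ++ ((wordInv c).drop n ++ wordInv x ++ (wordInv c).take m) ∈ R := by
      have := hR.rot ((wordInv c).take m) ((wordInv c).drop m ++ wordInv x) (by
        rwa [← List.append_assoc, List.take_append_drop])
      have e3 : (wordInv c).drop m = ((wordInv c).drop m).take (n-m) ++ (wordInv c).drop n := by
        conv_lhs => rw [← List.take_append_drop (n-m) ((wordInv c).drop m)]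
        rw [List.drop_drop, Nat.add_sub_cancel' hmn]
      rw [e3] at this
      simpa using this
    have h3 := cyc hR hU h2 (pw σ g (wordInv c) m) hG
    rw [pw_seg g _ hmn] at h3
    set d := wordDist σ (pw σ g (wordInv c) m) (pw σ g (wordInv c) n) with hd
    simp at h3 hx
    have h4 : 5 * (n - m) ≤ 9 * (K * d) := by
      rcases le_total (n-m) (c.length - n + (x.length + m)) with h5 | h5
      · have : min (n-m) (min (c.length - m) (c.length - n + (x.length + min m c.length))) = n - m := by omega
        rw [this] at h3
        nlinarith
      · have : min (n-m) (min (c.length - m) (c.length - n + (x.length + min m c.length))) = c.length - n + (x.length + m) := by omega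
        rw [this] at h3
        have h6 : x.length ≤ c.length - n + (x.length + m) := by omega
        have h7 : n - m ≤ K * x.length := by omega
        nlinarith
    have h5 : (5:ℝ) * (n - m) ≤ 9 * (K * d) := by
      have : (5:ℝ) * ((n - m : ℕ):ℝ) ≤ 9 * (K * d) := by exact_mod_cast h4
      rwa [Nat.cast_sub hmn] at this
    have h6 : (((n:ℕ):ℤ):ℝ) = n := by simp
    have h7 : (((m:ℕ):ℤ):ℝ) = m := by simp
    rw [h6, h7]
    have h8 : ((n:ℝ) - m) / (2 * K) ≤ d := by
      rw [div_le_iff₀ (by positivity)]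
      have : (0:ℝ) ≤ K * d := by positivity
      nlinarith
    linarith
  · simp only [Int.cast_natCast]
    nlinarith

theorem path_word0 {a b : ℤ} (hab : a ≤ b) {q : ℤ → G} (hG : Gen σ) (hq : DIsPath σ (Icc a b) q) :
    ∃ u : Word S, (u.length : ℤ) ≤ b - a ∧ q a * evalWord σ u = q b ∧
      ∀ k, ∃ n ∈ Icc a b, pw σ (q a) u k = q n := by
  induction b, hab using Int.le_induction with
  | base => exact ⟨[], by simp, by simp, fun k => ⟨a, by simp, by simp [pw]⟩⟩
  | succ b hab ih =>
    obtain ⟨u, h1, h2, h3⟩ := ih (fun n h h' => hq n ⟨h.1, by linarith [h.2]⟩ ⟨h'.1, by linarith [h'.2]⟩)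
    obtain ⟨v, h4, h5⟩ := wd_ex hG (q b) (q (b+1))
    have h6 := hq b ⟨hab, by simp⟩ ⟨by omega, by simp⟩
    refine ⟨u ++ v, by simp; omega, by rw [ev_append, ← mul_assoc, h2, h5], ?_⟩
    intro k
    rcases le_or_gt k u.length with hk | hk
    · obtain ⟨n, hn, h⟩ := h3 k
      refine ⟨n, ⟨hn.1, by linarith [hn.2]⟩, ?_⟩
      rw [pw, List.take_append_of_le_length hk]; exact h
    · refine ⟨b+1, ⟨by omega, by simp⟩, ?_⟩
      rw [pw_end _ _ (by simp; omega), ev_append, ← mul_assoc, h2, h5]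

theorem path_word {a b : ℤ} {q : ℤ → G} (hG : Gen σ) (hq : DIsPath σ (Icc a b) q) {m n : ℤ}
    (hm : m ∈ Icc a b) (hn : n ∈ Icc a b) :
    ∃ u : Word S, (u.length : ℤ) ≤ |n - m| ∧ q m * evalWord σ u = q n ∧
      ∀ k, ∃ i ∈ Icc a b, pw σ (q m) u k = q i := by
  have key : ∀ m n, m ∈ Icc a b → n ∈ Icc a b → m ≤ n → ∃ u : Word S, (u.length : ℤ) ≤ n - m ∧ q m * evalWord σ u = q n ∧
      ∀ k, ∃ i ∈ Icc a b, pw σ (q m) u k = q i := by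
    intro m n hm hn hmn
    have hsub : Icc m n ⊆ Icc a b := Icc_subset_Icc hm.1 hn.2
    obtain ⟨u, h1, h2, h3⟩ := path_word0 hmn hG (fun i h h' => hq i (hsub h) (hsub h'))
    refine ⟨u, h1, h2, fun k => ?_⟩
    obtain ⟨i, hi, h⟩ := h3 k
    exact ⟨i, hsub hi, h⟩
  rcases le_total m n with hmn | hmn
  · obtain ⟨u, h1, h2⟩ := key m n hm hn hmn
    exact ⟨u, by rwa [abs_of_nonneg (by omega)], h2⟩
  · obtain ⟨u, h1, h2, h3⟩ := key n m hn hm hmn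
    refine ⟨wordInv u, by rw [abs_of_nonpos (by omega)]; simpa using h1, by rw [ev_inv, ← h2]; group, ?_⟩
    intro k
    obtain ⟨i, hi, h⟩ := h3 (u.length - k)
    refine ⟨i, hi, ?_⟩
    rw [← h]
    rcases le_total k u.length with hk | hk
    · have := take_inv u (u.length - k)
      rw [Nat.sub_sub_self hk] at this
      rw [pw, this, ev_inv, pw, ← h2]
      have e : evalWord σ u = evalWord σ (u.take (u.length - k)) * evalWord σ (u.drop (u.length - k)) := by
        rw [← ev_append, List.take_append_drop]
      rw [e]; group
    · rw [pw_end _ _ (by simpa using hk), ev_inv, Nat.sub_eq_zero_of_le hk, pw_zero, ← h2]; group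

def cc (E Q : ℝ) : ℝ := E + Q * (Q * (2 * E + 1 + Q)) + Q

theorem conn (hG : Gen σ) {Q E : ℝ} (hQ : 1 ≤ Q) (hE : 0 ≤ E) {a b : ℤ} (hab : a ≤ b) {p : ℤ → G}
    (hp : DQGeoOn σ Q (Icc a b) p) {P : ℕ → G} {m : ℕ} (h0 : P 0 = p a) (hm : P m = p b)
    (hP : ∀ j < m, wordDist σ (P j) (P (j+1)) ≤ 1)
    (hn : ∀ j ≤ m, ∃ n ∈ Icc a b, (wordDist σ (P j) (p n) : ℝ) ≤ E) :
    ∀ v ∈ Icc a b, ∃ j ≤ m, (wordDist σ (p v) (P j) : ℝ) ≤ cc E Q := by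
  intro v hv
  have hBm : ∃ i, i ≤ m ∧ ∃ n ∈ Icc a b, v ≤ n ∧ (wordDist σ (P i) (p n) : ℝ) ≤ E :=
    ⟨m, le_rfl, b, ⟨hab, le_rfl⟩, hv.2, by rw [hm, wd_self]; simpa using hE⟩
  classical
  obtain ⟨hi, n', hn', hvn', hd'⟩ := Nat.find_spec hBm
  set i := Nat.find hBm with hidef
  obtain ⟨j, hj, n, hnI, hnv, hd, hji⟩ : ∃ j, j ≤ m ∧ ∃ n ∈ Icc a b, n ≤ v ∧ (wordDist σ (P j) (p n) : ℝ) ≤ E ∧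
      wordDist σ (P j) (P i) ≤ 1 := by
    rcases Nat.eq_zero_or_pos i with h | h
    · refine ⟨0, Nat.zero_le _, a, ⟨le_rfl, hab⟩, hv.1, by rw [h0, wd_self]; simpa using hE, by rw [h, wd_self]; omega⟩
    · obtain ⟨n, hn1, hn2⟩ := hn (i-1) (by omega)
      refine ⟨i-1, by omega, n, hn1, ?_, hn2, ?_⟩
      · by_contra hc
        exact Nat.find_min hBm (m := i-1) (by omega) ⟨by omega, n, hn1, by omega, hn2⟩
      · have := hP (i-1) (by omega)
        rwa [Nat.sub_add_cancel h] at this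
  refine ⟨j, hj, ?_⟩
  have t1 : (wordDist σ (p n) (p n') : ℝ) ≤ 2 * E + 1 := by
    have e1 := wd_tri hG (p n) (P j) (p n')
    have e2 := wd_tri hG (P j) (P i) (p n')
    rw [wd_symm hG (p n)] at e1
    have : wordDist σ (p n) (p n') ≤ wordDist σ (P j) (p n) + (1 + wordDist σ (P i) (p n')) := by
      rw [wd_symm hG (p n)] at *; omega
    have : (wordDist σ (p n) (p n') : ℝ) ≤ wordDist σ (P j) (p n) + (1 + wordDist σ (P i) (p n')) := by
      exact_mod_cast this
    linarith
  have t2 := (hp.2 n hnI n' hn').1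
  have hnn : (n:ℝ) ≤ v := by exact_mod_cast hnv
  have hnn' : (v:ℝ) ≤ n' := by exact_mod_cast hvn'
  rw [abs_of_nonneg (by linarith)] at t2
  have t3 : ((n':ℝ) - n) ≤ Q * (2 * E + 1 + Q) := by
    have : ((n':ℝ) - n) / Q ≤ 2 * E + 1 + Q := by linarith
    rw [div_le_iff₀ (by linarith)] at this
    linarith
  have t4 := (hp.2 v hv n hnI).2
  rw [abs_of_nonpos (by linarith)] at t4
  have e1 := wd_tri hG (p v) (p n) (P j)
  rw [wd_symm hG (p n)] at e1
  have e1 : (wordDist σ (p v) (P j) : ℝ) ≤ wordDist σ (p v) (p n) + wordDist σ (P j) (p n) := by exact_mod_cast e1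
  unfold cc
  have : Q * -((n:ℝ) - v) ≤ Q * (Q * (2 * E + 1 + Q)) := by gcongr; linarith
  linarith

theorem w2a (hR : SC σ R) (hU : Uni σ R) (hG : Gen σ) {φ : ℕ → ℕ} (hφ : Subl φ) (Q : ℕ) (hQ : 1 ≤ Q) :
    ∃ D : ℕ, ∀ w : Word S, Red w → Ov R w → Small R φ w → ∀ (g : G) (q : ℤ → G) (a b : ℤ), a ≤ b →
      DQGeoOn σ Q (Icc a b) q → q a = g → q b = g * evalWord σ w →
      ∀ k ≤ w.length, ∃ n ∈ Icc a b, wordDist σ (pw σ g w k) (q n) ≤ D := by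
  obtain ⟨D, hD⟩ := a2 (σ := σ) hR hU hφ (Q+1)
  refine ⟨D + (18 * D + 3 + 2 * Q * D + Q * Q), ?_⟩
  intro w hw hov hS g q a b hab hq hqa hqb k0 hk0
  set T := 18 * D + 3 + 2 * Q * D + Q * Q with hT
  classical
  let good : ℕ → Prop := fun k => ∃ n ∈ Icc a b, wordDist σ (pw σ g w k) (q n) ≤ D
  have g0 : good 0 := ⟨a, ⟨le_rfl, hab⟩, by rw [pw_zero, hqa, wd_self]; omega⟩
  have g1 : good w.length := ⟨b, ⟨hab, le_rfl⟩, by rw [pw_end _ _ le_rfl, hqb, wd_self]; omega⟩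
  have hex : ∃ t, k0 ≤ t ∧ good t := ⟨_, hk0, g1⟩
  set t := Nat.find hex with ht
  obtain ⟨htk, nt, hnt, hdt⟩ := Nat.find_spec hex
  rw [← ht] at htk hdt
  have htw : t ≤ w.length := Nat.find_min' hex ⟨hk0, g1⟩
  set s := Nat.findGreatest good k0 with hs
  have hsk : s ≤ k0 := Nat.findGreatest_le _
  obtain ⟨ns, hns, hds⟩ : good s := Nat.findGreatest_spec (Nat.zero_le _) g0
  have hbad : ∀ k, s < k → k < t → ¬ good k := by
    intro k h1 h2 h3
    rcases le_total k k0 with h | h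
    · exact Nat.findGreatest_is_greatest h1 h h3
    · exact Nat.find_min hex h2 ⟨h, h3⟩
  by_cases hTs : t - s ≤ T
  · refine ⟨ns, hns, ?_⟩
    have e1 := wd_tri hG (pw σ g w k0) (pw σ g w s) (q ns)
    have e2 := pw_dist_le (σ := σ) g w hsk
    rw [wd_symm hG] at e2
    omega
  exfalso
  have hst : s ≤ t := hsk.trans htk
  obtain ⟨v1, hv1, hv1'⟩ := wd_ex hG (pw σ g w s) (q ns)
  obtain ⟨v2, hv2, hv2'⟩ := wd_ex hG (q nt) (pw σ g w t)
  obtain ⟨u, hu, hu', hu''⟩ := path_word hG hq.1 hns hnt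
  have hv2l : v2.length ≤ D := by rw [hv2, wd_symm hG]; exact hdt
  have hv1l : v1.length ≤ D := by rw [hv1]; exact hds
  set w' := (w.drop s).take (t-s) with hw'
  have hw'l : w'.length = t - s := by simp [hw']; omega
  have hinf : w' <:+: w := sub_infix _ _ _
  have heq : pw σ g w s * evalWord σ (v1 ++ u ++ v2) = pw σ g w t := by
    rw [ev_append, ev_append, ← mul_assoc, ← mul_assoc, hv1', hu', hv2']
  obtain ⟨ω, h1, h2⟩ := hD w' (hw.infix hinf) (hov.infix hinf) (hS.infix hinf) (pw σ g w s)
    (v1 ++ u ++ v2) (by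
      apply mul_left_cancel (a := pw σ g w s)
      rw [heq, pw_seg g w hst])
  rw [hw'l] at h1 h2
  have hmid : ∀ k, 4 * D < k → k + 4 * D < t - s → 2 * ((Q:ℝ)+1) ≤ ω k := by
    intro k hk1 hk2
    obtain ⟨-, ⟨j, hj, hjd⟩ | h⟩ := h2 k (by omega)
    · exfalso
      rw [pw_shift g w s k t (by omega)] at hjd
      rcases le_or_gt j v1.length with hj1 | hj1
      · have e0 := pw_dist_le (σ := σ) (pw σ g w s) (v1 ++ u ++ v2) (Nat.zero_le j)
        rw [pw_zero] at e0
        have e1 := wd_tri hG (pw σ g w s) (pw σ (pw σ g w s) (v1 ++ u ++ v2) j) (pw σ g w (s+k))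
        have e2 := a1dist hR hU hG hw hov g (Nat.le_add_right s k) (by omega)
        omega
      rcases le_or_gt j (v1.length + u.length) with hj2 | hj2
      · obtain ⟨i, hi, hi'⟩ := hu'' (j - v1.length)
        refine hbad (s+k) (by omega) (by omega) ⟨i, hi, ?_⟩
        rw [← hi', wd_symm hG]
        have e3 : pw σ (pw σ g w s) (v1 ++ u ++ v2) j = pw σ (q ns) u (j - v1.length) := by
          rw [pw, List.take_append_of_le_length (by simp; omega), List.take_append, ev_append, ← mul_assoc,
            List.take_of_length_le (by omega), hv1', pw]
        rw [← e3]; exact hjd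
      · have e0 := pw_dist_le (σ := σ) (pw σ g w s) (v1 ++ u ++ v2) hj
        rw [pw_end _ _ le_rfl, heq] at e0
        simp only [List.length_append] at e0
        have e1 := wd_tri hG (pw σ g w (s+k)) (pw σ (pw σ g w s) (v1 ++ u ++ v2) j) (pw σ g w t)
        have e2 := a1dist hR hU hG hw hov g (i := s+k) (j := t) (by omega) htw
        rw [wd_symm hG (pw σ g w (s+k)) (pw σ (pw σ g w s) (v1 ++ u ++ v2) j)] at e1
        omega
    · push_cast at h; exact h
  have hsum : ((t - s - 4 * D - 4 * D - 1 : ℕ) : ℝ) * (2 * ((Q:ℝ)+1)) ≤ ∑ k ∈ Finset.range (t-s), ω k := by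
    have e1 : ∑ k ∈ Finset.Ioo (4*D) (t - s - 4*D), ω k ≤ ∑ k ∈ Finset.range (t-s), ω k := by
      apply Finset.sum_le_sum_of_subset_of_nonneg
      · intro k hk; simp at hk ⊢; omega
      · intro k hk _; exact (h2 k (Finset.mem_range.1 hk)).1
    refine le_trans ?_ e1
    have := Finset.card_nsmul_le_sum (Finset.Ioo (4*D) (t - s - 4*D)) ω (2 * ((Q:ℝ)+1)) (by
      intro k hk; simp at hk; exact hmid k hk.1 (by omega))
    rwa [Nat.card_Ioo, nsmul_eq_mul] at this
  have hu2 : (u.length:ℝ) ≤ Q * (2 * D + (t - s : ℕ) + Q) := by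
    have e1 := (hq.2 ns hns nt hnt).1
    have e2 : wordDist σ (q ns) (q nt) ≤ 2 * D + (t - s) := by
      have f1 := wd_tri hG (q ns) (pw σ g w s) (q nt)
      have f2 := wd_tri hG (pw σ g w s) (pw σ g w t) (q nt)
      have f3 := pw_dist_le (σ := σ) g w hst
      rw [wd_symm hG (q ns) (pw σ g w s)] at f1
      omega
    have e2 : (wordDist σ (q ns) (q nt) : ℝ) ≤ 2 * D + (t - s : ℕ) := by exact_mod_cast e2
    have e3 : (u.length:ℝ) ≤ |(nt:ℝ) - ns| := by exact_mod_cast hu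
    have e4 : |(nt:ℝ) - ns| / Q ≤ 2 * D + (t - s : ℕ) + Q := by linarith
    have hQ0 : (0:ℝ) < Q := by exact_mod_cast hQ
    rw [div_le_iff₀ hQ0] at e4
    linarith
  have hu3 : u.length ≤ Q * (2 * D + (t - s) + Q) := by exact_mod_cast hu2
  have h4 : (t - s - 4 * D - 4 * D - 1) * (2 * (Q+1)) ≤ (v1 ++ u ++ v2).length := by
    have := hsum.trans h1
    exact_mod_cast this
  simp only [List.length_append] at h4
  set L := t - s with hL
  have h5 : v1.length + u.length + v2.length ≤ (Q+1) * L := by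
    have : Q * (2 * D + L + Q) = 2 * Q * D + Q * L + Q * Q := by ring
    have : (Q+1) * L = Q * L + L := by ring
    omega
  have h6 : (Q+1) * (2 * (L - 4 * D - 4 * D - 1)) ≤ (Q+1) * L := by
    calc _ = (L - 4 * D - 4 * D - 1) * (2 * (Q+1)) := by ring
      _ ≤ _ := h4.trans h5
  have h7 := Nat.le_of_mul_le_mul_left h6 (by omega)
  omega

theorem w2 (hR : SC σ R) (hU : Uni σ R) (hG : Gen σ) {φ : ℕ → ℕ} (hφ : Subl φ) :
    ∃ M, IsMorseGauge M ∧ ∀ w : Word S, Red w → Ov R w → Small R φ w →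
      ∀ (g : G) (Q : ℝ) (q : ℤ → G) (a b : ℤ), 1 ≤ Q → a ≤ b →
      DQGeoOn σ Q (Icc a b) q → q a = g → q b = g * evalWord σ w →
      ∀ n ∈ Icc a b, ∃ k ≤ w.length, (wordDist σ (q n) (pw σ g w k) : ℝ) ≤ M Q := by
  have h : ∀ Q : ℕ, ∃ D : ℕ, 1 ≤ Q → ∀ w : Word S, Red w → Ov R w → Small R φ w → ∀ (g : G) (q : ℤ → G) (a b : ℤ), a ≤ b →
      DQGeoOn σ Q (Icc a b) q → q a = g → q b = g * evalWord σ w →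
      ∀ k ≤ w.length, ∃ n ∈ Icc a b, wordDist σ (pw σ g w k) (q n) ≤ D := by
    intro Q
    by_cases hQ : 1 ≤ Q
    · obtain ⟨D, hD⟩ := w2a (σ := σ) hR hU hG hφ Q hQ
      exact ⟨D, fun _ => hD⟩
    · exact ⟨0, fun h => absurd h hQ⟩
  choose D hD using h
  obtain ⟨M, hM, hM'⟩ := gauge_ex (fun n => ⌈cc (D n) n⌉₊)
  refine ⟨M, hM, ?_⟩
  intro w hw hov hS g Q q a b hQ hab hq hqa hqb n hn
  have hQ1 : (1:ℝ) ≤ (⌈Q⌉₊ : ℝ) := hQ.trans (Nat.le_ceil Q)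
  have hQn : 1 ≤ ⌈Q⌉₊ := by exact_mod_cast hQ1
  have hq' := hq.mono' hQ (Nat.le_ceil Q)
  obtain ⟨k, hk, h⟩ := conn hG hQ1 (Nat.cast_nonneg (D ⌈Q⌉₊)) hab hq' (P := pw σ g w) (m := w.length)
    (by simp [hqa]) (by rw [pw_end _ _ le_rfl, hqb])
    (fun j _ => by have := pw_dist_le (σ := σ) g w (Nat.le_add_right j 1); omega)
    (fun j hj => by
      obtain ⟨i, hi, h⟩ := hD _ hQn w hw hov hS g q a b hab hq' hqa hqb j hj
      exact ⟨i, hi, by exact_mod_cast h⟩) n hn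
  exact ⟨k, hk, h.trans ((Nat.le_ceil _).trans (hM' Q hQ))⟩

end Morse
end MorseLTG

namespace MorseLTG
universe u
section PartC
variable {S : Type u} {G : Type u} [Group G] {σ : S → G} {R : Set (Word S)}

theorem DMorseOn.sub {M : ℝ → ℝ} {I J : Set ℤ} (hJ : J ⊆ I) {p : ℤ → G} (h : DMorseOn σ M I p) :
    DMorseOn σ M J p :=
  fun Q hQ s hs t ht => h Q hQ s (hJ hs) t (hJ ht)

theorem DQGeoOn.left {Q : ℝ} {I : Set ℤ} {p : ℤ → G} (g : G) (h : DQGeoOn σ Q I p) :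
    DQGeoOn σ Q I (fun n => g * p n) := by
  refine ⟨fun n h1 h2 => ?_, fun m hm n hn => ?_⟩
  · simp only [wd_left]; exact h.1 n h1 h2
  · simp only [wd_left]; exact h.2 m hm n hn

/-- translate in group and time -/
theorem DMorseOn.trans {M : ℝ → ℝ} {N : ℕ} {p p' : ℤ → G} {s s' : ℤ} (g : G)
    (h : DMorseOn σ M (Icc s (s+N)) p) (hp : ∀ k : ℕ, k ≤ N → p' (s' + k) = g * p (s + k)) :
    DMorseOn σ M (Icc s' (s'+N)) p' := by
  have hp' : ∀ n ∈ Icc s' (s'+N), p' n = g * p (s + (n - s')) := by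
    intro n hn
    obtain ⟨h1, h2⟩ := hn
    obtain ⟨k, hk⟩ := Int.eq_ofNat_of_zero_le (show 0 ≤ n - s' by omega)
    have := hp k (by omega)
    rw [hk, ← this]; congr 1; omega
  intro Q hQ a ha b hb hab q c d hcd hq h1 h2 n hn
  obtain ⟨ha1, ha2⟩ := id ha
  obtain ⟨hb1, hb2⟩ := id hb
  obtain ⟨m, hm, h3⟩ := h Q hQ (s + (a - s')) ⟨by omega, by omega⟩ (s + (b - s')) ⟨by omega, by omega⟩ (by omega)
    (fun n => g⁻¹ * q n) c d hcd (hq.left _) (by simp [h1, hp' a ha]) (by simp [h2, hp' b hb]) n hn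
  obtain ⟨hm1, hm2⟩ := hm
  refine ⟨m - s + s', ⟨by omega, by omega⟩, ?_⟩
  rw [hp' _ ⟨by omega, by omega⟩]
  rw [← wd_left g, mul_inv_cancel_left] at h3
  convert h3 using 5
  ring

theorem seg_word (hG : Gen σ) {p : ℤ → G} (s : ℤ) (N : ℕ)
    (h : ∀ k : ℕ, k < N → wordDist σ (p (s+k)) (p (s+k+1)) = 1) :
    ∃ w : Word S, w.length = N ∧ ∀ k : ℕ, k ≤ N → pw σ (p s) w k = p (s + k) := by
  induction N with
  | zero => exact ⟨[], rfl, fun k hk => by simp [Nat.le_zero.1 hk]⟩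
  | succ N ih =>
    obtain ⟨w, h1, h2⟩ := ih (fun k hk => h k (by omega))
    obtain ⟨v, h3, h4⟩ := wd_ex hG (p (s+N)) (p (s+N+1))
    rw [h N (by omega)] at h3
    refine ⟨w ++ v, by simp [h1, h3], fun k hk => ?_⟩
    rcases Nat.lt_or_ge N k with h5 | h5
    · have : k = N + 1 := by omega
      subst this
      rw [pw_end _ _ (by simp [h1, h3]), ev_append, ← mul_assoc, ← pw_end (σ := σ) (p s) w (k := N) (by omega), h2 N le_rfl, h4]
      congr 1; push_cast; ring
    · rw [← h2 k h5, pw, List.take_append_of_le_length (by omega)]; rfl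

theorem DGeodesicOn.qg {I : Set ℤ} {p : ℤ → G} (h : DGeodesicOn σ I p) : DQGeoOn σ 1 I p := by
  have h' : ∀ m ∈ I, ∀ n ∈ I, (wordDist σ (p m) (p n) : ℝ) = |(n:ℝ) - m| := by
    intro m hm n hn
    have := h m hm n hn
    have : ((wordDist σ (p m) (p n) : ℤ) : ℝ) = ((|n - m| : ℤ) : ℝ) := by rw [this]
    simpa using this
  refine ⟨fun n h1 h2 => ?_, fun m hm n hn => ?_⟩
  · have := h n h1 _ h2
    simp at this; omega
  · rw [h' m hm n hn]; constructor <;> simp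

theorem partC [Finite S] (hG : Gen σ) (h : CayMLTG σ) : CayStronglySigmaCompact σ := by
  classical
  let Loc : ℕ × Finset (Word S) → (ℤ → G) → Prop := fun i p =>
    ∀ s : ℤ, 0 ≤ s → ∃ w ∈ i.2, ∀ k : ℕ, k ≤ i.1 → pw σ (p s) w k = p (s + k)
  let Ok : ℕ × Finset (Word S) → (ℝ → ℝ) → Prop := fun i M => IsMorseGauge M ∧
    ∀ p, DGeodesicRay σ p → Loc i p → DMorseOn σ M (Ici 0) p
  let Ms : ℕ × Finset (Word S) → ℝ → ℝ := fun i => if h : ∃ M, Ok i M then h.choose else fun _ => 0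
  have hMs : ∀ i, IsMorseGauge (Ms i) := by
    intro i
    by_cases h : ∃ M, Ok i M
    · simp only [Ms, dif_pos h]; exact h.choose_spec.1
    · simp only [Ms, dif_neg h]
      exact ⟨fun _ _ _ _ _ => le_rfl, continuousOn_const, fun _ _ => le_rfl⟩
  have hMs' : ∀ i, (∃ M, Ok i M) → Ok i (Ms i) := by
    intro i h
    simp only [Ms, dif_pos h]; exact h.choose_spec
  have key : ∀ M : ℝ → ℝ, IsMorseGauge M → ∃ i, ∀ p : ℤ → G, DGeodesicRay σ p →
      DMorseOn σ M (Set.Ici 0) p → DMorseOn σ (Ms i) (Set.Ici 0) p := by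
    intro M hM
    obtain ⟨L, Q', M', hL, hQ', hM', hh⟩ := h 1 le_rfl M hM
    set N := ⌈L⌉₊ with hN
    have hfin : {w : Word S | w.length = N ∧ DMorseOn σ M (Icc 0 ((0:ℤ) + N)) (pathOfWord σ 1 w)}.Finite :=
      (List.finite_length_eq (S × Bool) N).subset (fun w hw => hw.1)
    have hok : Ok (N, hfin.toFinset) M' := by
      refine ⟨hM', fun p hp hloc => ?_⟩
      refine (hh (Ici 0) ordConnected_Ici p ?_).2
      intro s hs t ht hst hL'
      have htN : t ≤ s + N := by
        have : (((t - s : ℤ)) : ℝ) ≤ N := hL'.trans (Nat.le_ceil L)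
        have : t - s ≤ (N:ℤ) := by exact_mod_cast this
        omega
      refine ⟨DQGeoOn.sub (fun x hx => le_trans hs hx.1) hp.2.qg, ?_⟩
      obtain ⟨w, hw, hw'⟩ := hloc s hs
      simp only [Set.Finite.mem_toFinset, mem_ofPred_eq] at hw
      have := DMorseOn.trans (p' := p) (s' := s) (p s) hw.2 (fun k hk => by
        rw [← hw' k hk]; simp [pathOfWord, pw])
      exact DMorseOn.sub (show Icc s t ⊆ Icc s (s+N) from fun x hx => ⟨hx.1, hx.2.trans htN⟩) this
    refine ⟨(N, hfin.toFinset), fun p hp hpM => (hMs' (N, hfin.toFinset) ⟨M', hok⟩).2 p hp ?_⟩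
    intro s hs
    obtain ⟨w, hw1, hw2⟩ := seg_word hG (p := p) s N (fun k hk => by
      have := hp.2 (s+k) (by simp; omega) (s+k+1) (by simp; omega)
      simp at this; omega)
    refine ⟨w, ?_, hw2⟩
    simp only [Set.Finite.mem_toFinset, mem_ofPred_eq]
    refine ⟨hw1, ?_⟩
    have : DMorseOn σ M (Icc s (s+N)) p := hpM.sub (fun x hx => le_trans hs hx.1)
    refine this.trans (p s)⁻¹ (fun k hk => ?_)
    rw [← hw2 k hk]; simp [pathOfWord, pw]
  have : Countable (ℕ × Finset (Word S)) := inferInstance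
  obtain ⟨f, hf⟩ := exists_surjective_nat (ℕ × Finset (Word S))
  refine ⟨fun n => Ms (f n), fun n => hMs _, ?_, ?_⟩
  · intro p hp M hM hpM
    obtain ⟨i, hi⟩ := key M hM
    obtain ⟨n, rfl⟩ := hf i
    exact ⟨n, hi p hp hpM⟩
  · intro M hM
    obtain ⟨i, hi⟩ := key M hM
    obtain ⟨n, rfl⟩ := hf i
    exact ⟨n, hi⟩

theorem partC2 (h : CayStronglySigmaCompact σ) : CaySigmaCompact σ := by
  obtain ⟨Ms, h1, h2, -⟩ := h
  exact ⟨Ms, h1, h2⟩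

end PartC

section Inst
variable {S : Type u} (R : Set (Word S))

def RR : Set (Word S) := symmClosure R \ {[]}

theorem rot_ex (w u v : Word S) (k : ℕ) (h : u ++ v = w.rotate k) : ∃ k', v ++ u = w.rotate k' := by
  refine ⟨k + u.length, ?_⟩
  rw [← List.rotate_rotate, ← h, List.rotate_append_length_eq]

theorem inv_rot (w : Word S) (k : ℕ) : ∃ k', wordInv (w.rotate k) = (wordInv w).rotate k' := by
  rw [wordInv_eq, wordInv_eq, List.map_rotate, List.reverse_rotate]
  exact ⟨_, rfl⟩

theorem red_iff (w : Word S) (h : ReducedWord w) : Red w := by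
  refine List.IsChain.imp ?_ h
  rintro ⟨a, b⟩ ⟨c, d⟩ h1 h2
  simp [linv] at h2
  obtain ⟨rfl, rfl⟩ := h2
  simp at h1

theorem ev_FreeGroup {K : Type*} [Group K] (f : S → K) (w : Word S) :
    FreeGroup.lift f (FreeGroup.mk w) = evalWord f w := by
  simp [evalWord, FreeGroup.lift_mk, cond_eq_ite]

theorem ev_pres (w : Word S) : evalWord (presGen R) w = PresentedGroup.mk _ (FreeGroup.mk w) := by
  rw [← ev_FreeGroup]
  congr 1
  ext a
  rfl

theorem ev_mem {w : Word S} (hw : w ∈ R) : evalWord (presGen R) w = 1 := by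
  rw [ev_pres]
  exact PresentedGroup.one_of_mem ⟨w, hw, rfl⟩

theorem ev_rot {K : Type u} [Group K] (f : S → K) (w : Word S) (k : ℕ) (h : evalWord f w = 1) :
    evalWord f (w.rotate k) = 1 := by
  rw [← List.rotate_mod]
  rcases w.eq_nil_or_concat with rfl | h'
  · simpa using h
  have hw : w ≠ [] := by rcases h' with ⟨_, _, rfl⟩; simp
  have : k % w.length < w.length := Nat.mod_lt _ (List.length_pos_iff.2 hw)
  rw [List.rotate_eq_drop_append_take this.le]
  rw [← List.take_append_drop (k % w.length) w, ev_append] at h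
  unfold evalWord at *
  simp only [List.map_append, List.prod_append] at *
  exact mul_eq_one_comm.1 h

theorem genPres : Gen (presGen R) := by
  intro g
  obtain ⟨x, rfl⟩ := QuotientGroup.mk_surjective g
  induction x using Quot.inductionOn with
  | h w => exact ⟨w, ev_pres R w⟩

theorem uniPres : Uni (presGen R) (RR R) := by
  intro K _ f hf w hw
  have h1 : ∀ r ∈ FreeGroup.mk '' R, FreeGroup.lift f r = 1 := by
    rintro _ ⟨ρ, hρ, rfl⟩
    rw [ev_FreeGroup]
    by_cases h0 : ρ = []
    · simp [h0]
    · exact hf ρ ⟨⟨ρ, hρ, 0, by simp⟩, h0⟩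
  rw [ev_pres] at hw
  have := congrArg (PresentedGroup.toGroup h1) hw
  rw [map_one] at this
  rw [← ev_FreeGroup]
  exact this

theorem scPres (h : SmallCancellation R (1/9)) : SC (presGen R) (RR R) where
  ne ρ h := h.2
  rot u v huv := by
    obtain ⟨⟨r, hr, k, hk⟩, h2⟩ := huv
    refine ⟨⟨r, hr, ?_⟩, ?_⟩
    · rcases hk with hk | hk
      · obtain ⟨k', hk'⟩ := rot_ex _ _ _ _ hk
        exact ⟨k', Or.inl hk'⟩
      · obtain ⟨k', hk'⟩ := rot_ex _ _ _ _ hk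
        exact ⟨k', Or.inr hk'⟩
    · simp at h2 ⊢; tauto
  inv ρ hρ := by
    obtain ⟨⟨r, hr, k, hk⟩, h2⟩ := hρ
    refine ⟨⟨r, hr, ?_⟩, wordInv_ne_nil h2⟩
    obtain ⟨k', hk'⟩ := inv_rot r k
    obtain ⟨k2, hk2⟩ := inv_rot (wordInv r) k
    rcases hk with rfl | rfl
    · exact ⟨k', Or.inr hk'⟩
    · rw [wordInv_wordInv] at hk2
      exact ⟨k2, Or.inl hk2⟩
  red ρ hρ := by
    obtain ⟨⟨r, hr, k, hk⟩, h2⟩ := hρ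
    rcases hk with rfl | rfl
    · exact red_iff _ (h.1 r hr k)
    · obtain ⟨k2, hk2⟩ := inv_rot (wordInv r) k
      rw [wordInv_wordInv] at hk2
      rw [← wordInv_wordInv ((wordInv r).rotate k), hk2]
      exact (red_iff _ (h.1 r hr k2)).inv
  piece ρ hρ ρ' hρ' hne t ht ht' := by
    rcases eq_or_ne t [] with rfl | h0
    · have := List.length_pos_iff.2 hρ.2
      simpa using this
    · have := h.2 ρ hρ.1 t ⟨h0, ρ, hρ.1, ρ', hρ'.1, hne, ht, ht'⟩ ht.isInfix
      have : (9:ℝ) * t.length < ρ.length := by linarith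
      exact_mod_cast this
  ev ρ hρ := by
    obtain ⟨⟨r, hr, k, hk⟩, h2⟩ := hρ
    rcases hk with rfl | rfl
    · exact ev_rot _ _ _ (ev_mem R hr)
    · exact ev_rot _ _ _ (by rw [ev_inv, ev_mem R hr, inv_one])

end Inst
end MorseLTG

namespace MorseLTG
universe u
section PartD
variable {S : Type u} {G : Type u} [Group G] {σ : S → G} {R : Set (Word S)}

theorem trim (t : Word S) (ht : t ≠ []) (b : S × Bool) :
    ∃ x : Word S, (x <:+: t ∨ x <:+: wordInv t) ∧ t.length ≤ 2 * x.length ∧ ∀ y ∈ x.head?, y ≠ b := by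
  have hp := List.length_pos_iff.2 ht
  by_cases h : ∃ m, m < (t.length+1)/2 ∧ t[m]? ≠ some b
  · obtain ⟨m, hm, h⟩ := h
    refine ⟨t.drop m, Or.inl (List.drop_suffix m t).isInfix, by simp; omega, ?_⟩
    rintro y hy rfl
    rw [List.head?_drop] at hy
    exact h hy
  · push Not at h
    refine ⟨wordInv (t.take ((t.length+1)/2)), Or.inr ?_, by simp; omega, ?_⟩
    · rw [← drop_inv]; exact (List.drop_suffix _ _).isInfix
    · rintro y hy rfl
      rw [List.head?_eq_getElem?, wordInv_getElem? _ _ (by simp; omega)] at hy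
      have h1 := h ((t.length+1)/2 - 1) (by omega)
      rw [List.getElem?_take] at hy
      have h2 : (List.take ((t.length + 1) / 2) t).length - 1 - 0 = (t.length+1)/2 - 1 := by simp; omega
      rw [h2, if_pos (by omega), h1] at hy
      simp at hy
      exact linv_ne _ hy

theorem inf_rel (hR : SC σ R) {x t ρ : Word S} (hx : x <:+: t) (ht : t <+: ρ) (hρ : ρ ∈ R) :
    ∃ c, x ++ c ∈ R ∧ (x ++ c).length = ρ.length := by
  obtain ⟨a, b, rfl⟩ := hx
  obtain ⟨d, rfl⟩ := ht
  refine ⟨b ++ d ++ a, ?_, by simp; omega⟩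
  have := hR.rot a (x ++ b ++ d) (by simpa using hρ)
  simpa using this

theorem inf_inv {u v : Word S} (h : u <:+: v) : wordInv u <:+: wordInv v := by
  obtain ⟨a, b, rfl⟩ := h
  exact ⟨wordInv b, wordInv a, by simp⟩

theorem Small.inv' (hR : SC σ R) {φ : ℕ → ℕ} {t : Word S} (h : Small R φ t) : Small R φ (wordInv t) := by
  rintro u ρ hu hρ ⟨s, rfl⟩
  obtain ⟨ρ', h1, h2, h3⟩ := prefix_inv hR hρ
  have h4 := inf_inv hu
  rw [wordInv_wordInv] at h4
  have := h _ _ h4 h1 h2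
  rw [h3] at this
  simpa using this

theorem small_psi (hR : SC σ R) {φ : ℕ → ℕ} {n0 : ℕ} (hn : ∀ n, n0 ≤ n → 9 * φ n ≤ n) {x c : Word S}
    (hx : x ++ c ∈ R) (hl : n0 ≤ (x ++ c).length) (h : Small R φ x) :
    Small R (fun n => min (φ n) (n/9)) x := by
  intro u ρ hu hρ hup
  have h1 := h u ρ hu hρ hup
  rw [le_min_iff]
  refine ⟨h1, ?_⟩
  rcases le_or_gt n0 ρ.length with h2 | h2
  · have := hn _ h2
    omega
  · obtain ⟨d, h3, h4⟩ := inf_rel hR hu (List.prefix_append x c) hx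
    have := hR.piece ρ hρ (u ++ d) h3 (by rintro rfl; omega) u hup (List.prefix_append _ _)
    omega

def Inv (R : Set (Word S)) (ψ : ℕ → ℕ) (W : Word S) : Prop :=
  Red W ∧ Small R (fun n => 3 * ψ n) W ∧ ∀ u ρ, u <:+ W → ρ ∈ R → u <+: ρ → u.length ≤ 2 * ψ ρ.length

theorem Inv.step (hR : SC σ R) {ψ : ℕ → ℕ} {W x : Word S} (hW : Inv R ψ W) (hr : Red (W ++ x))
    (hs : Small R ψ x) (hl : W.length ≤ x.length) : Inv R ψ (W ++ x) := by
  refine ⟨hr, ?_, ?_⟩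
  · intro u ρ hu hρ hup
    rcases List.infix_append_iff.1 hu with h | h | ⟨s, h', rfl, h1, h2⟩
    · exact hW.2.1 u ρ h hρ hup
    · have := hs u ρ h hρ hup
      simp only; omega
    · have h3 := hW.2.2 s ρ h1 hρ ((List.prefix_append _ _).trans hup)
      obtain ⟨d, h4, h5⟩ := inf_rel hR (List.infix_append_right (l₁ := s) (l₂ := h')) hup hρ
      have h6 := hs h' _ h2.isInfix h4 (List.prefix_append _ _)
      rw [h5] at h6
      simp; omega
  · intro u ρ hu hρ hup
    rcases le_total u.length x.length with h | h
    · have := hs u ρ (List.suffix_of_suffix_length_le hu (List.suffix_append _ _) h).isInfix hρ hup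
      omega
    · obtain ⟨s, hs'⟩ := List.suffix_of_suffix_length_le (List.suffix_append W x) hu h
      subst hs'
      obtain ⟨d, h4, h5⟩ := inf_rel hR (List.infix_append_right (l₁ := s) (l₂ := x)) hup hρ
      have h6 := hs x _ (List.infix_refl _) h4 (List.prefix_append _ _)
      rw [h5] at h6
      have := hu.length_le
      simp at this ⊢; omega

theorem Inv.nil (ψ : ℕ → ℕ) : Inv R ψ [] := by
  refine ⟨List.isChain_nil, ?_, ?_⟩
  · intro u ρ hu; simp at hu; simp [hu]
  · intro u ρ hu; simp at hu; simp [hu]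

theorem Inv.geo (hR : SC σ R) (hU : Uni σ R) {ψ : ℕ → ℕ} (h9 : ∀ n, 9 * ψ n ≤ n) {W : Word S}
    (h : Inv R ψ W) : Geo σ W := by
  refine a1geo hR hU h.1 (fun t ρ h1 h2 h3 => ?_)
  have := h.2.1 t ρ h1 h2 h3
  have := h9 ρ.length
  simp at *; omega

theorem ray (hG : Gen σ) {W : ℕ → Word S} (hW : ∀ k, W k <+: W (k+1)) (hl : ∀ k, k ≤ (W k).length)
    (hgeo : ∀ k, Geo σ (W k)) {M : ℝ → ℝ} (hM : ∀ k w, w <:+: W k →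
      ∀ (g : G) (Q : ℝ) (q : ℤ → G) (a b : ℤ), 1 ≤ Q → a ≤ b →
      DQGeoOn σ Q (Icc a b) q → q a = g → q b = g * evalWord σ w →
      ∀ n ∈ Icc a b, ∃ k ≤ w.length, (wordDist σ (q n) (pw σ g w k) : ℝ) ≤ M Q) :
    ∃ p, DGeodesicRay σ p ∧ DMorseOn σ M (Ici 0) p ∧
      ∀ k j : ℕ, j ≤ (W k).length → p j = pw σ 1 (W k) j := by
  have hmono : ∀ j k, j ≤ k → W j <+: W k := by
    intro j k h
    induction k, h using Nat.le_induction with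
    | base => exact List.prefix_refl _
    | succ k hk ih => exact ih.trans (hW k)
  have hp : ∀ k j : ℕ, j ≤ (W k).length → pw σ 1 (W j) j = pw σ 1 (W k) j := by
    intro k j hj
    have : ∀ a b, W a <+: W b → j ≤ (W a).length → (W a).take j = (W b).take j := by
      rintro a b ⟨c, hc⟩ h
      rw [← hc, List.take_append_of_le_length h]
    rw [pw, pw]
    congr 2
    rcases le_total j k with h | h
    · exact this _ _ (hmono _ _ h) (hl j)
    · exact (this _ _ (hmono _ _ h) hj).symm
  have hd : ∀ i j : ℕ, i ≤ j → wordDist σ (pw σ 1 (W i) i) (pw σ 1 (W j) j) = j - i := by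
    intro i j hij
    rw [hp j i (hij.trans (hl j)), ← pw_seg 1 (W j) hij]
    rw [((hgeo j).infix (sub_infix _ i (j-i))).dist hG]
    have := hl j
    simp; omega
  refine ⟨fun n => pw σ 1 (W n.toNat) n.toNat, ⟨by simp, ?_⟩, ?_, ?_⟩
  · intro m hm n hn
    simp only [mem_Ici] at hm hn
    lift m to ℕ using hm
    lift n to ℕ using hn
    simp only [Int.toNat_natCast]
    rcases le_total m n with h | h
    · rw [hd m n h, abs_of_nonneg (by omega)]; omega
    · rw [wd_symm hG, hd n m h, abs_of_nonpos (by omega)]; omega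
  · intro Q hQ s hs t ht hst q a b hab hq h1 h2 n hn
    simp only [mem_Ici] at hs ht
    lift s to ℕ using hs
    lift t to ℕ using ht
    simp only [Int.toNat_natCast] at h1 h2
    have hst' : s ≤ t := by exact_mod_cast hst
    have e1 := hp t s (hst'.trans (hl t))
    obtain ⟨k, hk, h3⟩ := hM t _ (sub_infix _ s (t-s)) (pw σ 1 (W t) s) Q q a b hQ hab hq (by rw [h1, e1])
      (by rw [h2, pw_seg _ _ hst']) n hn
    have hk' : k ≤ t - s := hk.trans (by simp)
    rw [pw_shift _ _ _ _ _ hk', ← hp t (s+k) (by have := hl t; omega)] at h3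
    refine ⟨((s+k : ℕ) : ℤ), ⟨by omega, by omega⟩, ?_⟩
    simp only [Int.toNat_natCast]
    exact h3
  · intro k j hj
    simp only [Int.toNat_natCast]
    exact hp k j hj

def NS (R : Set (Word S)) (ns : ℕ → ℕ) : Prop :=
  (∀ i, i ≤ ns i) ∧ ∀ φ, Subl φ → ∃ i0, ∀ i, i0 ≤ i → ∀ ρ ∈ R, ∀ t : Word S, ns i ≤ ρ.length →
    t <+: ρ → Small R φ t → i * t.length < ρ.length

theorem d1 (hR : SC σ R) (hU : Uni σ R) (hG : Gen σ) (h : CaySigmaCompact σ) : ∃ ns, NS R ns := by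
  obtain ⟨Ms, hMs, hσ⟩ := h
  let ns : ℕ → ℕ := fun i => i * i + 1 + ∑ n ∈ Finset.range (i+1), ⌈36 * Ms n ((2 * (2 * i : ℕ) : ℝ)) + 10⌉₊
  have hns : ∀ i n, n ≤ i → 36 * Ms n ((2 * (2 * i : ℕ) : ℝ)) + 10 < (ns i : ℝ) := by
    intro i n hn
    have h1 := Finset.single_le_sum (f := fun n => ⌈36 * Ms n ((2 * (2 * i : ℕ) : ℝ)) + 10⌉₊)
      (s := Finset.range (i+1)) (fun _ _ => Nat.zero_le _) (Finset.mem_range.2 (Nat.lt_succ_of_le hn))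
    have h2 : ⌈36 * Ms n ((2 * (2 * i : ℕ) : ℝ)) + 10⌉₊ < ns i := by
      simp only [ns] at h1 ⊢; omega
    exact (Nat.le_ceil _).trans_lt (by exact_mod_cast h2)
  refine ⟨ns, fun i => ?_, fun φ hφ => ?_⟩
  · have := Nat.le_mul_self i
    simp only [ns]; omega
  by_contra hcon
  push Not at hcon
  obtain ⟨n0, hn0⟩ := hφ.2 9
  set ψ : ℕ → ℕ := fun n => min (φ n) (n/9) with hψ
  have h9 : ∀ n, 9 * ψ n ≤ n := by intro n; simp only [hψ]; omega
  have hψS : Subl (fun n => 3 * ψ n) := by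
    refine ⟨fun a b hab => ?_, fun K => ?_⟩
    · have := hφ.1 hab
      simp only [hψ]
      have : a / 9 ≤ b / 9 := Nat.div_le_div_right hab
      omega
    · obtain ⟨n1, h1⟩ := hφ.2 (K*3)
      refine ⟨n1, fun n hn => le_trans ?_ (h1 n hn)⟩
      rw [mul_assoc]
      gcongr
      simp [hψ]
  -- step
  have step : ∀ (W : Word S) (i0 : ℕ), Inv R ψ W → ∃ x c : Word S, ∃ i, i0 ≤ i ∧ x ++ c ∈ R ∧
      ns i ≤ (x++c).length ∧ (x++c).length ≤ (2*i) * x.length ∧ 1 ≤ x.length ∧ Inv R ψ (W ++ x) := by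
    intro W i0 hW
    obtain ⟨i, hi, ρ, hρ, t, h1, h2, h3, h4⟩ := hcon (i0 + n0 + 2 * W.length + 2)
    have hni : i * i + 1 ≤ ns i := by simp only [ns]; omega
    have hti : i ≤ t.length := by
      by_contra h
      push Not at h
      have : i * t.length ≤ i * i := by gcongr
      omega
    have ht0 : t ≠ [] := by rintro rfl; simp at hti; omega
    have hb : ∃ b : S × Bool, ∀ y ∈ W.getLast?, b = linv y := by
      rcases hl : W.getLast? with _ | y
      · exact ⟨t.head ht0, by simp⟩
      · exact ⟨linv y, by simp⟩
    obtain ⟨b, hb⟩ := hb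
    obtain ⟨x, hx1, hx2, hx3⟩ := trim t ht0 b
    have hx : ∃ c, x ++ c ∈ R ∧ (x ++ c).length = ρ.length := by
      rcases hx1 with hx1 | hx1
      · exact inf_rel hR hx1 h2 hρ
      · obtain ⟨s, rfl⟩ := h2
        obtain ⟨ρ', h5, h6, h7⟩ := prefix_inv hR hρ
        rw [← h7]
        exact inf_rel hR hx1 h6 h5
    have hxS : Small R φ x := by
      rcases hx1 with hx1 | hx1
      · exact h3.infix hx1
      · exact (h3.inv' hR).infix hx1
    obtain ⟨c, hc1, hc2⟩ := hx
    have hxx : i ≤ 2 * x.length := hti.trans hx2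
    refine ⟨x, c, i, by omega, hc1, by omega, ?_, by omega, hW.step hR ?_ (small_psi hR hn0 hc1 ?_ hxS) (by omega)⟩
    · rw [hc2]; nlinarith
    · rw [Red, List.isChain_append]
      refine ⟨hW.1, (hR.red _ hc1).infix (List.prefix_append _ _).isInfix, ?_⟩
      intro a ha y hy
      rw [← hb a ha]
      exact hx3 y hy
    · rw [hc2]
      nlinarith
  choose X C I hI using step
  let W : ℕ → {W : Word S // Inv R ψ W} := fun k => Nat.rec ⟨[], Inv.nil ψ⟩
    (fun k W => ⟨W.1 ++ X W.1 k W.2, (hI W.1 k W.2).2.2.2.2.2⟩) k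
  have hWs : ∀ k, (W (k+1)).1 = (W k).1 ++ X (W k).1 k (W k).2 := fun k => rfl
  obtain ⟨M, hM, hM'⟩ := w2 hR hU hG hψS
  have hov : ∀ k, Ov R (W k).1 := by
    intro k t ρ h1 h2 h3
    have h4 := (W k).2.2.1 t ρ h1 h2 h3
    have := h9 ρ.length
    simp only at h4; omega
  obtain ⟨p, hp1, hp2, hp3⟩ := ray hG (W := fun k => (W k).1) (fun k => ⟨_, (hWs k).symm⟩)
    (fun k => by
      induction k with
      | zero => exact Nat.zero_le _
      | succ k ih =>
        have := (hI (W k).1 k (W k).2).2.2.2.2.1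
        simp only [hWs, List.length_append]; omega)
    (fun k => (W k).2.geo hR hU h9)
    (fun k w hw => hM' w ((W k).2.1.infix hw) ((hov k).infix hw) ((W k).2.2.1.infix hw))
  obtain ⟨n, hn⟩ := hσ p hp1 M hM hp2
  obtain ⟨h1, h2, h3, h4, h5, -⟩ := hI (W n).1 n (W n).2
  have hWn := hWs n
  set x := X (W n).1 n (W n).2
  set c := C (W n).1 n (W n).2
  set i := I (W n).1 n (W n).2
  set l := (W n).1.length with hl
  have hl1 : (W (n+1)).1.length = l + x.length := by rw [hWn]; simp [hl]
  set g := pw σ 1 (W n).1 l with hg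
  have hpg : ∀ j ≤ x.length, p ((l + j : ℕ) : ℤ) = pw σ g x j := by
    intro j hj
    rw [hp3 (n+1) (l+j) (by simp only [hl1]; omega)]
    simp only [hWn]
    rw [pw, List.take_length_add_append, ev_append, ← mul_assoc, hg, pw_end _ _ le_rfl, pw]
  have hxc : x.length ≤ c.length := by
    have h6 := (((W (n+1)).2.geo hR hU h9).ov hR) x _ (by rw [hWn]; exact List.infix_append_right) h2 (List.prefix_append _ _)
    simp at h6; omega
  have hi1 : 1 ≤ 2 * i := by
    by_contra h
    have : 2 * i = 0 := by omega
    rw [this] at h4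
    simp at h4 h5
    simp [h4.1] at h5
  have hq := around_qg hR hU hG h2 g hi1 h4
  have hev : evalWord σ (wordInv c) = evalWord σ x := by
    have := hR.ev _ h2
    rw [ev_append] at this
    rw [ev_inv]; exact (eq_inv_of_mul_eq_one_left this).symm
  have hQ : (1:ℝ) ≤ 2 * (2 * i : ℕ) := by
    have : (1:ℝ) ≤ (2 * i : ℕ) := by exact_mod_cast hi1
    linarith
  obtain ⟨m, hm, hd⟩ := hn _ hQ ((l : ℕ) : ℤ) (by simp) ((l + x.length : ℕ) : ℤ) (by simp; omega) (by omega)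
    _ 0 c.length (by omega) hq
    (by
      have := hpg 0 (by omega)
      simp only [add_zero, pw_zero] at this
      rw [this]; simp [pathOfWord])
    (by
      rw [hpg _ le_rfl, pw_end _ _ le_rfl, ← hev]
      show pw σ g (wordInv c) ((c.length : ℤ)).toNat = _
      rw [Int.toNat_natCast, pw_end _ _ (by simp)])
    ((c.length / 2 : ℕ) : ℤ) ⟨by omega, by omega⟩
  obtain ⟨hm1, hm2⟩ := hm
  obtain ⟨j, hj⟩ := Int.eq_ofNat_of_zero_le (show 0 ≤ m - l by omega)
  have hj' : m = ((l + j : ℕ) : ℤ) := by omega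
  rw [hj', hpg j (by omega)] at hd
  have h6 := around_mid hR hU hG h2 g hxc j (by omega)
  have h7 := hns i n h1
  have h8 : (5:ℝ) * ((x ++ c).length : ℝ) ≤ 36 * wordDist σ (pw σ g (wordInv c) (c.length / 2)) (pw σ g x j) + 10 := by
    exact_mod_cast h6
  have h9 : (ns i : ℝ) ≤ ((x ++ c).length : ℝ) := by exact_mod_cast h3
  have h10 : (wordDist σ (pw σ g (wordInv c) (c.length / 2)) (pw σ g x j) : ℝ) ≤ Ms n (2 * (2 * i : ℕ)) := hd
  have h11 : (0:ℝ) ≤ ((x ++ c).length : ℝ) := Nat.cast_nonneg _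
  linarith

end PartD
end MorseLTG

namespace MorseLTG
universe u
section PartD2
variable {S : Type u} {G : Type u} [Group G] {σ : S → G} {R : Set (Word S)}

theorem d2 {ns : ℕ → ℕ} (hns : NS R ns) {φ0 : ℕ → ℕ} (h0 : Subl φ0) :
    ∃ φ, Subl φ ∧ ∃ N, ∀ w : Word S, (∀ t ρ, t <:+: w → ρ ∈ R → t <+: ρ → ρ.length ≤ N →
      2 * t.length ≤ ρ.length ∧ t.length ≤ φ0 ρ.length) → Ov R w ∧ Small R φ w := by
  classical
  let g : ℕ → ℕ := fun m => Nat.findGreatest (fun i => ns i ≤ m) m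
  have hg1 : ∀ i m, ns i ≤ m → i ≤ g m := fun i m h =>
    Nat.le_findGreatest (P := fun i => ns i ≤ m) ((hns.1 i).trans h) h
  have hg2 : ∀ m, g m ≠ 0 → ns (g m) ≤ m := fun m h =>
    Nat.findGreatest_of_ne_zero (P := fun i => ns i ≤ m) (n := m) rfl h
  let φ : ℕ → ℕ := fun n => φ0 n + (Finset.range (n+1)).sup (fun m => m / g m + 1)
  have hle : ∀ n, n / g n + 1 ≤ φ n := by
    intro n
    have := Finset.le_sup (f := fun m => m / g m + 1) (Finset.mem_range.2 (Nat.lt_succ_self n))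
    simp only [φ]
    exact this.trans (Nat.le_add_left _ _)
  have hφ : Subl φ := by
    refine ⟨fun a b hab => ?_, fun K => ?_⟩
    · simp only [φ]
      have h1 := h0.1 hab
      have h2 : (Finset.range (a+1)).sup (fun m => m / g m + 1) ≤ (Finset.range (b+1)).sup (fun m => m / g m + 1) :=
        Finset.sup_mono (Finset.range_mono (by omega))
      omega
    · obtain ⟨n1, h1⟩ := h0.2 (4*K)
      set m0 := ns (4*K+1) with hm0
      refine ⟨n1 + 4 * (K * (1 + m0)), fun n hn => ?_⟩
      have h2 : (Finset.range (n+1)).sup (fun m => m / g m + 1) ≤ n / (4*K+1) + 1 + m0 := by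
        refine Finset.sup_le (fun m hm => ?_)
        have hm' : m ≤ n := by have := Finset.mem_range.1 hm; omega
        rcases le_total m0 m with h | h
        · have h3 := hg1 (4*K+1) m h
          have : m / g m ≤ n / (4*K+1) := Nat.div_le_div hm' h3 (by omega)
          omega
        · have := Nat.div_le_self m (g m)
          change m / g m + 1 ≤ _
          generalize n / (4*K+1) = z
          generalize m / g m = y at *
          omega
      have h3 := h1 n (by omega)
      have h4 : (4*K+1) * (n/(4*K+1)) ≤ n := Nat.mul_div_le _ _
      have h5 : K * φ n ≤ K * (φ0 n + (n / (4*K+1) + 1 + m0)) := by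
        simp only [φ]; gcongr
      have h6 : 4 * (K * (1 + m0)) ≤ n := by omega
      nlinarith
  obtain ⟨i0, hi0⟩ := hns.2 φ hφ
  obtain ⟨n2, hn2⟩ := hφ.2 2
  refine ⟨φ, hφ, ns (i0+1) + n2, fun w hw => ?_⟩
  have hS : Small R φ w := by
    have : ∀ n, ∀ t ρ, t <:+: w → ρ ∈ R → t <+: ρ → ρ.length = n → t.length ≤ φ n := by
      intro n
      induction n using Nat.strong_induction_on with
      | _ n ih =>
        intro t ρ ht hρ htp hn
        by_contra hc
        push Not at hc
        by_cases hN : ρ.length ≤ ns (i0+1) + n2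
        · have := (hw t ρ ht hρ htp hN).2
          rw [hn] at this
          have : φ0 n ≤ φ n := Nat.le_add_right _ _
          omega
        · have h1 := hg1 (i0+1) ρ.length (by omega)
          have h2 := hi0 (g ρ.length) (by omega) ρ hρ (t.take (φ n)) (hg2 _ (by omega))
            ((List.take_prefix _ _).trans htp) (by
              intro t' ρ' ht' hρ' htp'
              rcases lt_or_ge ρ'.length n with h3 | h3
              · exact ih _ h3 t' ρ' (ht'.trans ((List.take_prefix _ _).isInfix.trans ht)) hρ' htp' rfl
              · have h4 := ht'.length_le
                have h5 := hφ.1 h3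
                have : (t.take (φ n)).length ≤ φ n := by simp
                omega)
          have h3 : (t.take (φ n)).length = φ n := by simp; omega
          rw [h3, hn] at h2
          have h4 := hle n
          rw [hn] at h1
          have h5 : n < g n * (n / g n + 1) := Nat.lt_mul_div_succ n (by omega)
          have : g n * (n / g n + 1) ≤ g n * φ n := by gcongr
          omega
    intro t ρ h1 h2 h3
    exact this _ t ρ h1 h2 h3 rfl
  refine ⟨fun t ρ h1 h2 h3 => ?_, hS⟩
  by_cases hN : ρ.length ≤ ns (i0+1) + n2
  · exact (hw t ρ h1 h2 h3 hN).1
  · have := hS t ρ h1 h2 h3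
    have := hn2 ρ.length (by omega)
    omega

theorem phi_ex (T : Set (Word S)) (hT : ∀ K, ∃ n0, ∀ t ∈ T, ∀ ρ ∈ R, t <+: ρ → n0 ≤ ρ.length → K * t.length ≤ ρ.length) :
    ∃ φ, Subl φ ∧ ∀ t ∈ T, ∀ ρ ∈ R, t <+: ρ → t.length ≤ φ ρ.length := by
  classical
  let P : ℕ → ℕ → Prop := fun n l => ∃ t ∈ T, ∃ ρ ∈ R, t <+: ρ ∧ ρ.length ≤ n ∧ t.length = l
  refine ⟨fun n => Nat.findGreatest (P n) n, ⟨?_, ?_⟩, ?_⟩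
  · intro a b hab
    refine Nat.findGreatest_mono ?_ hab
    rintro l ⟨t, h1, ρ, h2, h3, h4, h5⟩
    exact ⟨t, h1, ρ, h2, h3, h4.trans hab, h5⟩
  · intro K
    obtain ⟨n0, hn0⟩ := hT K
    refine ⟨K * n0, fun n hn => ?_⟩
    by_cases h : Nat.findGreatest (P n) n = 0
    · simp [h]
    · obtain ⟨t, h1, ρ, h2, h3, h4, h5⟩ := Nat.findGreatest_of_ne_zero (P := P n) rfl h
      simp only
      rw [← h5]
      rcases le_total n0 ρ.length with h6 | h6
      · exact (hn0 t h1 ρ h2 h3 h6).trans h4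
      · have := h3.length_le
        exact le_trans (by gcongr; omega) hn
  · intro t h1 ρ h2 h3
    exact Nat.le_findGreatest (P := P ρ.length) h3.length_le ⟨t, h1, ρ, h2, h3, le_rfl, rfl⟩

/-- word quasigeodesics -/
def WQ (σ : S → G) (Q : ℕ) (w : Word S) : Prop :=
  ∀ i j, i ≤ j → j ≤ w.length → j - i ≤ Q * (wordDist σ (pw σ 1 w i) (pw σ 1 w j) + Q)

theorem pw_left (g h : G) (w : Word S) (k : ℕ) : pw σ (g * h) w k = g * pw σ h w k := by
  simp [pw, mul_assoc]

theorem pw_dist1 (g : G) (w : Word S) (i j : ℕ) :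
    wordDist σ (pw σ g w i) (pw σ g w j) = wordDist σ (pw σ 1 w i) (pw σ 1 w j) := by
  have := pw_left (σ := σ) g 1 w
  rw [mul_one] at this
  rw [this, this, wd_left]

theorem WQ.dq (hG : Gen σ) {Q : ℕ} (hQ : 1 ≤ Q) {w : Word S} (h : WQ σ Q w) (g : G) :
    DQGeoOn σ Q (Icc 0 (w.length : ℤ)) (pathOfWord σ g w) := by
  refine dqgeo_of hG (pow_path _ _ _) ?_
  rintro m ⟨hm0, hm⟩ n ⟨hn0, hn⟩ hmn
  lift m to ℕ using hm0
  lift n to ℕ using hn0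
  have hmn' : m ≤ n := by exact_mod_cast hmn
  have h1 := h m n hmn' (by omega)
  have h2 := pw_dist_le (σ := σ) 1 w hmn'
  show _ ≤ ((wordDist σ (pw σ g w ((m:ℤ)).toNat) (pw σ g w ((n:ℤ)).toNat) : ℕ) : ℝ) ∧
    ((wordDist σ (pw σ g w ((m:ℤ)).toNat) (pw σ g w ((n:ℤ)).toNat) : ℕ) : ℝ) ≤ _
  rw [Int.toNat_natCast, Int.toNat_natCast, pw_dist1]
  set d := wordDist σ (pw σ 1 w m) (pw σ 1 w n)
  have hQ' : (1:ℝ) ≤ Q := by exact_mod_cast hQ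
  have h3 : ((n:ℝ) - m) ≤ Q * (d + Q) := by
    rw [← Nat.cast_sub hmn']; exact_mod_cast h1
  have h4 : (d:ℝ) ≤ n - m := by
    rw [← Nat.cast_sub hmn']; exact_mod_cast h2
  have h5 : (0:ℝ) ≤ d := by positivity
  simp only [Int.cast_natCast]
  constructor
  · rw [sub_le_iff_le_add, div_le_iff₀ (by linarith)]
    linarith
  · nlinarith

theorem WQ.of_dq {Q : ℕ} (hQ : 1 ≤ Q) {w : Word S} {g : G}
    (h : DQGeoOn σ Q (Icc 0 (w.length : ℤ)) (pathOfWord σ g w)) : WQ σ Q w := by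
  intro i j hij hj
  have h1 := (h.2 (i:ℤ) ⟨by omega, by omega⟩ (j:ℤ) ⟨by omega, by omega⟩).1
  change _ ≤ ((wordDist σ (pw σ g w ((i:ℤ)).toNat) (pw σ g w ((j:ℤ)).toNat) : ℕ) : ℝ) at h1
  rw [Int.toNat_natCast, Int.toNat_natCast, pw_dist1] at h1
  have hij' : (i:ℝ) ≤ j := by exact_mod_cast hij
  have hQ' : (1:ℝ) ≤ Q := by exact_mod_cast hQ
  simp only [Int.cast_natCast] at h1
  rw [sub_le_iff_le_add, div_le_iff₀ (by linarith), abs_of_nonneg (by linarith), ← Nat.cast_sub hij] at h1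
  rw [mul_comm]
  exact_mod_cast h1

theorem WQ.geo (hG : Gen σ) {w : Word S} (h : Geo σ w) : WQ σ 1 w := by
  intro i j hij hj
  rw [← pw_seg 1 w hij, (h.infix (sub_infix _ i (j-i))).dist hG]
  simp; omega

theorem pw_inv (g : G) (w : Word S) (k : ℕ) (hk : k ≤ w.length) :
    pw σ (g * evalWord σ w) (wordInv w) k = pw σ g w (w.length - k) := by
  have := take_inv w (w.length - k)
  rw [Nat.sub_sub_self hk] at this
  rw [pw, this, ev_inv, pw]
  have e : evalWord σ w = evalWord σ (w.take (w.length - k)) * evalWord σ (w.drop (w.length - k)) := by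
    rw [← ev_append, List.take_append_drop]
  rw [e]; group

theorem WQ.inv (hG : Gen σ) {Q : ℕ} {w : Word S} (h : WQ σ Q w) : WQ σ Q (wordInv w) := by
  intro i j hij hj
  simp at hj
  rw [← pw_dist1 (1 * evalWord σ w), pw_inv _ _ _ hj, pw_inv _ _ _ (hij.trans hj), wd_symm hG]
  have := h (w.length - j) (w.length - i) (by omega) (by omega)
  omega

theorem pw_app1 (g : G) (u v : Word S) (k : ℕ) (hk : k ≤ u.length) : pw σ g (u ++ v) k = pw σ g u k := by
  rw [pw, List.take_append_of_le_length hk, pw]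

theorem pw_app2 (g : G) (u v : Word S) (k : ℕ) : pw σ g (u ++ v) (u.length + k) = pw σ (g * evalWord σ u) v k := by
  rw [pw, List.take_length_add_append, ev_append, pw, mul_assoc]

/-- each point on `u ++ w ++ v` is near `w` -/
theorem pw_ext (hG : Gen σ) (g : G) {u w v : Word S} {D : ℕ} (hu : u.length ≤ D) (hv : v.length ≤ D) (k : ℕ)
    (hk : k ≤ (u ++ w ++ v).length) :
    wordDist σ (pw σ g (u ++ w ++ v) k) (pw σ (g * evalWord σ u) w (min (k - u.length) w.length)) ≤ D := by
  rcases le_total k u.length with h | h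
  · rw [Nat.sub_eq_zero_of_le h, Nat.zero_min, pw_zero, List.append_assoc, pw_app1 _ _ _ _ h,
      ← pw_end (k := u.length) g u le_rfl]
    have := pw_dist_le (σ := σ) g u h
    omega
  · obtain ⟨j, rfl⟩ := Nat.exists_eq_add_of_le h
    rw [List.append_assoc, pw_app2, Nat.add_sub_cancel_left]
    rcases le_total j w.length with h' | h'
    · rw [pw_app1 _ _ _ _ h', min_eq_left h', wd_self]; omega
    · obtain ⟨i, rfl⟩ := Nat.exists_eq_add_of_le h'
      rw [pw_app2, min_eq_right h', pw_end _ w le_rfl, wd_symm hG]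
      have := pw_dist_le (σ := σ) (g * evalWord σ u * evalWord σ w) v (Nat.zero_le i)
      rw [pw_zero] at this
      simp at hk
      omega

theorem WQ.ext (hG : Gen σ) {Q D : ℕ} (hQ : 1 ≤ Q) {u w v : Word S} (h : WQ σ Q w) (hu : u.length ≤ D) (hv : v.length ≤ D) :
    WQ σ (Q + 4 * D) (u ++ w ++ v) := by
  intro i j hij hj
  have hj' : j ≤ u.length + w.length + v.length := by simpa [add_assoc] using hj
  have h1 := pw_ext (σ := σ) hG 1 (w := w) hu hv i (hij.trans hj)
  have h2 := pw_ext (σ := σ) hG 1 (w := w) hu hv j hj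
  have h3 := h (min (i - u.length) w.length) (min (j - u.length) w.length) (by omega) (by omega)
  rw [← pw_dist1 (1 * evalWord σ u)] at h3
  have h4 := wd_tri (σ := σ) hG (pw σ (1 * evalWord σ u) w (min (i - u.length) w.length)) (pw σ 1 (u ++ w ++ v) i)
    (pw σ (1 * evalWord σ u) w (min (j - u.length) w.length))
  have h5 := wd_tri (σ := σ) hG (pw σ 1 (u ++ w ++ v) i) (pw σ 1 (u ++ w ++ v) j)
    (pw σ (1 * evalWord σ u) w (min (j - u.length) w.length))
  rw [wd_symm hG] at h1
  set d := wordDist σ (pw σ 1 (u ++ w ++ v) i) (pw σ 1 (u ++ w ++ v) j)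
  set d' := wordDist σ (pw σ (1 * evalWord σ u) w (min (i - u.length) w.length)) (pw σ (1 * evalWord σ u) w (min (j - u.length) w.length))
  have h6 : d' ≤ d + 2 * D := by omega
  have h7 : j - i ≤ min (j - u.length) w.length - min (i - u.length) w.length + 2 * D := by omega
  have h8 : Q * (d' + Q) ≤ Q * (d + 2 * D + Q) := by gcongr
  nlinarith [Nat.zero_le (D * d), Nat.zero_le (D * Q), Nat.zero_le (D*D), Nat.zero_le (Q*D), Nat.mul_le_mul_right D hQ]

end PartD2
end MorseLTG

namespace MorseLTG
universe u
section PartE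
variable {S : Type u} {G : Type u} [Group G] {σ : S → G} {R : Set (Word S)}

def MQ (σ : S → G) (Q : ℝ) (M : ℝ → ℝ) (a b : ℤ) (p : ℤ → G) : Prop :=
  DQGeoOn σ Q (Icc a b) p ∧ DMorseOn σ M (Icc a b) p

variable {Q : ℝ} {M : ℝ → ℝ} {a b : ℤ} {p : ℤ → G}

theorem mw1 (hG : Gen σ) (h : MQ σ Q M a b p) {K : ℕ} (hK : 1 ≤ K)
    {m1 m2 : ℤ} (h1 : m1 ∈ Icc a b) (h2 : m2 ∈ Icc a b) (h12 : m1 ≤ m2) {u : Word S} (hu : WQ σ K u)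
    (he : p m1 * evalWord σ u = p m2) (k : ℕ) (hk : k ≤ u.length) :
    ∃ m ∈ Icc m1 m2, (wordDist σ (pw σ (p m1) u k) (p m) : ℝ) ≤ M K := by
  have := h.2 K (by exact_mod_cast hK) m1 h1 m2 h2 h12 _ 0 u.length (by omega) (hu.dq hG hK (p m1))
    (by simp [pathOfWord]) (by
      show pw σ (p m1) u ((u.length:ℤ)).toNat = _
      rw [Int.toNat_natCast, pw_end _ _ le_rfl, he]) (k:ℤ) ⟨by omega, by omega⟩
  exact this

theorem mw2 (hG : Gen σ) (hQ : 1 ≤ Q) (hM : IsMorseGauge M) (h : MQ σ Q M a b p) {K : ℕ} (hK : 1 ≤ K)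
    {m1 m2 : ℤ} (h1 : m1 ∈ Icc a b) (h2 : m2 ∈ Icc a b) (h12 : m1 ≤ m2) {u : Word S} (hu : WQ σ K u)
    (he : p m1 * evalWord σ u = p m2) (v : ℤ) (hv : v ∈ Icc m1 m2) :
    ∃ k ≤ u.length, (wordDist σ (p v) (pw σ (p m1) u k) : ℝ) ≤ cc (M K) Q := by
  refine conn hG hQ (hM.2.2 K (by exact_mod_cast hK)) h12 (h.1.sub (Icc_subset_Icc h1.1 h2.2)) (P := pw σ (p m1) u)
    (m := u.length) (by simp) (by rw [pw_end _ _ le_rfl, he]) (fun j _ => by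
      have := pw_dist_le (σ := σ) (p m1) u (Nat.le_add_right j 1); omega) ?_ v hv
  intro j hj
  exact mw1 hG h hK h1 h2 h12 hu he j hj

theorem fellow0 (hG : Gen σ) (hQ : 1 ≤ Q) (hM : IsMorseGauge M) (h : MQ σ Q M a b p) {K K' : ℕ} (hK : 1 ≤ K) (hK' : 1 ≤ K')
    {m1 m2 : ℤ} (h1 : m1 ∈ Icc a b) (h2 : m2 ∈ Icc a b) (h12 : m1 ≤ m2) {u v : Word S} (hu : WQ σ K u) (hv : WQ σ K' v)
    (he : p m1 * evalWord σ u = p m2) (he' : p m1 * evalWord σ v = p m2) (k : ℕ) (hk : k ≤ v.length) :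
    ∃ j ≤ u.length, (wordDist σ (pw σ (p m1) v k) (pw σ (p m1) u j) : ℝ) ≤ M K' + cc (M K) Q := by
  obtain ⟨m, hm, h3⟩ := mw1 hG h hK' h1 h2 h12 hv he' k hk
  obtain ⟨j, hj, h4⟩ := mw2 hG hQ hM h hK h1 h2 h12 hu he m hm
  refine ⟨j, hj, ?_⟩
  have : (wordDist σ (pw σ (p m1) v k) (pw σ (p m1) u j) : ℝ) ≤ wordDist σ (pw σ (p m1) v k) (p m)
      + wordDist σ (p m) (pw σ (p m1) u j) := by exact_mod_cast wd_tri hG _ _ _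
  linarith

theorem fellow (hG : Gen σ) (hQ : 1 ≤ Q) (hM : IsMorseGauge M) (h : MQ σ Q M a b p) {K K' : ℕ} (hK : 1 ≤ K) (hK' : 1 ≤ K')
    {m1 m2 : ℤ} (h1 : m1 ∈ Icc a b) (h2 : m2 ∈ Icc a b) {u v : Word S} (hu : WQ σ K u) (hv : WQ σ K' v)
    (he : p m1 * evalWord σ u = p m2) (he' : p m1 * evalWord σ v = p m2) (k : ℕ) (hk : k ≤ v.length) :
    ∃ j ≤ u.length, (wordDist σ (pw σ (p m1) v k) (pw σ (p m1) u j) : ℝ) ≤ M K' + cc (M K) Q := by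
  rcases le_total m1 m2 with h12 | h12
  · exact fellow0 hG hQ hM h hK hK' h1 h2 h12 hu hv he he' k hk
  · obtain ⟨j, hj, h3⟩ := fellow0 hG hQ hM h hK hK' h2 h1 h12 (hu.inv hG) (hv.inv hG)
      (by rw [ev_inv, ← he]; group) (by rw [ev_inv, ← he']; group) (v.length - k) (by simp)
    simp at hj
    have e1 := pw_inv (σ := σ) (p m1) v (v.length - k) (by omega)
    have e2 := pw_inv (σ := σ) (p m1) u j hj
    rw [he', Nat.sub_sub_self hk] at e1
    rw [he] at e2
    rw [e1, e2] at h3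
    exact ⟨u.length - j, by omega, h3⟩

def TT (σ : S → G) (Q : ℝ) (M : ℝ → ℝ) (D : ℕ) : Set (Word S) :=
  {t | Geo σ t ∧ ∃ (a b : ℤ) (p : ℤ → G) (m1 m2 : ℤ) (g : G), MQ σ Q M a b p ∧ m1 ∈ Icc a b ∧ m2 ∈ Icc a b ∧
    wordDist σ (p m1) g ≤ D ∧ wordDist σ (p m2) (g * evalWord σ t) ≤ D}

theorem tbound (hR : SC σ R) (hU : Uni σ R) (hG : Gen σ) (hQ : 1 ≤ Q) (hM : IsMorseGauge M) (D K : ℕ) :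
    ∃ n0, ∀ t ∈ TT σ Q M D, ∀ ρ ∈ R, t <+: ρ → n0 ≤ ρ.length → K * t.length ≤ ρ.length := by
  set E : ℝ := M ((2 * K + 4 * D : ℕ) : ℝ) + cc (M ((1 + 4 * D : ℕ):ℝ)) Q with hE
  refine ⟨⌈36 * (E + D) + 10⌉₊ + 1, ?_⟩
  rintro t ⟨ht, a, b, p, m1, m2, g, hp, hm1, hm2, hd1, hd2⟩ ρ hρ ⟨c, rfl⟩ hn
  by_contra hcon
  push Not at hcon
  have hK : 1 ≤ K := by
    by_contra h
    have : K = 0 := by omega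
    simp [this] at hcon
  obtain ⟨e1, h1, h1'⟩ := wd_ex hG (p m1) g
  obtain ⟨e2, h2, h2'⟩ := wd_ex hG (g * evalWord σ t) (p m2)
  rw [wd_symm hG] at h2
  have hev : evalWord σ (wordInv c) = evalWord σ t := by
    have := hR.ev _ hρ
    rw [ev_append] at this
    rw [ev_inv]; exact (eq_inv_of_mul_eq_one_left this).symm
  have hu := (WQ.geo hG ht).ext hG le_rfl (h1.trans_le hd1) (h2.trans_le hd2)
  have hv0 : WQ σ (2*K) (wordInv c) := by
    refine WQ.of_dq (g := g) (by omega) ?_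
    have := around_qg hR hU hG hρ g hK hcon.le
    push_cast
    simpa using this
  have hv := hv0.ext hG (by omega) (h1.trans_le hd1) (h2.trans_le hd2)
  obtain ⟨j, hj, h3⟩ := fellow hG hQ hM hp (by omega) (by omega) hm1 hm2 hu hv
    (by rw [ev_append, ev_append, ← mul_assoc, ← mul_assoc, h1', h2'])
    (by rw [ev_append, ev_append, hev, ← mul_assoc, ← mul_assoc, h1', h2'])
    (e1.length + c.length / 2) (by simp; omega)
  rw [List.append_assoc e1, pw_app2, pw_app1 _ _ _ _ (by simp; omega), h1'] at h3
  have h4 := pw_ext hG (p m1) (w := t) (h1.trans_le hd1) (h2.trans_le hd2) j hj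
  rw [h1'] at h4
  have h5 := wd_tri hG (pw σ g (wordInv c) (c.length / 2)) (pw σ (p m1) (e1 ++ t ++ e2) j)
    (pw σ g t (min (j - e1.length) t.length))
  have h6 := around_mid hR hU hG hρ g (by
    have := ht.ov hR t _ (List.infix_refl _) hρ (List.prefix_append _ _)
    simp at this; omega) (min (j - e1.length) t.length) (by omega)
  have h7 : (wordDist σ (pw σ g (wordInv c) (c.length / 2)) (pw σ g t (min (j - e1.length) t.length)) : ℝ)
      ≤ wordDist σ (pw σ g (wordInv c) (c.length / 2)) (pw σ (p m1) (e1 ++ t ++ e2) j) + D := by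
    exact_mod_cast (by omega)
  have h8 : (5:ℝ) * ((t ++ c).length : ℝ) ≤ 36 * wordDist σ (pw σ g (wordInv c) (c.length / 2)) (pw σ g t (min (j - e1.length) t.length)) + 10 := by
    exact_mod_cast h6
  have h9 : (36 * (E + D) + 10 : ℝ) < ((t ++ c).length : ℝ) :=
    (Nat.le_ceil _).trans_lt (by exact_mod_cast hn)
  have h10 : (0:ℝ) ≤ ((t ++ c).length : ℝ) := Nat.cast_nonneg _
  linarith

theorem near (hG : Gen σ) (h : MQ σ Q M a b p) (hab : a ≤ b) {D : ℕ} {x : G} {α : Word S} (hα : Geo σ α)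
    (hx : wordDist σ (p a) x ≤ D) (hy : wordDist σ (p b) (x * evalWord σ α) ≤ D) (k : ℕ) (hk : k ≤ α.length) :
    ∃ m ∈ Icc a b, (wordDist σ (p m) (pw σ x α k) : ℝ) ≤ M ((1 + 4 * D : ℕ) : ℝ) := by
  obtain ⟨e1, h1, h1'⟩ := wd_ex hG (p a) x
  obtain ⟨e2, h2, h2'⟩ := wd_ex hG (x * evalWord σ α) (p b)
  rw [wd_symm hG] at h2
  have hu := (WQ.geo hG hα).ext hG le_rfl (h1.trans_le hx) (h2.trans_le hy)
  obtain ⟨m, hm, h3⟩ := mw1 hG h (by omega) ⟨le_rfl, hab⟩ ⟨hab, le_rfl⟩ hab hu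
    (by rw [ev_append, ev_append, ← mul_assoc, ← mul_assoc, h1', h2']) (e1.length + k) (by simp; omega)
  rw [List.append_assoc e1, pw_app2, pw_app1 _ _ _ _ hk, h1', wd_symm hG] at h3
  exact ⟨m, hm, h3⟩

theorem Geo.pwd (hG : Gen σ) {w : Word S} (h : Geo σ w) (g : G) {i j : ℕ} (hij : i ≤ j) (hj : j ≤ w.length) :
    wordDist σ (pw σ g w i) (pw σ g w j) = j - i := by
  rw [← pw_seg g w hij, (h.infix (sub_infix _ i (j-i))).dist hG]
  simp; omega

theorem midl (hG : Gen σ) (hQ : 1 ≤ Q) (hM : IsMorseGauge M) (h : MQ σ Q M a b p) {D : ℕ} (hD : cc (M 3) Q ≤ D)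
    {m : ℤ} (hm : m ∈ Icc a b) {x : G} {α : Word S} (hα : Geo σ α)
    (hx : wordDist σ (p a) x ≤ D) (hy : wordDist σ (p b) (x * evalWord σ α) ≤ D)
    (hm1 : 2 * D < wordDist σ (p a) (p m)) (hm2 : 2 * D < wordDist σ (p m) (p b))
    (hP : 6 * D < wordDist σ (p a) (p b)) :
    ∃ k ≤ α.length, wordDist σ (p m) (pw σ x α k) ≤ D := by
  have hab : a ≤ b := hm.1.trans hm.2
  obtain ⟨i, hi, hi'⟩ := Finset.exists_min_image (Finset.range (α.length+1)) (fun k => wordDist σ (p a) (pw σ x α k)) ⟨0, by simp⟩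
  obtain ⟨j, hj, hj'⟩ := Finset.exists_min_image (Finset.range (α.length+1)) (fun k => wordDist σ (p b) (pw σ x α k)) ⟨0, by simp⟩
  simp only [Finset.mem_range, Nat.lt_succ_iff] at hi hj hi' hj'
  have T := wd_tri (σ := σ) hG
  have Sy := wd_symm (σ := σ) hG
  have hi0 := hi' 0 (by omega)
  rw [pw_zero] at hi0
  have hj0 := hj' α.length le_rfl
  rw [pw_end _ _ le_rfl] at hj0
  have dα := fun {i j : ℕ} (hij : i ≤ j) (hj : j ≤ α.length) => hα.pwd hG x hij hj
  have hi2 : i ≤ 2 * D := by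
    have h1 := dα (Nat.zero_le i) hi
    rw [pw_zero] at h1
    have h2 := T x (p a) (pw σ x α i)
    rw [Sy x (p a)] at h2
    omega
  have hj2 : α.length ≤ j + 2 * D := by
    have h1 := dα hj le_rfl
    rw [pw_end _ _ le_rfl] at h1
    have h2 := T (pw σ x α j) (p b) (x * evalWord σ α)
    rw [Sy (pw σ x α j) (p b)] at h2
    omega
  have hαl : wordDist σ (p a) (p b) ≤ α.length + 2 * D := by
    have h1 := hα.dist hG x
    have h2 := T (p a) x (p b)
    have h3 := T x (x * evalWord σ α) (p b)
    rw [Sy (x * evalWord σ α) (p b)] at h3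
    omega
  have hij : i ≤ j := by omega
  obtain ⟨β1, h1, h1'⟩ := wd_ex hG (p a) (pw σ x α i)
  obtain ⟨β2, h2, h2'⟩ := wd_ex hG (pw σ x α j) (p b)
  have gβ1 := geo_of hG h1 h1'
  have gβ2 := geo_of hG h2 h2'
  rw [Sy] at h2
  set γ := (α.drop i).take (j-i) with hγ
  have hγl : γ.length = j - i := by simp [hγ]; omega
  have hγe : pw σ x α i * evalWord σ γ = pw σ x α j := pw_seg x α hij
  have P1 : ∀ r, r ≤ β1.length → pw σ (p a) (β1 ++ γ ++ β2) r = pw σ (p a) β1 r := by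
    intro r hr; rw [List.append_assoc, pw_app1 _ _ _ _ hr]
  have P2 : ∀ r, r ≤ γ.length → pw σ (p a) (β1 ++ γ ++ β2) (β1.length + r) = pw σ x α (i + r) := by
    intro r hr
    rw [List.append_assoc, pw_app2, pw_app1 _ _ _ _ hr, h1', hγ, pw_shift _ _ _ _ _ (by omega)]
  have P3 : ∀ r, pw σ (p a) (β1 ++ γ ++ β2) (β1.length + γ.length + r) = pw σ (pw σ x α j) β2 r := by
    intro r
    rw [List.append_assoc, add_assoc, pw_app2, pw_app2, h1', hγe]
  have dβ1 : ∀ r, r ≤ β1.length → wordDist σ (p a) (pw σ (p a) β1 r) = r ∧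
      wordDist σ (pw σ (p a) β1 r) (pw σ x α i) = β1.length - r := by
    intro r hr
    have k1 := gβ1.pwd hG (p a) (Nat.zero_le r) hr
    have k2 := gβ1.pwd hG (p a) hr le_rfl
    rw [pw_zero] at k1
    rw [pw_end _ _ le_rfl, h1'] at k2
    exact ⟨by omega, k2⟩
  have dβ2 : ∀ r, r ≤ β2.length → wordDist σ (pw σ x α j) (pw σ (pw σ x α j) β2 r) = r ∧
      wordDist σ (p b) (pw σ (pw σ x α j) β2 r) = β2.length - r := by
    intro r hr
    have k1 := gβ2.pwd hG (pw σ x α j) (Nat.zero_le r) hr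
    have k2 := gβ2.pwd hG (pw σ x α j) hr le_rfl
    rw [pw_zero] at k1
    rw [pw_end _ _ le_rfl, h2', Sy] at k2
    exact ⟨by omega, k2⟩
  have hu : WQ σ 3 (β1 ++ γ ++ β2) := by
    intro r s hrs hs
    have hs' : s ≤ β1.length + γ.length + β2.length := by simpa [add_assoc] using hs
    rw [← pw_dist1 (p a)]
    suffices s - r ≤ 3 * wordDist σ (pw σ (p a) (β1 ++ γ ++ β2) r) (pw σ (p a) (β1 ++ γ ++ β2) s) by omega
    rcases le_total s β1.length with c1 | c1
    · rw [P1 r (by omega), P1 s c1, gβ1.pwd hG _ hrs c1]; omega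
    rcases le_total r β1.length with c2 | c2
    · obtain ⟨k1, k2⟩ := dβ1 r c2
      rw [P1 r c2]
      rcases le_total s (β1.length + γ.length) with c3 | c3
      · obtain ⟨s', rfl⟩ := Nat.exists_eq_add_of_le c1
        rw [P2 s' (by omega)]
        have k3 := hi' (i + s') (by omega)
        have k4 := T (p a) (pw σ (p a) β1 r) (pw σ x α (i+s'))
        have k5 := T (pw σ x α i) (pw σ (p a) β1 r) (pw σ x α (i+s'))
        rw [Sy (pw σ x α i) (pw σ (p a) β1 r), dα (Nat.le_add_right i s') (by omega)] at k5
        omega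
      · obtain ⟨s', rfl⟩ := Nat.exists_eq_add_of_le c3
        rw [P3 s']
        obtain ⟨k3, k4⟩ := dβ2 s' (by omega)
        have k5 := T (p a) (pw σ (p a) β1 r) (p b)
        have k6 := T (pw σ (p a) β1 r) (pw σ (pw σ x α j) β2 s') (p b)
        have k9 := Sy (pw σ (pw σ x α j) β2 s') (p b)
        have k7 := T (pw σ x α i) (p a) (pw σ x α j)
        have k8 := T (p a) (p b) (pw σ x α j)
        rw [dα hij hj, Sy (pw σ x α i) (p a)] at k7
        omega
    · obtain ⟨r', rfl⟩ := Nat.exists_eq_add_of_le c2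
      rcases le_total s (β1.length + γ.length) with c3 | c3
      · obtain ⟨s', rfl⟩ := Nat.exists_eq_add_of_le c1
        rw [P2 s' (by omega), P2 r' (by omega), dα (by omega) (by omega)]
        omega
      · obtain ⟨s', rfl⟩ := Nat.exists_eq_add_of_le c3
        rw [P3 s']
        obtain ⟨k3, k4⟩ := dβ2 s' (by omega)
        rcases le_total r' γ.length with c4 | c4
        · rw [P2 r' c4]
          have k5 := hj' (i + r') (by omega)
          have k6 := T (p b) (pw σ (pw σ x α j) β2 s') (pw σ x α (i+r'))
          have k7 := T (pw σ x α (i+r')) (pw σ (pw σ x α j) β2 s') (pw σ x α j)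
          rw [dα (by omega) hj] at k7
          have k8 := Sy (pw σ (pw σ x α j) β2 s') (pw σ x α (i+r'))
          have k9 := Sy (pw σ (pw σ x α j) β2 s') (pw σ x α j)
          omega
        · obtain ⟨r2, rfl⟩ := Nat.exists_eq_add_of_le c4
          rw [← add_assoc, P3 r2, gβ2.pwd hG _ (by omega) (by omega)]
          omega
  obtain ⟨k, hk, hkd⟩ := mw2 hG hQ hM h (K := 3) (by omega) ⟨le_rfl, hab⟩ ⟨hab, le_rfl⟩ hab hu
    (by rw [ev_append, ev_append, ← mul_assoc, ← mul_assoc, h1', hγe, h2']) m hm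
  have hkd' : wordDist σ (p m) (pw σ (p a) (β1 ++ γ ++ β2) k) ≤ D := by
    have : (wordDist σ (p m) (pw σ (p a) (β1 ++ γ ++ β2) k) : ℝ) ≤ D := hkd.trans (by simpa using hD)
    exact_mod_cast this
  have hk' : k ≤ β1.length + γ.length + β2.length := by simpa [add_assoc] using hk
  rcases le_total k β1.length with c1 | c1
  · exfalso
    rw [P1 k c1] at hkd'
    have k1 := (dβ1 k c1).1
    have k2 := T (p a) (pw σ (p a) β1 k) (p m)
    rw [Sy (pw σ (p a) β1 k) (p m)] at k2
    omega
  rcases le_total k (β1.length + γ.length) with c2 | c2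
  · obtain ⟨k', rfl⟩ := Nat.exists_eq_add_of_le c1
    rw [P2 k' (by omega)] at hkd'
    exact ⟨i + k', by omega, hkd'⟩
  · exfalso
    obtain ⟨k', rfl⟩ := Nat.exists_eq_add_of_le c2
    rw [P3 k'] at hkd'
    have k1 := (dβ2 k' (by omega)).2
    have k2 := T (p m) (pw σ (pw σ x α j) β2 k') (p b)
    have k3 := Sy (pw σ (pw σ x α j) β2 k') (p b)
    omega

end PartE
end MorseLTG

namespace MorseLTG
universe u
section PartF
variable {S : Type u} {G : Type u} [Group G] {σ : S → G} {R : Set (Word S)}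
variable {Q : ℝ} {M : ℝ → ℝ} {a b : ℤ} {p : ℤ → G}

theorem blockTT (hG : Gen σ) (h : MQ σ Q M a b p) (hab : a ≤ b) {D D1 : ℕ}
    (hD1 : M ((1 + 4 * D : ℕ) : ℝ) ≤ D1) {x : G} {α : Word S} (hα : Geo σ α)
    (hx : wordDist σ (p a) x ≤ D) (hy : wordDist σ (p b) (x * evalWord σ α) ≤ D) {u : Word S} (hu : u <:+: α) :
    Geo σ u ∧ u ∈ TT σ Q M D1 := by
  have gu := hα.infix hu
  refine ⟨gu, ?_⟩
  obtain ⟨l, r, rfl⟩ := hu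
  obtain ⟨m1, hm1, k1⟩ := near hG h hab hα hx hy l.length (by simp)
  obtain ⟨m2, hm2, k2⟩ := near hG h hab hα hx hy (l.length + u.length) (by simp)
  refine ⟨gu, a, b, p, m1, m2, pw σ x (l ++ u ++ r) l.length, h, hm1, hm2, ?_, ?_⟩
  · exact_mod_cast k1.trans hD1
  · have e : pw σ x (l ++ u ++ r) l.length * evalWord σ u = pw σ x (l ++ u ++ r) (l.length + u.length) := by
      rw [List.append_assoc, pw_app2, pw_app1 _ _ _ _ le_rfl, pw_end _ _ le_rfl]
      congr 1
      simp
    rw [e]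
    exact_mod_cast k2.trans hD1

def cat (α : ℕ → Word S) : ℕ → Word S
  | 0 => []
  | n+1 => cat α n ++ α n

theorem cat_inf (α : ℕ → Word S) {N : ℕ} {u : Word S} (hu : u.length ≤ N) : ∀ n, (∀ i < n, N ≤ (α i).length) →
    u <:+: cat α n → u = [] ∨ (∃ i < n, u <:+: α i) ∨ (∃ i, i + 1 < n ∧ u <:+: α i ++ α (i+1))
  | 0, _, h => by left; simpa [cat] using h
  | n+1, hN, h => by
    rw [cat, List.infix_append_iff] at h
    rcases h with h | h | ⟨t1, t2, rfl, h1, h2⟩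
    · rcases cat_inf α hu n (fun i hi => hN i (by omega)) h with h | ⟨i, hi, h⟩ | ⟨i, hi, h⟩
      · exact Or.inl h
      · exact Or.inr (Or.inl ⟨i, by omega, h⟩)
      · exact Or.inr (Or.inr ⟨i, by omega, h⟩)
    · exact Or.inr (Or.inl ⟨n, by omega, h⟩)
    · rcases n with _ | n
      · simp [cat] at h1
        subst h1
        exact Or.inr (Or.inl ⟨0, by omega, by simpa using h2.isInfix⟩)
      · have h3 : t1 <:+ α n := List.suffix_of_suffix_length_le h1 (List.suffix_append _ _) (by
          have := hN n (by omega); simp at hu; omega)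
        refine Or.inr (Or.inr ⟨n, by omega, ?_⟩)
        obtain ⟨c, hc⟩ := h3
        obtain ⟨d, hd⟩ := h2
        exact ⟨c, d, by rw [← hc, ← hd]; simp⟩

theorem cat_ev {α : ℕ → Word S} {x : ℕ → G} : ∀ n, (∀ i < n, x i * evalWord σ (α i) = x (i+1)) →
    x 0 * evalWord σ (cat α n) = x n
  | 0, _ => by simp [cat]
  | n+1, h => by
    rw [cat, ev_append, ← mul_assoc, cat_ev n (fun i hi => h i (by omega)), h n (by omega)]

theorem cat_len {α : ℕ → Word S} : ∀ n, (∀ i < n, 1 ≤ (α i).length) → n ≤ (cat α n).length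
  | 0, _ => by simp
  | n+1, h => by
    have := cat_len n (fun i hi => h i (by omega))
    have := h n (by omega)
    simp [cat]; omega

theorem cat_pw {α : ℕ → Word S} {x : ℕ → G} : ∀ n, 0 < n → (∀ i < n, x i * evalWord σ (α i) = x (i+1)) →
    ∀ j ≤ (cat α n).length, ∃ i < n, ∃ r ≤ (α i).length, pw σ (x 0) (cat α n) j = pw σ (x i) (α i) r
  | 0, h, _, _, _ => by omega
  | n+1, _, h, j, hj => by
    rcases le_or_gt (cat α n).length j with c | c
    · obtain ⟨r, rfl⟩ := Nat.exists_eq_add_of_le c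
      refine ⟨n, by omega, r, by simp [cat] at hj; omega, ?_⟩
      rw [cat, pw_app2, cat_ev n (fun i hi => h i (by omega))]
    · have hn : 0 < n := by
        rcases n with _ | n
        · simp [cat] at c
        · omega
      obtain ⟨i, hi, r, hr, e⟩ := cat_pw n hn (fun i hi => h i (by omega)) j c.le
      exact ⟨i, by omega, r, hr, by rw [cat, pw_app1 _ _ _ _ c.le, e]⟩

theorem sum_two {k i : ℕ} {F F' : ℕ → ℕ} (hi : i + 1 < k) (h : ∀ j, j ≠ i → j ≠ i + 1 → F j = F' j)
    (hs : ∑ j ∈ Finset.range k, F j ≤ ∑ j ∈ Finset.range k, F' j) : F i + F (i+1) ≤ F' i + F' (i+1) := by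
  have m1 : i ∈ Finset.range k := by simp; omega
  have m2 : i + 1 ∈ (Finset.range k).erase i := by simp; omega
  rw [← Finset.add_sum_erase _ F m1, ← Finset.add_sum_erase _ F' m1, ← Finset.add_sum_erase _ F m2,
    ← Finset.add_sum_erase _ F' m2] at hs
  have : ∑ x ∈ ((Finset.range k).erase i).erase (i+1), F x = ∑ x ∈ ((Finset.range k).erase i).erase (i+1), F' x := by
    apply Finset.sum_congr rfl
    intro j hj
    simp at hj
    exact h j hj.2.1 hj.1
  omega

theorem core (hG : Gen σ) (hQ : 1 ≤ Q) (hM : IsMorseGauge M) {D : ℕ} (hD : cc (M 3) Q ≤ D) {D1 : ℕ}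
    (hD1 : M ((1 + 4 * D : ℕ) : ℝ) ≤ D1) {N l : ℕ} (hN : 1 ≤ N) (hl : ((N + 6 * D + 3 : ℕ) : ℝ) ≤ l / Q - Q)
    {s t : ℤ} {k : ℕ} (hk : 0 < k) {c : ℕ → ℤ} (c0 : c 0 = s) (ck : c k = t)
    (hc : ∀ i < k, c i + l ≤ c (i+1) ∧ c (i+1) ≤ c i + 2 * l)
    (hloc : ∀ a b : ℤ, s ≤ a → a ≤ b → b ≤ t → b - a ≤ 4 * l → MQ σ Q M a b p) :
    ∃ w : Word S, p s * evalWord σ w = p t ∧ k ≤ w.length ∧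
      (∀ u, u <:+: w → u.length ≤ N → u = [] ∨ (Geo σ u ∧ u ∈ TT σ Q M D1)) ∧
      ∀ j ≤ w.length, ∃ m ∈ Icc s t, wordDist σ (p m) (pw σ (p s) w j) ≤ D1 := by
  have T := wd_tri (σ := σ) hG
  have Sy := wd_symm (σ := σ) hG
  have cm : ∀ i j, i ≤ j → j ≤ k → c i ≤ c j := by
    intro i j hij
    induction j, hij using Nat.le_induction with
    | base => intro _; exact le_rfl
    | succ j hj ih => intro h; have := hc j (by omega); have := ih (by omega); omega
  have cs : ∀ i ≤ k, s ≤ c i := fun i hi => c0 ▸ cm 0 i (by omega) hi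
  have ct : ∀ i ≤ k, c i ≤ t := fun i hi => ck ▸ cm i k hi le_rfl
  have far : ∀ i j, i < j → j ≤ k → c j - c i ≤ 4 * l → N + 6 * D + 3 ≤ wordDist σ (p (c i)) (p (c j)) := by
    intro i j hij hj h4
    have h1 := hloc (c i) (c j) (cs i (by omega)) (cm i j (by omega) hj) (ct j hj) h4
    have h2 := (h1.1.2 (c i) ⟨le_rfl, cm i j hij.le hj⟩ (c j) ⟨cm i j hij.le hj, le_rfl⟩).1
    have h3 : (l:ℝ) ≤ |(c j : ℝ) - c i| := by
      refine le_trans ?_ (le_abs_self _)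
      have := (hc i (by omega)).1
      have := cm (i+1) j (by omega) hj
      have : (l:ℤ) ≤ c j - c i := by omega
      exact_mod_cast this
    have h4 : (l:ℝ)/Q ≤ |(c j : ℝ) - c i| / Q := by gcongr
    have : ((N + 6 * D + 3 : ℕ) : ℝ) ≤ wordDist σ (p (c i)) (p (c j)) := by linarith
    exact_mod_cast this
  set V : Set (ℕ → G) := {x | x 0 = p s ∧ x k = p t ∧ ∀ i ≤ k, wordDist σ (p (c i)) (x i) ≤ D} with hV
  set f : (ℕ → G) → ℕ := fun x => ∑ j ∈ Finset.range k, wordDist σ (x j) (x (j+1)) with hf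
  obtain ⟨x, ⟨x0, xk, xD⟩, hmin⟩ : ∃ x ∈ V, ∀ y ∈ V, f x ≤ f y := by
    have : (f '' V).Nonempty := ⟨_, fun i => p (c i), ⟨by simp [c0], by simp [ck], fun i _ => by simp [wd_self]⟩, rfl⟩
    obtain ⟨x, hx, h⟩ := Nat.sInf_mem this
    exact ⟨x, hx, fun y hy => h ▸ Nat.sInf_le ⟨y, hy, rfl⟩⟩
  choose α hα1 hα2 using fun i => wd_ex hG (x i) (x (i+1))
  have gα : ∀ i, Geo σ (α i) := fun i => geo_of hG (hα1 i) (hα2 i)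
  have lα : ∀ i < k, N ≤ (α i).length := by
    intro i hi
    have h1 := far i (i+1) (by omega) (by omega) (by have := hc i hi; omega)
    have h2 := xD i (by omega)
    have h3 := xD (i+1) (by omega)
    have h4 := T (p (c i)) (x i) (p (c (i+1)))
    have h5 := T (x i) (x (i+1)) (p (c (i+1)))
    have h6 := Sy (x (i+1)) (p (c (i+1)))
    have h7 := hα1 i
    omega
  have gα2 : ∀ i, i + 1 < k → Geo σ (α i ++ α (i+1)) := by
    intro i hi
    have e : x i * evalWord σ (α i ++ α (i+1)) = x (i+2) := by
      rw [ev_append, ← mul_assoc, hα2, hα2]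
    refine geo_of hG ?_ e
    obtain ⟨γ, g1, g2⟩ := wd_ex hG (x i) (x (i+2))
    have b1 := hc i (by omega)
    have b2 := hc (i+1) hi
    have f1 := far i (i+1) (by omega) (by omega) (by omega)
    have f2 := far (i+1) (i+2) (by omega) (by omega) (by show c (i+1+1) - _ ≤ _; omega)
    have f3 := far i (i+2) (by omega) (by omega) (by show c (i+1+1) - _ ≤ _; omega)
    have mq := hloc (c i) (c (i+2)) (cs i (by omega)) (cm _ _ (by omega) (by omega)) (ct _ (by omega))
      (by show c (i+1+1) - _ ≤ _; omega)
    obtain ⟨r, hr, hrD⟩ := midl hG hQ hM mq hD (m := c (i+1)) ⟨by omega, by show _ ≤ c (i+1+1); omega⟩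
      (geo_of hG g1 g2) (xD i (by omega)) (by rw [g2]; exact xD _ (by omega)) (by omega) (by omega) (by omega)
    have hy : Function.update x (i+1) (pw σ (x i) γ r) ∈ V := by
      refine ⟨?_, ?_, ?_⟩
      · rw [Function.update_of_ne (by omega), x0]
      · rw [Function.update_of_ne (by omega), xk]
      · intro j hj
        rcases eq_or_ne j (i+1) with rfl | hne
        · rw [Function.update_self]; exact hrD
        · rw [Function.update_of_ne hne]; exact xD j hj
    have := sum_two hi (fun j h1 h2 => by
      rw [Function.update_of_ne h2, Function.update_of_ne (by omega)]) (hmin _ hy)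
    rw [Function.update_self, Function.update_of_ne (by omega), Function.update_of_ne (by omega)] at this
    have d1 := (geo_of hG g1 g2).pwd hG (x i) (Nat.zero_le r) hr
    have d2 := (geo_of hG g1 g2).pwd hG (x i) hr le_rfl
    rw [pw_zero] at d1
    rw [pw_end _ _ le_rfl, g2] at d2
    have d3 := T (x i) (x (i+1)) (x (i+2))
    have e1 := hα1 i
    have e2 := hα1 (i+1)
    have e3 : wordDist σ (x (i+1)) (x (i+1+1)) = wordDist σ (x (i+1)) (x (i+2)) := rfl
    have e4 : wordDist σ (pw σ (x i) γ r) (x (i+1+1)) = wordDist σ (pw σ (x i) γ r) (x (i+2)) := rfl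
    rw [List.length_append]
    omega
  have mq1 : ∀ i < k, MQ σ Q M (c i) (c (i+1)) p := fun i hi => by
    have := hc i hi
    exact hloc _ _ (cs i (by omega)) (by omega) (ct _ (by omega)) (by omega)
  have mq2 : ∀ i, i + 1 < k → MQ σ Q M (c i) (c (i+2)) p := fun i hi => by
    have b1 := hc i (by omega)
    have b2 : _ ∧ c (i+2) ≤ _ := hc (i+1) hi
    exact hloc _ _ (cs i (by omega)) (cm _ _ (by omega) (by omega)) (ct _ (by omega)) (by omega)
  refine ⟨cat α k, ?_, cat_len k (fun i hi => hN.trans (lα i hi)), ?_, ?_⟩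
  · rw [← x0, cat_ev (x := x) k (fun i _ => hα2 i), xk]
  · intro u hu hul
    rcases cat_inf α hul k lα hu with h | ⟨i, hi, h⟩ | ⟨i, hi, h⟩
    · exact Or.inl h
    · refine Or.inr (blockTT hG (mq1 i hi) (cm _ _ (by omega) (by omega)) hD1 (gα i) (xD i (by omega)) ?_ h)
      rw [hα2]; exact xD _ (by omega)
    · refine Or.inr (blockTT hG (mq2 i hi) (cm _ _ (by omega) (by omega)) hD1 (gα2 i hi) (xD i (by omega)) ?_ h)
      rw [ev_append, ← mul_assoc, hα2, hα2]; exact xD _ (by omega)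
  · intro j hj
    obtain ⟨i, hi, r, hr, e⟩ := cat_pw (σ := σ) (x := x) k hk (fun i _ => hα2 i) j hj
    obtain ⟨m, hm, h⟩ := near hG (mq1 i hi) (cm _ _ (by omega) (by omega)) (gα i) (xD i (by omega))
      (by rw [hα2]; exact xD _ (by omega)) r hr
    refine ⟨m, ⟨(cs i (by omega)).trans hm.1, hm.2.trans (ct _ (by omega))⟩, ?_⟩
    rw [← x0, e]
    exact_mod_cast h.trans hD1

theorem red_of {N : ℕ} (hN : 2 ≤ N) {w : Word S} (h : ∀ u, u <:+: w → u.length ≤ N → Red u) : Red w := by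
  rw [Red, List.isChain_iff_forall_rel_of_append_cons_cons]
  rintro a b l1 l2 rfl
  have := h [a, b] ⟨l1, l2, by simp⟩ (by simpa using hN)
  simpa [Red] using this

theorem partition (l : ℕ) (hl : 1 ≤ l) (s t : ℤ) (hst : s + l ≤ t) : ∃ (k : ℕ) (c : ℕ → ℤ), 0 < k ∧ c 0 = s ∧ c k = t ∧
    (∀ i < k, c i + l ≤ c (i+1) ∧ c (i+1) ≤ c i + 2 * l) ∧ t - s ≤ 2 * l * k := by
  obtain ⟨d, hd⟩ := Int.eq_ofNat_of_zero_le (show 0 ≤ t - s by omega)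
  have h1 : d / l * l ≤ d := Nat.div_mul_le_self d l
  have h2 : d < (d / l + 1) * l := by
    have := Nat.lt_div_mul_add (a := d) (b := l) hl
    rw [add_mul]; omega
  have hk : 0 < d / l := Nat.div_pos (by omega) hl
  set k := d / l
  refine ⟨k, fun i => if i < k then s + i * l else t, hk, by simp [hk], by simp, ?_, ?_⟩
  · intro i hi
    simp only [hi, if_true]
    split_ifs with h
    · push_cast; constructor <;> nlinarith
    · have : k = i + 1 := by omega
      rw [this] at h1 h2
      zify at h1 h2
      constructor <;> nlinarith
  · zify at h2
    have : (1:ℤ) ≤ k := by exact_mod_cast hk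
    have : (1:ℤ) ≤ l := by exact_mod_cast hl
    nlinarith

theorem partD (hR : SC σ R) (hU : Uni σ R) (hG : Gen σ) (h : CaySigmaCompact σ) : CayMLTG σ := by
  intro Q hQ M hM
  obtain ⟨ns, hns⟩ := d1 hR hU hG h
  set D : ℕ := ⌈cc (M 3) Q⌉₊ with hDd
  have hD : cc (M 3) Q ≤ D := Nat.le_ceil _
  set D1 : ℕ := ⌈M ((1 + 4 * D : ℕ) : ℝ)⌉₊
  have hD1 : M ((1 + 4 * D : ℕ) : ℝ) ≤ D1 := Nat.le_ceil _
  obtain ⟨φ0, hφ0, hT⟩ := phi_ex (R := R) (TT σ Q M D1) (tbound hR hU hG hQ hM D1)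
  obtain ⟨φ, hφ, N0, hd2⟩ := d2 hns hφ0
  obtain ⟨M2, hM2, hw2⟩ := w2 hR hU hG hφ
  set N := N0 + 2
  set l : ℕ := ⌈Q * ((N + 6 * D + 3 : ℕ) + Q)⌉₊ with hld
  have hl1 : Q * ((N + 6 * D + 3 : ℕ) + Q) ≤ l := Nat.le_ceil _
  have hQ0 : 0 < Q := by linarith
  have hl2 : ((N + 6 * D + 3 : ℕ) : ℝ) ≤ l / Q - Q := by
    rw [le_sub_iff_add_le, le_div_iff₀ hQ0]; linarith
  have hl : 1 ≤ l := by
    rw [Nat.one_le_iff_ne_zero, hld]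
    have : 0 < ⌈Q * ((N + 6 * D + 3 : ℕ) + Q)⌉₊ := Nat.ceil_pos.2 (by positivity)
    omega
  have hlR : (1:ℝ) ≤ l := by exact_mod_cast hl
  refine ⟨4 * l, Q + 4 * l, fun x => M x + M2 x + D1, by positivity, by linarith, ?_, ?_⟩
  · obtain ⟨m1, m2, m3⟩ := hM
    obtain ⟨n1, n2, n3⟩ := hM2
    refine ⟨?_, ?_, ?_⟩
    · intro x hx y hy hxy
      have e1 := m1 hx hy hxy
      have e2 := n1 hx hy hxy
      show M x + M2 x + D1 ≤ M y + M2 y + D1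
      linarith
    · exact (m2.add n2).add continuousOn_const
    · intro x hx
      have e1 := m3 x hx
      have e2 := n3 x hx
      have e3 : (0:ℝ) ≤ D1 := Nat.cast_nonneg _
      show 0 ≤ M x + M2 x + D1
      linarith
  intro I hI p hp
  have hloc : ∀ s ∈ I, ∀ t ∈ I, ∀ a b : ℤ, s ≤ a → a ≤ b → b ≤ t → b - a ≤ 4 * l → MQ σ Q M a b p := by
    intro s hs t ht a b h1 h2 h3 h4
    exact hp a (hI.out hs ht ⟨h1, by omega⟩) b (hI.out hs ht ⟨by omega, h3⟩) h2 (by exact_mod_cast h4)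
  have key : ∀ s ∈ I, ∀ t ∈ I, s + l ≤ t → ∃ w : Word S, Red w ∧ Ov R w ∧ Small R φ w ∧
      p s * evalWord σ w = p t ∧ t - s ≤ 2 * l * w.length ∧
      ∀ j ≤ w.length, ∃ m ∈ Icc s t, wordDist σ (p m) (pw σ (p s) w j) ≤ D1 := by
    intro s hs t ht hst
    obtain ⟨k, c, hk, c0, ck, hc, hkl⟩ := partition l hl s t hst
    obtain ⟨w, h1, h2, h3, h4⟩ := core hG hQ hM hD hD1 (by omega : 1 ≤ N) hl2 hk c0 ck hc (hloc s hs t ht)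
    obtain ⟨o1, o2⟩ := hd2 w (by
      intro t ρ ht hρ hp hl
      rcases h3 t ht (by have := hp.length_le; omega) with rfl | ⟨g1, g2⟩
      · simp
      · exact ⟨g1.ov hR t ρ (List.infix_refl _) hρ hp, hT t g2 ρ hρ hp⟩)
    refine ⟨w, red_of (by omega : 2 ≤ N) (fun u hu hul => ?_), o1, o2, h1, ?_, h4⟩
    · rcases h3 u hu hul with rfl | ⟨g1, _⟩
      · simp [Red]
      · exact g1.red
    · have : (k:ℤ) ≤ w.length := by exact_mod_cast h2
      nlinarith
  have hpath : DIsPath σ I p := by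
    intro n h1 h2
    exact (hloc n h1 _ h2 n (n+1) le_rfl (by omega) le_rfl (by omega)).1.1 n (by simp) (by simp)
  have hsmall : ∀ s ∈ I, ∀ t ∈ I, s ≤ t → t < s + l → MQ σ Q M s t p := fun s hs t ht h1 h2 =>
    hloc s hs t ht s t le_rfl h1 le_rfl (by omega)
  constructor
  · refine dqgeo_of hG hpath (fun m hm n hn hmn => ⟨?_, ?_⟩)
    · rcases lt_or_ge n (m + l) with c | c
      · have h1 := (hsmall m hm n hn hmn c).1.mono' hQ (by linarith : Q ≤ Q + 4 * l)
        have := (h1.2 m (by simp [hmn]) n (by simp [hmn])).1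
        rwa [abs_of_nonneg] at this
        have : (m:ℝ) ≤ n := by exact_mod_cast hmn
        linarith
      · obtain ⟨w, h1, h2, -, h3, h4, -⟩ := key m hm n hn c
        obtain ⟨q, q1, q2⟩ := wd_ex hG (p m) (p n)
        have := a1 hR hU h1 h2 (q := q) (by rw [← h3] at q2; exact mul_left_cancel q2)
        rw [q1] at this
        have e1 : (5:ℝ) * w.length ≤ 9 * wordDist σ (p m) (p n) := by exact_mod_cast this
        have e2 : (n:ℝ) - m ≤ 2 * l * w.length := by exact_mod_cast h4
        have : ((n:ℝ) - m) / (Q + 4 * l) ≤ wordDist σ (p m) (p n) := by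
          rw [div_le_iff₀ (by positivity)]
          have : (0:ℝ) ≤ wordDist σ (p m) (p n) := Nat.cast_nonneg _
          nlinarith
        linarith
    · obtain ⟨u, u1, u2, -⟩ := path_word0 hmn hG (fun i h1 h2 => hpath i (hI.out hm hn h1) (hI.out hm hn h2))
      have e1 : (wordDist σ (p m) (p n) : ℝ) ≤ u.length := by exact_mod_cast wd_le u2
      have e2 : (u.length : ℝ) ≤ n - m := by exact_mod_cast u1
      have e3 : (m:ℝ) ≤ n := by exact_mod_cast hmn
      nlinarith
  · intro Q1 hQ1 s hs t ht hst q a b hab hq hqa hqb n hn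
    have p1 := hM.2.2 Q1 hQ1
    have p2 := hM2.2.2 Q1 hQ1
    have p3 : (0:ℝ) ≤ D1 := Nat.cast_nonneg _
    rcases lt_or_ge t (s + l) with c | c
    · obtain ⟨m, hm, h1⟩ := (hsmall s hs t ht hst c).2 Q1 hQ1 s (by simp [hst]) t (by simp [hst]) hst q a b hab hq hqa hqb n hn
      exact ⟨m, hm, by show _ ≤ M Q1 + M2 Q1 + D1; linarith⟩
    · obtain ⟨w, h1, h2, h3, h4, -, h6⟩ := key s hs t ht c
      obtain ⟨k, hk, h7⟩ := hw2 w h1 h2 h3 (p s) Q1 q a b hQ1 hab hq hqa (by rw [hqb, h4]) n hn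
      obtain ⟨m, hm, h8⟩ := h6 k hk
      refine ⟨m, hm, ?_⟩
      have e1 := wd_tri hG (q n) (pw σ (p s) w k) (p m)
      rw [wd_symm hG (pw σ (p s) w k) (p m)] at e1
      have e2 : (wordDist σ (q n) (p m) : ℝ) ≤ wordDist σ (q n) (pw σ (p s) w k) + wordDist σ (p m) (pw σ (p s) w k) := by
        exact_mod_cast e1
      have e3 : (wordDist σ (p m) (pw σ (p s) w k) : ℝ) ≤ D1 := by exact_mod_cast h8
      show _ ≤ M Q1 + M2 Q1 + D1
      linarith

end PartF
end MorseLTG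

open MorseLTG in
/-- for a `C'(1/9)` group, MLTG, σ-compactness and strong
σ-compactness of the Morse boundary are all equivalent. -/
theorem stmt1 {S : Type*} [Fintype S] (R : Set (Word S))
    (hsc : SmallCancellation R (1 / 9)) :
    (CayMLTG (presGen R) ↔ CaySigmaCompact (presGen R)) ∧
      (CaySigmaCompact (presGen R) ↔ CayStronglySigmaCompact (presGen R)) := by
  have hR := scPres R hsc
  have hD : CaySigmaCompact (presGen R) → CayMLTG (presGen R) := fun h =>
    partD hR (uniPres R) (genPres R) h
  exact ⟨⟨fun h => partC2 (partC (genPres R) h), hD⟩, ⟨fun h => partC (genPres R) (hD h), partC2⟩⟩
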